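/- There exists a universal constant C such that for every finite irreducible reversible chain P and every k, max over starting states x_1,…,x_k of the expected cover time by k independent chains satisfies E_{x_1,…,x_k}[τ_cov(k)] ≤ C·(t_mix + t_cov/k), where t_mix is the total-variation mixing time of the lazy chain (P+I)/2. -/

import Mathlib

open scoped BigOperators

/- `pathSum P x t A`: probability, for the chain with transition matrix `P` started
at `x`, of the event `A` about the first `t+1` positions of the trajectory. -/
open Classical in
noncomputable def pathSum {V : Type*} [Fintype V] (P : V → V → ℝ) (x : V) (t : ℕ)
    (A : (Fin (t+1) → V) → Prop) : ℝ :=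
  ∑ w : Fin (t+1) → V,
    if w 0 = x ∧ A w then ∏ i : Fin t, P (w i.castSucc) (w i.succ) else 0

/-- `P_x(τ_cov > t)`: the chain started at `x` has not visited every state by time `t`. -/
noncomputable def coverTail {V : Type*} [Fintype V] (P : V → V → ℝ) (x : V) (t : ℕ) : ℝ :=
  pathSum P x t (fun w => ¬ ∀ v : V, ∃ i, w i = v)

/-- `E_x[τ_cov]`, the expected cover time started from `x`. -/
noncomputable def expCov {V : Type*} [Fintype V] (P : V → V → ℝ) (x : V) : ℝ :=
  ∑' t : ℕ, coverTail P x t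

/-- `t_cov = max_x E_x[τ_cov]`. -/
noncomputable def tcov {V : Type*} [Fintype V] [Nonempty V] (P : V → V → ℝ) : ℝ :=
  ⨆ x : V, expCov P x

/-- `E_{x_1,…,x_k}[τ_cov(k)]`: the expected first time that `k` independent copies of
the chain, started from `x0 = (x_1,…,x_k)`, have jointly visited every state of `V`. -/
noncomputable def multiExpCov {V : Type*} [Fintype V] (P : V → V → ℝ)
    (k : ℕ) (x0 : Fin k → V) : ℝ :=
  ∑' t : ℕ, pathSum (fun a b : Fin k → V => ∏ i, P (a i) (b i)) x0 t
    (fun w => ¬ ∀ v : V, ∃ (i : Fin k) (t' : Fin (t+1)), w t' i = v)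

/-- The total variation mixing time `t_mix = min{t : max_x ‖P_L^t(x,·) − π‖_TV ≤ 1/4}`
of the lazy chain `P_L = (P+I)/2`. -/
noncomputable def tmix {V : Type*} [Fintype V] [DecidableEq V]
    (P : V → V → ℝ) (π : V → ℝ) : ℕ :=
  sInf {t : ℕ | ∀ x,
    (1 / 2) * ∑ y, |(((2:ℝ)⁻¹ • (Matrix.of P + 1)) ^ t) x y - π y| ≤ 1 / 4}


section UnionZeta
variable {ι : Type*} [Fintype ι] [DecidableEq ι]

/-- zeta transform -/
def uz (f : Finset ι → ℝ) (W : Finset ι) : ℝ := ∑ S, if S ⊆ W then f S else 0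

lemma uz_inj {f g : Finset ι → ℝ} (h : ∀ W, uz f W = uz g W) : f = g := by
  funext S
  induction S using Finset.strongInduction with
  | H S ih =>
    have := h S
    unfold uz at this
    rw [← Finset.add_sum_erase _ _ (Finset.mem_univ S),
      ← Finset.add_sum_erase (a := S) _ (fun T => if T ⊆ S then g T else 0) (Finset.mem_univ S)] at this
    have e : ∑ x ∈ Finset.univ.erase S, (if x ⊆ S then f x else 0)
        = ∑ x ∈ Finset.univ.erase S, (if x ⊆ S then g x else 0) := by
      apply Finset.sum_congr rfl
      intro x hx
      split_ifs with hs
      · exact ih x (lt_of_le_of_ne hs (Finset.ne_of_mem_erase hx))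
      · rfl
    simp only [subset_refl, if_true] at this
    linarith

def cv (g k : Finset ι → ℝ) (S : Finset ι) : ℝ :=
  ∑ T, ∑ T', if T ∪ T' = S then g T * k T' else 0

lemma cv_sum (g k : Finset ι → ℝ) (Φ : Finset ι → ℝ) :
    ∑ S, cv g k S * Φ S = ∑ T, ∑ T', g T * k T' * Φ (T ∪ T') := by
  unfold cv
  simp_rw [Finset.sum_mul]
  rw [Finset.sum_comm]
  refine Finset.sum_congr rfl fun T _ => ?_
  rw [Finset.sum_comm]
  refine Finset.sum_congr rfl fun T' _ => ?_
  simp [ite_mul]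

lemma uz_eq_sum (f : Finset ι → ℝ) (W : Finset ι) :
    uz f W = ∑ S, f S * (if S ⊆ W then 1 else 0) := by
  simp [uz]

lemma uz_cv (g k : Finset ι → ℝ) (W : Finset ι) : uz (cv g k) W = uz g W * uz k W := by
  rw [uz_eq_sum, cv_sum, uz_eq_sum, uz_eq_sum, Finset.sum_mul_sum]
  refine Finset.sum_congr rfl fun T _ => Finset.sum_congr rfl fun T' _ => ?_
  by_cases h1 : T ⊆ W <;> by_cases h2 : T' ⊆ W <;> simp [Finset.union_subset_iff, h1, h2]

lemma conv_sum {f g k : Finset ι → ℝ} (h : ∀ W, uz f W = uz g W * uz k W) (Φ : Finset ι → ℝ) :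
    ∑ S, f S * Φ S = ∑ T, ∑ T', g T * k T' * Φ (T ∪ T') := by
  have : f = cv g k := uz_inj fun W => by rw [h, uz_cv]
  rw [this, cv_sum]

lemma cv_nonneg {g k : Finset ι → ℝ} (hg : ∀ S, 0 ≤ g S) (hk : ∀ S, 0 ≤ k S) (S : Finset ι) :
    0 ≤ cv g k S := by
  unfold cv
  refine Finset.sum_nonneg fun T _ => Finset.sum_nonneg fun T' _ => ?_
  split_ifs
  · exact mul_nonneg (hg _) (hk _)
  · exact le_rfl

lemma pois_exists (n : Finset ι → ℝ) (hn : ∀ A, 0 ≤ n A) (s : Finset (Finset ι)) :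
    ∃ p : Finset ι → ℝ, (∀ S, 0 ≤ p S) ∧
      (∀ W, uz p W = Real.exp (-∑ A ∈ s, if A ⊆ W then 0 else n A)) ∧
      (∀ good : Finset ι → Prop, good ∅ → (∀ S T, good S → good T → good (S ∪ T)) →
        (∀ A, n A ≠ 0 → good A) → ∀ S, p S ≠ 0 → good S) := by
  classical
  induction s using Finset.induction with
  | empty =>
    refine ⟨fun S => if S = ∅ then 1 else 0, ?_, ?_, ?_⟩
    · intro S; dsimp only; split_ifs <;> norm_num
    · intro W
      simp only [uz]
      rw [Finset.sum_eq_single ∅] <;> simp_all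
    · intro good h0 _ _ S hS
      by_cases h : S = ∅
      · rw [h]; exact h0
      · simp [h] at hS
  | insert A s hA ih =>
    obtain ⟨p, hp0, hpz, hpg⟩ := ih
    let c := n A
    let d : Finset ι → ℝ := fun S =>
      (if S = ∅ then Real.exp (-c) else 0) + (if S = A then 1 - Real.exp (-c) else 0)
    have hexp : Real.exp (-c) ≤ 1 := Real.exp_le_one_iff.2 (by simpa [c] using hn A)
    have hd : ∀ S, 0 ≤ d S := by
      intro S
      have := Real.exp_pos (-c)
      simp only [d]
      split_ifs <;> linarith
    refine ⟨cv d p, cv_nonneg hd hp0, ?_, ?_⟩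
    · intro W
      rw [uz_cv, hpz, Finset.sum_insert hA, neg_add, Real.exp_add]
      congr 1
      have : uz d W = (∑ S, if S = ∅ then (if S ⊆ W then Real.exp (-c) else 0) else 0)
          + (∑ S, if S = A then (if S ⊆ W then 1 - Real.exp (-c) else 0) else 0) := by
        rw [← Finset.sum_add_distrib]
        refine Finset.sum_congr rfl fun S _ => ?_
        simp only [d]
        split_ifs <;> simp
      rw [this, Finset.sum_ite_eq', Finset.sum_ite_eq']
      by_cases h : A ⊆ W <;> simp [h, c]
    · intro good h0 hU hG S hS
      unfold cv at hS
      obtain ⟨T, -, hT⟩ := Finset.exists_ne_zero_of_sum_ne_zero hS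
      obtain ⟨T', -, hT'⟩ := Finset.exists_ne_zero_of_sum_ne_zero hT
      split_ifs at hT' with h
      · rw [← h]
        have h1 : d T ≠ 0 := left_ne_zero_of_mul hT'
        have h2 : p T' ≠ 0 := right_ne_zero_of_mul hT'
        refine hU _ _ ?_ (hpg good h0 hU hG T' h2)
        by_cases e1 : T = ∅
        · rw [e1]; exact h0
        · by_cases e2 : T = A
          · rw [e2]
            apply hG
            intro hc
            apply h1
            simp [d, e1, c, hc]
          · simp [d, e1, e2] at h1
      · exact absurd rfl hT'

open Classical in
/-- law of the union of a Poisson process of sets with intensity `n` -/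
noncomputable def pois (n : Finset ι → ℝ) : Finset ι → ℝ :=
  if hn : ∀ A, 0 ≤ n A then (pois_exists n hn Finset.univ).choose else fun _ => 0

lemma pois_nonneg (n : Finset ι → ℝ) (S : Finset ι) : 0 ≤ pois n S := by
  unfold pois
  split_ifs with hn
  · exact (pois_exists n hn Finset.univ).choose_spec.1 S
  · exact le_rfl

lemma uz_pois {n : Finset ι → ℝ} (hn : ∀ A, 0 ≤ n A) (W : Finset ι) :
    uz (pois n) W = Real.exp (-∑ A, if A ⊆ W then 0 else n A) := by
  unfold pois
  rw [dif_pos hn]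
  exact (pois_exists n hn Finset.univ).choose_spec.2.1 W

lemma uz_pois' {n : Finset ι → ℝ} (hn : ∀ A, 0 ≤ n A) (W : Finset ι) :
    uz (pois n) W = Real.exp (uz n W - ∑ A, n A) := by
  rw [uz_pois hn]
  congr 1
  rw [uz, ← Finset.sum_sub_distrib, ← Finset.sum_neg_distrib]
  refine Finset.sum_congr rfl fun A _ => ?_
  split_ifs <;> simp

lemma pois_good {n : Finset ι → ℝ} (hn : ∀ A, 0 ≤ n A) (good : Finset ι → Prop) (h0 : good ∅)
    (hU : ∀ S T, good S → good T → good (S ∪ T)) (hG : ∀ A, n A ≠ 0 → good A) (S : Finset ι)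
    (hS : pois n S ≠ 0) : good S := by
  unfold pois at hS
  rw [dif_pos hn] at hS
  exact (pois_exists n hn Finset.univ).choose_spec.2.2 good h0 hU hG S hS

lemma pois_sum {n : Finset ι → ℝ} (hn : ∀ A, 0 ≤ n A) : ∑ S, pois n S = 1 := by
  have := uz_pois hn Finset.univ
  simpa [uz] using this

/-- probability that the set `B` is not covered under the law `f` -/
def fl (f : Finset ι → ℝ) (B : Finset ι) : ℝ := ∑ S, f S * (if B ⊆ S then 0 else 1)

lemma fl_nonneg {f : Finset ι → ℝ} (hf : ∀ S, 0 ≤ f S) (B : Finset ι) : 0 ≤ fl f B := by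
  refine Finset.sum_nonneg fun S _ => mul_nonneg (hf S) ?_
  split_ifs <;> norm_num

lemma fl_le {f : Finset ι → ℝ} (hf : ∀ S, 0 ≤ f S) (B : Finset ι) : fl f B ≤ ∑ S, f S := by
  refine Finset.sum_le_sum fun S _ => ?_
  split_ifs <;> simp [hf S]

lemma fl_mono {f : Finset ι → ℝ} (hf : ∀ S, 0 ≤ f S) {B B' : Finset ι} (h : B ⊆ B') :
    fl f B ≤ fl f B' := by
  refine Finset.sum_le_sum fun S _ => mul_le_mul_of_nonneg_left ?_ (hf S)
  split_ifs with h1 h2 h2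
  · exact le_rfl
  · norm_num
  · exact absurd (h.trans h2) h1
  · exact le_rfl

lemma fl_empty (f : Finset ι → ℝ) : fl f ∅ = 0 := by simp [fl]

lemma fl_conv {f g k : Finset ι → ℝ} (h : ∀ W, uz f W = uz g W * uz k W) (B : Finset ι) :
    fl f B = ∑ T, g T * fl k (B \ T) := by
  unfold fl
  rw [conv_sum h]
  refine Finset.sum_congr rfl fun T _ => ?_
  rw [Finset.mul_sum]
  refine Finset.sum_congr rfl fun T' _ => ?_
  rw [mul_assoc]
  congr 3
  exact propext (sdiff_le_iff (a := B) (b := T) (c := T')).symm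

/-- failure probability of the Poisson process -/
noncomputable def FF (n : Finset ι → ℝ) (B : Finset ι) : ℝ := fl (pois n) B

lemma FF_nonneg (n : Finset ι → ℝ) (B : Finset ι) : 0 ≤ FF n B := fl_nonneg (pois_nonneg n) B

lemma FF_le_one {n : Finset ι → ℝ} (hn : ∀ A, 0 ≤ n A) (B : Finset ι) : FF n B ≤ 1 :=
  (fl_le (pois_nonneg n) B).trans (pois_sum hn).le

lemma uz_pois_add {n n' : Finset ι → ℝ} (hn : ∀ A, 0 ≤ n A) (hn' : ∀ A, 0 ≤ n' A) (W) :
    uz (pois (n + n')) W = uz (pois n) W * uz (pois n') W := by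
  rw [uz_pois hn, uz_pois hn', uz_pois (n := n + n') (fun A => add_nonneg (hn A) (hn' A)), ← Real.exp_add,
    ← neg_add, ← Finset.sum_add_distrib]
  congr 2
  refine Finset.sum_congr rfl fun A _ => ?_
  split_ifs <;> simp

lemma FF_add {n n' : Finset ι → ℝ} (hn : ∀ A, 0 ≤ n A) (hn' : ∀ A, 0 ≤ n' A) (B : Finset ι) :
    FF (n + n') B = ∑ T, pois n T * FF n' (B \ T) :=
  fl_conv (uz_pois_add hn hn') B

lemma FF_add_le_mul {n n' : Finset ι → ℝ} (hn : ∀ A, 0 ≤ n A) (hn' : ∀ A, 0 ≤ n' A)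
    (B : Finset ι) : FF (n + n') B ≤ FF n B * FF n' B := by
  rw [FF_add hn hn', FF, fl, Finset.sum_mul]
  refine Finset.sum_le_sum fun T _ => ?_
  rw [mul_assoc]
  refine mul_le_mul_of_nonneg_left ?_ (pois_nonneg n T)
  split_ifs with h
  · rw [Finset.sdiff_eq_empty_iff_subset.2 h, FF, fl_empty, zero_mul]
  · rw [one_mul]
    exact fl_mono (pois_nonneg n') Finset.sdiff_subset

lemma FF_anti {n n' : Finset ι → ℝ} (hn : ∀ A, 0 ≤ n A) (h : ∀ A, n A ≤ n' A) (B : Finset ι) :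
    FF n' B ≤ FF n B := by
  have h2 : ∀ A, 0 ≤ (n' - n) A := fun A => sub_nonneg.2 (h A)
  have := FF_add_le_mul hn h2 B
  rw [add_sub_cancel] at this
  exact this.trans (mul_le_of_le_one_right (FF_nonneg _ _) (FF_le_one h2 B))

lemma FF_add_ge {n n' : Finset ι → ℝ} (hn : ∀ A, 0 ≤ n A) (hn' : ∀ A, 0 ≤ n' A)
    (B : Finset ι) : Real.exp (-∑ A, n' A) * FF n B ≤ FF (n + n') B := by
  rw [add_comm, FF_add hn' hn]
  refine le_trans ?_ (Finset.single_le_sum (f := fun T => pois n' T * FF n (B \ T))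
    (fun T _ => mul_nonneg (pois_nonneg _ _) (FF_nonneg _ _)) (Finset.mem_univ ∅))
  simp only [Finset.sdiff_empty]
  refine mul_le_mul_of_nonneg_right ?_ (FF_nonneg _ _)
  have := uz_pois' hn' ∅
  have e : uz (pois n') ∅ = pois n' ∅ := by
    simp [uz, Finset.subset_empty]
  rw [← e, this]
  apply Real.exp_le_exp.2
  have : 0 ≤ uz n' ∅ := Finset.sum_nonneg fun S _ => by split_ifs <;> simp [hn']
  linarith

lemma FF_le_exp {n : Finset ι → ℝ} (hn : ∀ A, 0 ≤ n A) (B : Finset ι) :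
    FF n B ≤ Real.exp (-n Finset.univ) := by
  classical
  set d : Finset ι → ℝ := fun S => if S = Finset.univ then n Finset.univ else 0 with hd
  have hd0 : ∀ S, 0 ≤ d S := fun S => by simp only [hd]; split_ifs <;> simp [hn]
  have h1 : FF n B ≤ FF d B := FF_anti hd0 (fun A => by
    simp only [hd]; split_ifs with h
    · rw [h]
    · exact hn A) B
  refine h1.trans ?_
  have e : uz (pois d) ∅ = pois d ∅ := by simp [uz, Finset.subset_empty]
  have h3 : pois d ∅ ≤ Real.exp (-n Finset.univ) ∨ (Finset.univ : Finset ι) = ∅ := by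
    by_cases hu : (Finset.univ : Finset ι) = ∅
    · exact Or.inr hu
    left
    rw [← e, uz_pois hd0]
    apply Real.exp_le_exp.2
    apply neg_le_neg
    refine le_trans ?_ (Finset.single_le_sum (f := fun A => if A ⊆ ∅ then 0 else d A)
      (fun T _ => by split_ifs <;> simp [hd0]) (Finset.mem_univ Finset.univ))
    simp [hd, Finset.subset_empty, hu]
  rcases h3 with h3 | h3
  · refine le_trans ?_ h3
    unfold FF fl
    rw [← Finset.add_sum_erase _ _ (Finset.mem_univ ∅)]
    have : ∑ x ∈ Finset.univ.erase ∅, pois d x * (if B ⊆ x then 0 else 1) = 0 := by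
      refine Finset.sum_eq_zero fun S hS => ?_
      by_cases h0 : pois d S = 0
      · rw [h0, zero_mul]
      have := pois_good hd0 (fun S => S = ∅ ∨ S = Finset.univ) (Or.inl rfl)
        (fun S T hS hT => by
          rcases hS with rfl | rfl
          · simpa using hT
          · right; simp) (fun A hA => by
          right
          by_contra hne
          exact hA (by simp [hd, hne])) S h0
      rcases this with h | h
      · exact absurd h (Finset.ne_of_mem_erase hS)
      · simp [h]
    rw [this, add_zero]
    have := pois_nonneg d ∅
    split_ifs <;> simp [this]
  · have : B = ∅ := Finset.subset_empty.1 (h3 ▸ Finset.subset_univ B)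
    rw [this, FF, fl_empty]; positivity
end UnionZeta


section Sig
variable {ι : Type*} [Fintype ι] [DecidableEq ι] {W : Type*} [Fintype W]

/-- expectation -/
def ex (f Φ : Finset ι → ℝ) : ℝ := ∑ A, f A * Φ A

/-- law of the path signature -/
def sig (f0 : W → Finset ι) (f1 : W → W → Finset ι) (P : W → W → ℝ) : ℕ → W → Finset ι → ℝ
  | 0, x => fun A => if f0 x = A then 1 else 0
  | j + 1, x => fun A => ∑ y, P x y * ∑ A', if f1 x y ∪ A' = A then sig f0 f1 P j y A' else 0

variable (f0 : W → Finset ι) (f1 : W → W → Finset ι) (P : W → W → ℝ)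

lemma ex_sig_zero (x : W) (Φ : Finset ι → ℝ) : ex (sig f0 f1 P 0 x) Φ = Φ (f0 x) := by
  simp [ex, sig]

lemma ex_sig_succ (j : ℕ) (x : W) (Φ : Finset ι → ℝ) :
    ex (sig f0 f1 P (j+1) x) Φ
      = ∑ y, P x y * ex (sig f0 f1 P j y) (fun A => Φ (f1 x y ∪ A)) := by
  simp only [ex, sig]
  simp_rw [Finset.sum_mul]
  rw [Finset.sum_comm]
  refine Finset.sum_congr rfl fun y _ => ?_
  simp_rw [mul_assoc]
  rw [← Finset.mul_sum]
  congr 1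
  simp_rw [Finset.sum_mul]
  rw [Finset.sum_comm]
  refine Finset.sum_congr rfl fun A' _ => ?_
  simp [ite_mul]

lemma sig_nonneg (hP : ∀ x y, 0 ≤ P x y) (j : ℕ) (x : W) (A : Finset ι) :
    0 ≤ sig f0 f1 P j x A := by
  induction j generalizing x A with
  | zero => simp only [sig]; split_ifs <;> norm_num
  | succ j ih =>
    simp only [sig]
    refine Finset.sum_nonneg fun y _ => mul_nonneg (hP _ _) (Finset.sum_nonneg fun A' _ => ?_)
    split_ifs
    · exact ih _ _
    · exact le_rfl

lemma ex_sig_one (hP1 : ∀ x, ∑ y, P x y = 1) (j : ℕ) (x : W) :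
    ex (sig f0 f1 P j x) (fun _ => 1) = 1 := by
  induction j generalizing x with
  | zero => rw [ex_sig_zero]
  | succ j ih => rw [ex_sig_succ]; simp [ih, hP1]

lemma sig_sum (hP1 : ∀ x, ∑ y, P x y = 1) (j : ℕ) (x : W) :
    ∑ A, sig f0 f1 P j x A = 1 := by
  simpa [ex] using ex_sig_one f0 f1 P hP1 j x

lemma ex_mono {f Φ Ψ : Finset ι → ℝ} (hf : ∀ A, 0 ≤ f A) (h : ∀ A, Φ A ≤ Ψ A) :
    ex f Φ ≤ ex f Ψ := Finset.sum_le_sum fun A _ => mul_le_mul_of_nonneg_left (h A) (hf A)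

lemma uz_sig_succ (j : ℕ) (x : W) (D : Finset ι) :
    uz (sig f0 f1 P (j+1) x) D
      = ∑ y, P x y * ((if f1 x y ⊆ D then 1 else 0) * uz (sig f0 f1 P j y) D) := by
  have := ex_sig_succ f0 f1 P j x (fun S => if S ⊆ D then 1 else 0)
  rw [uz_eq_sum]
  refine this.trans ?_
  refine Finset.sum_congr rfl fun y _ => ?_
  congr 1
  rw [uz_eq_sum, Finset.mul_sum, ex]
  refine Finset.sum_congr rfl fun A _ => ?_
  by_cases h1 : f1 x y ⊆ D <;> by_cases h2 : A ⊆ D <;> simp [Finset.union_subset_iff, h1, h2]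

lemma uz_sig_zero (x : W) (D : Finset ι) :
    uz (sig f0 f1 P 0 x) D = if f0 x ⊆ D then 1 else 0 := by
  rw [uz_eq_sum]
  exact ex_sig_zero f0 f1 P x (fun S => if S ⊆ D then 1 else 0)

/-- signature for vertex observables -/
def osig (obs : W → Finset ι) (P : W → W → ℝ) : ℕ → W → Finset ι → ℝ :=
  sig obs (fun x _ => obs x) P

variable (obs : W → Finset ι)

lemma ex_osig_step {Φ : Finset ι → ℝ} (hP : ∀ x y, 0 ≤ P x y) (hP1 : ∀ x, ∑ y, P x y = 1)
    (hΦ : Antitone Φ) (t : ℕ) (x : W) :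
    ex (osig obs P (t+1) x) Φ ≤ ex (osig obs P t x) Φ := by
  induction t generalizing x Φ with
  | zero =>
    unfold osig
    rw [ex_sig_succ, ex_sig_zero]
    calc _ ≤ ∑ y, P x y * Φ (obs x) := by
          refine Finset.sum_le_sum fun y _ => mul_le_mul_of_nonneg_left ?_ (hP _ _)
          rw [ex_sig_zero]
          exact hΦ Finset.subset_union_left
      _ = _ := by rw [← Finset.sum_mul, hP1, one_mul]
  | succ t ih =>
    unfold osig at *
    rw [ex_sig_succ, ex_sig_succ]
    refine Finset.sum_le_sum fun y _ => mul_le_mul_of_nonneg_left ?_ (hP _ _)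
    exact ih (fun A B h => hΦ (Finset.union_subset_union_right h)) y

lemma ex_osig_shift {Φ : Finset ι → ℝ} (hP : ∀ x y, 0 ≤ P x y)
    (hΦ : Antitone Φ) (t : ℕ) (x : W) :
    ex (osig obs P (t+1) x) Φ ≤ ∑ y, P x y * ex (osig obs P t y) Φ := by
  unfold osig
  rw [ex_sig_succ]
  refine Finset.sum_le_sum fun y _ => mul_le_mul_of_nonneg_left ?_ (hP _ _)
  exact ex_mono (sig_nonneg _ _ _ hP _ _) fun A => hΦ Finset.subset_union_right

lemma ex_osig_anti {Φ : Finset ι → ℝ} (hP : ∀ x y, 0 ≤ P x y) (hP1 : ∀ x, ∑ y, P x y = 1)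
    (hΦ : Antitone Φ) (x : W) : Antitone (fun t => ex (osig obs P t x) Φ) :=
  antitone_nat_of_succ_le fun t => ex_osig_step P obs hP hP1 hΦ t x

lemma fl_eq_ex (f : Finset ι → ℝ) (B : Finset ι) :
    fl f B = ex f (fun S => if B ⊆ S then 0 else 1) := rfl

lemma flΦ_anti (B : Finset ι) : Antitone (fun S : Finset ι => if B ⊆ S then (0:ℝ) else 1) := by
  intro S T h
  dsimp only
  split_ifs with h1 h2 h2
  · exact le_rfl
  · norm_num
  · exact absurd (h2.trans h) h1
  · exact le_rfl

lemma fl_osig_succ (t : ℕ) (x : W) (B : Finset ι) :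
    fl (osig obs P (t+1) x) B = ∑ y, P x y * fl (osig obs P t y) (B \ obs x) := by
  rw [fl_eq_ex]
  unfold osig
  rw [ex_sig_succ]
  refine Finset.sum_congr rfl fun y _ => ?_
  rw [fl_eq_ex]
  congr 2
  funext A
  congr 1
  exact propext (sdiff_le_iff (a := B) (b := obs x) (c := A)).symm

lemma fl_markov' (hP : ∀ x y, 0 ≤ P x y) (hP1 : ∀ x, ∑ y, P x y = 1) (T : ℕ) (α : ℝ)
    (B0 : Finset ι) (h : ∀ y, fl (osig obs P T y) B0 ≤ α) (t : ℕ) (x : W) (B : Finset ι)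
    (hB0 : B ⊆ B0) :
    fl (osig obs P (T+t) x) B ≤ α * fl (osig obs P t x) B := by
  induction t generalizing x B with
  | zero =>
    have e : fl (osig obs P 0 x) B = if B ⊆ obs x then 0 else 1 := ex_sig_zero _ _ _ _ _
    have h1 : fl (osig obs P T x) B ≤ fl (osig obs P 0 x) B :=
      ex_osig_anti P obs hP hP1 (flΦ_anti B) x (Nat.zero_le T)
    rw [e] at *
    split_ifs at * with hB
    · simpa using h1
    · rw [mul_one]
      exact (fl_mono (sig_nonneg _ _ _ hP _ _) hB0).trans (h x)
  | succ t ih =>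
    rw [← add_assoc, fl_osig_succ, fl_osig_succ, Finset.mul_sum]
    refine Finset.sum_le_sum fun y _ => ?_
    rw [mul_left_comm]
    exact mul_le_mul_of_nonneg_left (ih _ _ (Finset.sdiff_subset.trans hB0)) (hP _ _)

lemma fl_markov (hP : ∀ x y, 0 ≤ P x y) (hP1 : ∀ x, ∑ y, P x y = 1) (T : ℕ) (α : ℝ)
    (h : ∀ y, fl (osig obs P T y) Finset.univ ≤ α) (t : ℕ) (x : W) (B : Finset ι) :
    fl (osig obs P (T+t) x) B ≤ α * fl (osig obs P t x) B :=
  fl_markov' P obs hP hP1 T α _ h t x B (Finset.subset_univ _)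

lemma geo_sum_bound {a : ℕ → ℝ} (h0 : ∀ n, 0 ≤ a n) (h1 : ∀ n, a n ≤ 1) (T : ℕ) {α : ℝ}
    (hα0 : 0 ≤ α) (hα : α < 1) (h : ∀ t, a (T + t) ≤ α * a t) (N : ℕ) :
    ∑ t ∈ Finset.range N, a t ≤ T / (1 - α) := by
  have e1 : ∑ t ∈ Finset.range (T + N), a t ≤ T + α * ∑ t ∈ Finset.range N, a t := by
    rw [Finset.sum_range_add]
    refine add_le_add ?_ ?_
    · calc _ ≤ ∑ t ∈ Finset.range T, (1:ℝ) := Finset.sum_le_sum fun t _ => h1 t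
        _ = T := by simp
    · rw [Finset.mul_sum]
      exact Finset.sum_le_sum fun t _ => h t
  have e2 : ∑ t ∈ Finset.range N, a t ≤ ∑ t ∈ Finset.range (T + N), a t :=
    Finset.sum_le_sum_of_subset_of_nonneg (by intro x; simp; omega) fun t _ _ => h0 t
  rw [le_div_iff₀ (by linarith)]
  nlinarith

lemma fl_osig_sum (hP : ∀ x y, 0 ≤ P x y) (hP1 : ∀ x, ∑ y, P x y = 1) (T : ℕ) (α : ℝ)
    (hα0 : 0 ≤ α) (hα : α < 1)
    (h : ∀ y, fl (osig obs P T y) Finset.univ ≤ α) (x : W) :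
    Summable (fun t => fl (osig obs P t x) Finset.univ) ∧
    ∑' t, fl (osig obs P t x) Finset.univ ≤ T / (1 - α) := by
  have h0 : ∀ t, 0 ≤ fl (osig obs P t x) Finset.univ := fun t =>
    fl_nonneg (sig_nonneg _ _ _ hP _ _) _
  have hb := geo_sum_bound h0 (fun t => (fl_le (sig_nonneg _ _ _ hP _ _) _).trans
    (sig_sum _ _ _ hP1 _ _).le) T hα0 hα (fun t => fl_markov P obs hP hP1 T α h t x _)
  exact ⟨summable_of_sum_range_le h0 hb, Real.tsum_le_of_sum_range_le h0 hb⟩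

lemma path_ex [DecidableEq W] (t : ℕ) (x : W) (Φ : Finset ι → ℝ) :
    (∑ w : Fin (t+1) → W, if w 0 = x then
      (∏ i : Fin t, P (w i.castSucc) (w i.succ)) * Φ (Finset.univ.biUnion fun i => obs (w i)) else 0)
      = ex (osig obs P t x) Φ := by
  induction t generalizing x Φ with
  | zero =>
    unfold osig
    rw [ex_sig_zero, ← (Equiv.funUnique (Fin 1) W).symm.sum_comp]
    simp [Finset.biUnion]
  | succ t ih =>
    have e := ex_sig_succ obs (fun x _ => obs x) P t x Φ
    unfold osig at *
    rw [e, ← (Fin.consEquiv (fun _ : Fin (t+2) => W)).sum_comp, Fintype.sum_prod_type]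
    simp_rw [← ih]
    rw [Finset.sum_eq_single x]
    · simp only [Fin.consEquiv, Equiv.coe_fn_mk, Fin.cons_zero, if_true]
      simp_rw [Finset.mul_sum]
      rw [Finset.sum_comm]
      refine Finset.sum_congr rfl fun w _ => ?_
      rw [Finset.sum_eq_single (w 0)]
      · rw [if_pos rfl, Fin.prod_univ_succ]
        simp only [Fin.castSucc_zero, Fin.cons_zero, Fin.cons_succ, ← Fin.succ_castSucc]
        rw [mul_assoc]
        congr 3
        ext v
        simp [Fin.exists_fin_succ]
      · intro b _ hb
        rw [if_neg (Ne.symm hb), mul_zero]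
      · simp
    · intro b _ hb
      refine Finset.sum_eq_zero fun w _ => ?_
      simp [Fin.consEquiv, hb]
    · simp

lemma pathSum_eq (t : ℕ) (x : W) (A : (Fin (t+1) → W) → Prop)
    (hA : ∀ w, A w ↔ ¬ (Finset.univ ⊆ Finset.univ.biUnion fun i => obs (w i))) :
    pathSum P x t A = fl (osig obs P t x) Finset.univ := by
  classical
  rw [fl_eq_ex, ← path_ex, pathSum]
  refine Finset.sum_congr rfl fun w _ => ?_
  by_cases h1 : w 0 = x <;> by_cases h2 : A w
  · simp only [h1, h2, and_self, if_true, if_neg ((hA w).1 h2), mul_one]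
  · simp only [h1, h2, and_false, if_true, if_false, if_pos (not_not.1 (fun h => h2 ((hA w).2 h))),
      mul_zero]
  · simp [h1]
  · simp [h1]
end Sig

section Chain
variable {V : Type*} [Fintype V] [DecidableEq V] (P : V → V → ℝ)

/-- law of the range of the chain -/
def R : ℕ → V → Finset V → ℝ := osig (fun x => {x}) P

lemma coverTail_eq (x : V) (t : ℕ) : coverTail P x t = fl (R P t x) Finset.univ := by
  apply pathSum_eq
  intro w
  simp [Finset.subset_iff, eq_comm]

lemma ker_nonneg {k : ℕ} (hP : ∀ x y, 0 ≤ P x y) (a b : Fin k → V) :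
    0 ≤ ∏ i, P (a i) (b i) := Finset.prod_nonneg fun i _ => hP _ _

lemma ker_sum {k : ℕ} (hP1 : ∀ x, ∑ y, P x y = 1) (a : Fin k → V) :
    ∑ b : Fin k → V, ∏ i, P (a i) (b i) = 1 := by
  rw [← Fintype.prod_sum]
  simp [hP1]

/-- law of the joint range -/
def MR (k : ℕ) : ℕ → (Fin k → V) → Finset V → ℝ :=
  osig (fun a => Finset.univ.image a) (fun a b : Fin k → V => ∏ i, P (a i) (b i))

lemma multiExpCov_eq (k : ℕ) (x0 : Fin k → V) :
    multiExpCov P k x0 = ∑' t, fl (MR P k t x0) Finset.univ := by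
  unfold multiExpCov
  congr 1
  funext t
  apply pathSum_eq
  intro w
  simp only [Finset.subset_iff, Finset.mem_univ, Finset.mem_biUnion, Finset.mem_image, true_and,
    true_imp_iff]
  refine not_congr (forall_congr' fun v => ?_)
  rw [exists_comm]

lemma uz_MR (k t : ℕ) (x0 : Fin k → V) (D : Finset V) :
    uz (MR P k t x0) D = ∏ i, uz (R P t (x0 i)) D := by
  induction t generalizing x0 with
  | zero =>
    unfold MR R osig
    rw [uz_sig_zero]
    simp_rw [uz_sig_zero]
    by_cases h : Finset.univ.image x0 ⊆ D
    · rw [if_pos h, Finset.prod_eq_one]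
      intro i _
      rw [if_pos]
      simpa using h (Finset.mem_image_of_mem _ (Finset.mem_univ i))
    · rw [if_neg h]
      obtain ⟨v, hv, hvD⟩ := Finset.not_subset.1 h
      obtain ⟨i, -, rfl⟩ := Finset.mem_image.1 hv
      rw [Finset.prod_eq_zero (Finset.mem_univ i)]
      simp [hvD]
  | succ t ih =>
    unfold MR R osig at *
    rw [uz_sig_succ]
    simp_rw [uz_sig_succ, ih]
    rw [Fintype.prod_sum]
    refine Finset.sum_congr rfl fun b _ => ?_
    rw [Finset.prod_mul_distrib, Finset.prod_mul_distrib]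
    congr 2
    by_cases h : Finset.univ.image x0 ⊆ D
    · rw [if_pos h, Finset.prod_eq_one]
      intro i _
      rw [if_pos]
      simpa using h (Finset.mem_image_of_mem _ (Finset.mem_univ i))
    · rw [if_neg h]
      obtain ⟨v, hv, hvD⟩ := Finset.not_subset.1 h
      obtain ⟨i, -, rfl⟩ := Finset.mem_image.1 hv
      rw [Finset.prod_eq_zero (Finset.mem_univ i)]
      simp [hvD]
end Chain


section Cov
variable {V : Type*} [Fintype V] [DecidableEq V] (P : V → V → ℝ)

lemma R_nonneg (hP : ∀ x y, 0 ≤ P x y) (t : ℕ) (x : V) (A : Finset V) : 0 ≤ R P t x A :=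
  sig_nonneg _ _ _ hP _ _ _

lemma R_sum (hP1 : ∀ x, ∑ y, P x y = 1) (t : ℕ) (x : V) : ∑ A, R P t x A = 1 :=
  sig_sum _ _ _ hP1 _ _

lemma fl_R_single (hP : ∀ x y, 0 ≤ P x y) (hP1 : ∀ x, ∑ y, P x y = 1) (n : ℕ) (x y : V) :
    fl (R P n x) {y} ≤ 1 - (Matrix.of P ^ n) x y := by
  induction n generalizing x with
  | zero =>
    have e : fl (R P 0 x) {y} = if {y} ⊆ ({x} : Finset V) then 0 else 1 :=
      ex_sig_zero (fun x => {x}) (fun x _ => {x}) P x _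
    rw [e, pow_zero, Matrix.one_apply]
    by_cases h : x = y
    · simp [h]
    · simp [h, Ne.symm h]
  | succ n ih =>
    unfold R at *
    rw [fl_osig_succ, pow_succ', Matrix.mul_apply, ← hP1 x, ← Finset.sum_sub_distrib]
    refine Finset.sum_le_sum fun z _ => ?_
    rw [Matrix.of_apply]
    have h1 := mul_le_mul_of_nonneg_left ((fl_mono (sig_nonneg _ _ _ hP _ _)
      (Finset.sdiff_subset (s := {y}) (t := {x}))).trans (ih z)) (hP x z)
    unfold osig
    linarith

lemma fl_R_anti (hP : ∀ x y, 0 ≤ P x y) (hP1 : ∀ x, ∑ y, P x y = 1) (x : V) (B : Finset V) :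
    Antitone (fun t => fl (R P t x) B) := ex_osig_anti P _ hP hP1 (flΦ_anti B) x

lemma fl_union {f : Finset V → ℝ} (hf : ∀ S, 0 ≤ f S) : fl f Finset.univ ≤ ∑ y, fl f {y} := by
  unfold fl
  rw [Finset.sum_comm]
  refine Finset.sum_le_sum fun S _ => ?_
  rw [← Finset.mul_sum]
  refine mul_le_mul_of_nonneg_left ?_ (hf S)
  split_ifs with h
  · exact Finset.sum_nonneg fun y _ => by split_ifs <;> norm_num
  · obtain ⟨y, -, hy⟩ := Finset.not_subset.1 h
    refine le_trans ?_ (Finset.single_le_sum (f := fun y => if {y} ⊆ S then (0:ℝ) else 1)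
      (fun y _ => by split_ifs <;> norm_num) (Finset.mem_univ y))
    simp [hy]

lemma exists_cover [Nonempty V] (hP : ∀ x y, 0 ≤ P x y) (hP1 : ∀ x, ∑ y, P x y = 1)
    (hirr : ∀ x y, ∃ n : ℕ, 0 < (Matrix.of P ^ n) x y) :
    ∃ T : ℕ, ∀ x, fl (R P T x) Finset.univ ≤ 1/2 := by
  choose n hn using hirr
  let N := ∑ x, ∑ y, n x y
  have hnN : ∀ x y, n x y ≤ N := fun x y =>
    (Finset.single_le_sum (f := fun y => n x y) (fun _ _ => Nat.zero_le _)
      (Finset.mem_univ y)).trans (Finset.single_le_sum (f := fun x => ∑ y, n x y)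
      (fun _ _ => Nat.zero_le _) (Finset.mem_univ x))
  obtain ⟨p, -, hp⟩ := Finset.exists_min_image (Finset.univ : Finset (V × V))
    (fun p => (Matrix.of P ^ (n p.1 p.2)) p.1 p.2) Finset.univ_nonempty
  set δ := (Matrix.of P ^ (n p.1 p.2)) p.1 p.2 with hδ
  have hδ0 : 0 < δ := hn _ _
  have h1 : ∀ x y, fl (R P N x) {y} ≤ 1 - δ := fun x y =>
    (fl_R_anti P hP hP1 x {y} (hnN x y)).trans
      ((fl_R_single P hP hP1 _ x y).trans (by have := hp (x,y) (Finset.mem_univ _); linarith))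
  have hδ1 : 0 ≤ 1 - δ := (fl_nonneg (R_nonneg P hP _ _) _).trans (h1 p.1 p.1)
  have h2 : ∀ j x y, fl (R P (N*j) x) {y} ≤ (1-δ)^j := by
    intro j x y
    induction j with
    | zero => simpa using (fl_le (R_nonneg P hP _ _) _).trans (R_sum P hP1 _ _).le
    | succ j ih =>
      have := fl_markov' P (fun x => {x}) hP hP1 N (1-δ) {y} (fun x => h1 x y) (N*j) x {y}
        (subset_refl _)
      rw [Nat.mul_succ, add_comm, pow_succ']
      exact this.trans (mul_le_mul_of_nonneg_left ih hδ1)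
  have hc : 0 < (Fintype.card V : ℝ) := by exact_mod_cast Fintype.card_pos
  obtain ⟨j, hj⟩ := exists_pow_lt_of_lt_one (show 0 < 1 / (2 * (Fintype.card V : ℝ)) by positivity)
    (show 1 - δ < 1 by linarith)
  refine ⟨N * j, fun x => (fl_union (R_nonneg P hP _ _)).trans ?_⟩
  calc _ ≤ ∑ y : V, 1 / (2 * (Fintype.card V : ℝ)) :=
        Finset.sum_le_sum fun y _ => (h2 j x y).trans hj.le
    _ = 1/2 := by simp

lemma expCov_le_tcov [Nonempty V] (x : V) : expCov P x ≤ tcov P :=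
  le_ciSup (Set.finite_range _).bddAbove x

lemma sum_le_tcov [Nonempty V] (hP : ∀ x y, 0 ≤ P x y) (hP1 : ∀ x, ∑ y, P x y = 1)
    (hirr : ∀ x y, ∃ n : ℕ, 0 < (Matrix.of P ^ n) x y) (x : V) (s : ℕ) :
    ∑ t ∈ Finset.range s, fl (R P t x) Finset.univ ≤ tcov P := by
  obtain ⟨T, hT⟩ := exists_cover P hP hP1 hirr
  have h := (fl_osig_sum P (fun x => {x}) hP hP1 T (1/2) (by norm_num) (by norm_num) hT x).1
  refine le_trans ?_ (expCov_le_tcov P x)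
  unfold expCov
  simp_rw [coverTail_eq]
  exact h.sum_le_tsum _ fun t _ => fl_nonneg (R_nonneg P hP _ _) _

lemma tail_le_tcov [Nonempty V] (hP : ∀ x y, 0 ≤ P x y) (hP1 : ∀ x, ∑ y, P x y = 1)
    (hirr : ∀ x y, ∃ n : ℕ, 0 < (Matrix.of P ^ n) x y) (x : V) (s : ℕ) :
    s * fl (R P s x) Finset.univ ≤ tcov P := by
  refine le_trans ?_ (sum_le_tcov P hP hP1 hirr x s)
  rw [← nsmul_eq_mul]
  have := Finset.card_nsmul_le_sum (Finset.range s) (fun t => fl (R P t x) Finset.univ)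
    (fl (R P s x) Finset.univ) fun t ht => fl_R_anti P hP hP1 x _ (Finset.mem_range.1 ht).le
  simpa using this

lemma one_le_tcov [Nontrivial V] (hP : ∀ x y, 0 ≤ P x y) (hP1 : ∀ x, ∑ y, P x y = 1)
    (hirr : ∀ x y, ∃ n : ℕ, 0 < (Matrix.of P ^ n) x y) : 1 ≤ tcov P := by
  obtain ⟨x, y, hxy⟩ := exists_pair_ne V
  have := sum_le_tcov P hP hP1 hirr x 1
  have e : fl (R P 0 x) Finset.univ = if Finset.univ ⊆ ({x} : Finset V) then 0 else 1 :=
    ex_sig_zero (fun x => {x}) (fun x _ => {x}) P x _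
  rw [Finset.sum_range_one, e, if_neg] at this
  · exact this
  · intro h
    have := h (Finset.mem_univ y)
    simp at this
    exact hxy this.symm

end Cov

section Mix
variable {V : Type*} [Fintype V] [DecidableEq V] (P : V → V → ℝ) (π : V → ℝ)

/-- lazy kernel -/
noncomputable def LK : Matrix V V ℝ := (2:ℝ)⁻¹ • (Matrix.of P + 1)

lemma LK_apply (x y : V) : LK P x y = (P x y + if x = y then 1 else 0) / 2 := by
  simp [LK, Matrix.one_apply]; ring

variable {P π}
lemma LK_nonneg (hP : ∀ x y, 0 ≤ P x y) (n : ℕ) (x y : V) : 0 ≤ (LK P ^ n) x y := by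
  induction n generalizing x with
  | zero => rw [pow_zero, Matrix.one_apply]; split_ifs <;> norm_num
  | succ n ih =>
    rw [pow_succ', Matrix.mul_apply]
    refine Finset.sum_nonneg fun z _ => mul_nonneg ?_ (ih z)
    rw [LK_apply]
    have := hP x z
    split_ifs <;> linarith

lemma LK_sum (hP1 : ∀ x, ∑ y, P x y = 1) (n : ℕ) (x : V) : ∑ y, (LK P ^ n) x y = 1 := by
  induction n generalizing x with
  | zero => simp [Matrix.one_apply]
  | succ n ih =>
    simp_rw [pow_succ', Matrix.mul_apply]
    rw [Finset.sum_comm]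
    simp_rw [← Finset.mul_sum, ih, mul_one, LK_apply, ← Finset.sum_div, Finset.sum_add_distrib, hP1]
    simp

lemma LK_rev (hr : ∀ x y, π x * P x y = π y * P y x) (n : ℕ) (x y : V) :
    π x * (LK P ^ n) x y = π y * (LK P ^ n) y x := by
  induction n generalizing x y with
  | zero =>
    simp only [pow_zero, Matrix.one_apply]
    by_cases h : x = y
    · simp [h]
    · simp [h, Ne.symm h]
  | succ n ih =>
    rw [pow_succ', Matrix.mul_apply, ← pow_succ', pow_succ, Matrix.mul_apply, Finset.mul_sum,
      Finset.mul_sum]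
    refine Finset.sum_congr rfl fun z _ => ?_
    have h1 : π x * LK P x z = π z * LK P z x := by
      rw [LK_apply, LK_apply]
      have := hr x z
      by_cases h : x = z
      · simp [h]
      · simp [h, Ne.symm h]; linarith
    rw [← mul_assoc, h1, mul_right_comm, ih z y]
    ring

lemma LK_stat (hP1 : ∀ x, ∑ y, P x y = 1) (hr : ∀ x y, π x * P x y = π y * P y x) (n : ℕ) (y : V) :
    ∑ x, π x * (LK P ^ n) x y = π y := by
  simp_rw [LK_rev hr n _ y, ← Finset.mul_sum, LK_sum hP1, mul_one]

lemma P_pow_nonneg (hP : ∀ x y, 0 ≤ P x y) (n : ℕ) (x y : V) : 0 ≤ (Matrix.of P ^ n) x y := by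
  induction n generalizing x with
  | zero => rw [pow_zero, Matrix.one_apply]; split_ifs <;> norm_num
  | succ n ih =>
    rw [pow_succ', Matrix.mul_apply]
    exact Finset.sum_nonneg fun z _ => mul_nonneg (hP _ _) (ih z)

lemma LK_ge (hP : ∀ x y, 0 ≤ P x y) (n m : ℕ) (hm : m ≤ n) (x y : V) :
    (1/2)^n * (Matrix.of P ^ m) x y ≤ (LK P ^ n) x y := by
  induction n generalizing x m with
  | zero =>
    obtain rfl : m = 0 := by omega
    simp
  | succ n ih =>
    rw [pow_succ' (LK P), Matrix.mul_apply]
    rcases Nat.lt_or_ge n m with h | h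
    · obtain rfl : m = n + 1 := by omega
      rw [pow_succ' (Matrix.of P), Matrix.mul_apply, Finset.mul_sum]
      refine Finset.sum_le_sum fun z _ => ?_
      have h1 := ih n le_rfl z
      have h2 : P x z / 2 ≤ LK P x z := by
        rw [LK_apply]; split_ifs <;> linarith
      have h3 := LK_nonneg hP n z y
      calc _ = (P x z / 2) * ((1/2)^n * (Matrix.of P ^ n) z y) := by
              rw [Matrix.of_apply]; ring
        _ ≤ (P x z / 2) * (LK P ^ n) z y := by
              refine mul_le_mul_of_nonneg_left h1 ?_
              have := hP x z
              linarith
        _ ≤ _ := mul_le_mul_of_nonneg_right h2 h3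
    · refine le_trans ?_ (Finset.single_le_sum (f := fun z => LK P x z * (LK P ^ n) z y)
        (fun z _ => mul_nonneg ?_ (LK_nonneg hP n z y)) (Finset.mem_univ x))
      · have h1 := ih m h x
        have h2 : 1 / 2 ≤ LK P x x := by
          rw [LK_apply]
          have := hP x x
          simp; linarith
        have h3 := LK_nonneg hP n x y
        calc _ = (1/2) * ((1/2)^n * (Matrix.of P ^ m) x y) := by ring
          _ ≤ (1/2) * (LK P ^ n) x y := by linarith
          _ ≤ _ := mul_le_mul_of_nonneg_right h2 h3
      · simpa using LK_nonneg hP 1 x z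

lemma tmix_spec [Nonempty V] (hP : ∀ x y, 0 ≤ P x y) (hP1 : ∀ x, ∑ y, P x y = 1)
    (hirr : ∀ x y, ∃ n : ℕ, 0 < (Matrix.of P ^ n) x y) (hπ : ∀ x, 0 < π x) (hπ1 : ∑ x, π x = 1)
    (hr : ∀ x y, π x * P x y = π y * P y x) (x : V) :
    (1 / 2) * ∑ y, |(LK P ^ (tmix P π)) x y - π y| ≤ 1 / 4 := by
  have key : {t : ℕ | ∀ x, (1 / 2) * ∑ y, |(LK P ^ t) x y - π y| ≤ 1 / 4}.Nonempty := by
    choose n hn using hirr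
    let N := ∑ x, ∑ y, n x y
    have hnN : ∀ x y, n x y ≤ N := fun x y =>
      (Finset.single_le_sum (f := fun y => n x y) (fun _ _ => Nat.zero_le _)
        (Finset.mem_univ y)).trans (Finset.single_le_sum (f := fun x => ∑ y, n x y)
        (fun _ _ => Nat.zero_le _) (Finset.mem_univ x))
    obtain ⟨p, -, hp⟩ := Finset.exists_min_image (Finset.univ : Finset (V × V))
      (fun p => (LK P ^ N) p.1 p.2) Finset.univ_nonempty
    set δ := (LK P ^ N) p.1 p.2 with hδ
    have hδ0 : 0 < δ := lt_of_lt_of_le (mul_pos (by positivity) (hn p.1 p.2))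
      (LK_ge hP N _ (hnN p.1 p.2) p.1 p.2)
    have hπle : ∀ y, π y ≤ 1 := fun y => by
      rw [← hπ1]; exact Finset.single_le_sum (f := π) (fun z _ => (hπ z).le) (Finset.mem_univ y)
    have hge : ∀ x z, 0 ≤ (LK P ^ N) x z - δ * π z := fun x z => by
      have h1 := hp (x, z) (Finset.mem_univ _)
      have h2 := hπle z
      dsimp only at h1
      nlinarith
    have hsum : ∀ x, ∑ z, ((LK P ^ N) x z - δ * π z) = 1 - δ := fun x => by
      rw [Finset.sum_sub_distrib, LK_sum hP1, ← Finset.mul_sum, hπ1, mul_one]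
    have hδ1 : 0 ≤ 1 - δ := by
      rw [← hsum p.1]; exact Finset.sum_nonneg fun z _ => hge _ _
    have hD : ∀ j x, ∑ y, |(LK P ^ (N*j)) x y - π y| ≤ 2 * (1-δ)^j := by
      intro j
      induction j with
      | zero =>
        intro x
        rw [mul_zero]
        calc _ ≤ ∑ y, ((LK P ^ 0) x y + π y) := by
              refine Finset.sum_le_sum fun y _ => ?_
              have h1 := LK_nonneg hP 0 x y
              have h2 := hπ y
              rw [abs_le]; constructor <;> linarith
          _ = _ := by rw [Finset.sum_add_distrib, LK_sum hP1, hπ1]; norm_num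
      | succ j ih =>
        intro x
        have e : ∀ y, (LK P ^ (N*(j+1))) x y - π y
            = ∑ z, ((LK P ^ N) x z - δ * π z) * ((LK P ^ (N*j)) z y - π y) := by
          intro y
          rw [Nat.mul_succ, add_comm, pow_add, Matrix.mul_apply]
          have : ∑ z, ((LK P ^ N) x z - δ * π z) * ((LK P ^ (N*j)) z y - π y)
            = ∑ z, (LK P ^ N) x z * (LK P ^ (N*j)) z y - (∑ z, (LK P ^ N) x z) * π y
              - δ * (∑ z, π z * (LK P ^ (N*j)) z y) + δ * (∑ z, π z) * π y := by
            generalize N * j = M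
            generalize N = N'
            rw [Finset.sum_mul, Finset.mul_sum, Finset.mul_sum, Finset.sum_mul,
              ← Finset.sum_sub_distrib, ← Finset.sum_sub_distrib, ← Finset.sum_add_distrib]
            refine Finset.sum_congr rfl fun z _ => by ring
          rw [this, LK_sum hP1, LK_stat hP1 hr, hπ1]
          ring
        calc _ ≤ ∑ y, ∑ z, ((LK P ^ N) x z - δ * π z) * |(LK P ^ (N*j)) z y - π y| := by
              refine Finset.sum_le_sum fun y _ => ?_
              rw [e]
              refine (Finset.abs_sum_le_sum_abs _ _).trans (le_of_eq ?_)
              refine Finset.sum_congr rfl fun z _ => ?_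
              rw [abs_mul, abs_of_nonneg (hge _ _)]
          _ = ∑ z, ((LK P ^ N) x z - δ * π z) * ∑ y, |(LK P ^ (N*j)) z y - π y| := by
              rw [Finset.sum_comm]; simp_rw [Finset.mul_sum]
          _ ≤ ∑ z, ((LK P ^ N) x z - δ * π z) * (2 * (1-δ)^j) :=
              Finset.sum_le_sum fun z _ => mul_le_mul_of_nonneg_left (ih z) (hge _ _)
          _ = _ := by rw [← Finset.sum_mul, hsum]; ring
    obtain ⟨j, hj⟩ := exists_pow_lt_of_lt_one (show (0:ℝ) < 1/4 by norm_num)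
      (show 1 - δ < 1 by linarith)
    exact ⟨N*j, fun x => by have := hD j x; linarith⟩
  exact Nat.sInf_mem key x

lemma LK_doeblin [Nonempty V] (hP : ∀ x y, 0 ≤ P x y) (hP1 : ∀ x, ∑ y, P x y = 1)
    (hirr : ∀ x y, ∃ n : ℕ, 0 < (Matrix.of P ^ n) x y) (hπ : ∀ x, 0 < π x) (hπ1 : ∑ x, π x = 1)
    (hr : ∀ x y, π x * P x y = π y * P y x) (x y : V) :
    π y / 4 ≤ (LK P ^ (2 * tmix P π)) x y := by
  set s := tmix P π
  have hx := tmix_spec hP hP1 hirr hπ hπ1 hr x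
  have hy := tmix_spec hP hP1 hirr hπ hπ1 hr y
  have e : (LK P ^ (2 * s)) x y = π y * ∑ z, (LK P ^ s) x z * (LK P ^ s) y z / π z := by
    rw [two_mul, pow_add, Matrix.mul_apply, Finset.mul_sum]
    refine Finset.sum_congr rfl fun z _ => ?_
    have h := LK_rev hr s y z
    have := hπ z
    field_simp
    linear_combination (-(LK P ^ s) x z) * h
  have h1 : (1:ℝ)/2 ≤ ∑ z, min ((LK P ^ s) x z) ((LK P ^ s) y z) := by
    have : ∀ z, min ((LK P ^ s) x z) ((LK P ^ s) y z) ≥ ((LK P ^ s) x z + (LK P ^ s) y z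
        - (|(LK P ^ s) x z - π z| + |(LK P ^ s) y z - π z|)) / 2 := by
      intro z
      have a1 := abs_le.1 (le_refl |(LK P ^ s) x z - π z|)
      have a2 := abs_le.1 (le_refl |(LK P ^ s) y z - π z|)
      apply le_min <;> linarith [a1.1, a1.2, a2.1, a2.2]
    refine le_trans ?_ (Finset.sum_le_sum fun z _ => this z)
    rw [← Finset.sum_div, Finset.sum_sub_distrib, Finset.sum_add_distrib, Finset.sum_add_distrib,
      LK_sum hP1, LK_sum hP1]
    linarith
  have h2 := Finset.sq_sum_div_le_sum_sq_div Finset.univ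
    (fun z => min ((LK P ^ s) x z) ((LK P ^ s) y z)) (g := π) (fun z _ => hπ z)
  rw [hπ1, div_one] at h2
  have h3 : ∑ z, min ((LK P ^ s) x z) ((LK P ^ s) y z) ^ 2 / π z
      ≤ ∑ z, (LK P ^ s) x z * (LK P ^ s) y z / π z := by
    refine Finset.sum_le_sum fun z _ => ?_
    refine div_le_div_of_nonneg_right ?_ (hπ z).le
    have b1 := LK_nonneg hP s x z
    have b2 := LK_nonneg hP s y z
    rw [sq]
    exact mul_le_mul (min_le_left _ _) (min_le_right _ _) (le_min b1 b2) b1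
  rw [e]
  have := hπ y
  have h4 : (1/4 : ℝ) ≤ ∑ z, (LK P ^ s) x z * (LK P ^ s) y z / π z := by nlinarith
  have h5 := mul_le_mul_of_nonneg_left h4 this.le
  linarith

lemma tmix_pos [Nontrivial V] (hP : ∀ x y, 0 ≤ P x y) (hP1 : ∀ x, ∑ y, P x y = 1)
    (hirr : ∀ x y, ∃ n : ℕ, 0 < (Matrix.of P ^ n) x y) (hπ : ∀ x, 0 < π x) (hπ1 : ∑ x, π x = 1)
    (hr : ∀ x y, π x * P x y = π y * P y x) : 1 ≤ tmix P π := by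
  by_contra h
  have h0 : tmix P π = 0 := by omega
  have key : ∀ x, 3/4 ≤ π x := by
    intro x
    have := tmix_spec hP hP1 hirr hπ hπ1 hr x
    rw [h0, pow_zero] at this
    have h2 : ∑ y, (if y = x then (1 - π x) else π y) ≤ ∑ y, |(1 : Matrix V V ℝ) x y - π y| := by
      refine Finset.sum_le_sum fun y _ => ?_
      rw [Matrix.one_apply]
      by_cases hy : y = x
      · subst hy; simp [le_abs_self]
      · simp [hy, Ne.symm hy, le_abs_self]
    rw [← Finset.add_sum_erase _ _ (Finset.mem_univ x), if_pos rfl] at h2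
    have h3 : ∑ y ∈ Finset.univ.erase x, (if y = x then (1 - π x) else π y) = 1 - π x := by
      rw [← hπ1, ← Finset.add_sum_erase _ π (Finset.mem_univ x), add_sub_cancel_left]
      refine Finset.sum_congr rfl fun y hy => if_neg (Finset.ne_of_mem_erase hy)
    linarith
  obtain ⟨x, y, hxy⟩ := exists_pair_ne V
  have h1 := Finset.sum_le_univ_sum_of_nonneg (s := {x, y}) (f := π) (fun z => (hπ z).le)
  rw [Finset.sum_pair hxy, hπ1] at h1
  linarith [key x, key y]

end Mix


lemma real_hasSum_exp (x : ℝ) : HasSum (fun n : ℕ => x^n / (n.factorial : ℝ)) (Real.exp x) := by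
  rw [Real.exp_eq_exp_ℝ]
  exact NormedSpace.expSeries_div_hasSum_exp x

lemma hs_cast {f g : ℕ → ℝ} {a b : ℝ} (h : HasSum f a) (hf : ∀ i, f i = g i) (hab : a = b) :
    HasSum g b := by
  rw [← hab, ← funext hf]; exact h

section Det
variable {V : Type*} [Fintype V] [DecidableEq V]

/-- failure probability after `i` independent sets of law `r` -/
def DD (r : Finset V → ℝ) : ℕ → Finset V → ℝ
  | 0, B => if B = ∅ then 0 else 1
  | i + 1, B => ex r (fun A => DD r i (B \ A))

/-- law of union of `i` independent sets of law `r` -/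
def pw (r : Finset V → ℝ) : ℕ → Finset V → ℝ
  | 0 => fun S => if S = ∅ then 1 else 0
  | i + 1 => cv r (pw r i)

lemma uz_pw (r : Finset V → ℝ) (i : ℕ) (W : Finset V) : uz (pw r i) W = (uz r W)^i := by
  induction i with
  | zero =>
    simp only [uz, pw, pow_zero]
    rw [Finset.sum_eq_single ∅] <;> simp_all
  | succ i ih => rw [pw, uz_cv, ih, pow_succ']

lemma fl_pw (r : Finset V → ℝ) (i : ℕ) (B : Finset V) : fl (pw r i) B = DD r i B := by
  induction i generalizing B with
  | zero =>
    simp only [fl, pw, DD]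
    rw [Finset.sum_eq_single ∅] <;> simp_all [Finset.subset_empty]
  | succ i ih =>
    rw [pw, fl_conv (g := r) (k := pw r i) (fun W => uz_cv _ _ W)]
    simp_rw [ih]
    rfl

lemma pw_nonneg {r : Finset V → ℝ} (hr : ∀ A, 0 ≤ r A) (i : ℕ) (S : Finset V) : 0 ≤ pw r i S := by
  induction i generalizing S with
  | zero => simp only [pw]; split_ifs <;> norm_num
  | succ i ih => exact cv_nonneg hr ih S

lemma pw_sum {r : Finset V → ℝ} (hr1 : ∑ A, r A = 1) (i : ℕ) : ∑ S, pw r i S = 1 := by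
  have := uz_pw r i Finset.univ
  simpa [uz, hr1] using this

lemma DD_nonneg {r : Finset V → ℝ} (hr : ∀ A, 0 ≤ r A) (i : ℕ) (B : Finset V) : 0 ≤ DD r i B := by
  rw [← fl_pw]; exact fl_nonneg (pw_nonneg hr i) B

lemma DD_mono {r : Finset V → ℝ} (hr : ∀ A, 0 ≤ r A) (i : ℕ) {B B' : Finset V} (h : B ⊆ B') :
    DD r i B ≤ DD r i B' := by
  rw [← fl_pw, ← fl_pw]; exact fl_mono (pw_nonneg hr i) h

lemma DD_sdiff_anti {r : Finset V → ℝ} (hr : ∀ A, 0 ≤ r A) (i : ℕ) (B : Finset V) :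
    Antitone (fun A => DD r i (B \ A)) := fun _ _ h =>
  DD_mono hr i (Finset.sdiff_subset_sdiff (subset_refl _) h)

lemma ex_const {r : Finset V → ℝ} (hr1 : ∑ A, r A = 1) (c : ℝ) : ex r (fun _ => c) = c := by
  simp only [ex]; rw [← Finset.sum_mul, hr1, one_mul]

lemma DD_anti {r : Finset V → ℝ} (hr : ∀ A, 0 ≤ r A) (hr1 : ∑ A, r A = 1) (B : Finset V) :
    Antitone (fun i => DD r i B) :=
  antitone_nat_of_succ_le fun i => by
    calc DD r (i+1) B ≤ ex r (fun _ => DD r i B) :=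
          ex_mono hr fun A => DD_mono hr i Finset.sdiff_subset
      _ = _ := ex_const hr1 _

lemma DD_cmp {r r' : Finset V → ℝ} (hr : ∀ A, 0 ≤ r A) (hr' : ∀ A, 0 ≤ r' A)
    (h : ∀ Φ : Finset V → ℝ, Antitone Φ → ex r Φ ≤ ex r' Φ) (i : ℕ) (B : Finset V) :
    DD r i B ≤ DD r' i B := by
  induction i generalizing B with
  | zero => exact le_rfl
  | succ i ih =>
    refine (h _ (DD_sdiff_anti hr i B)).trans ?_
    exact ex_mono hr' fun A => ih _

lemma FF_hasSum {r : Finset V → ℝ} (hr : ∀ A, 0 ≤ r A) (hr1 : ∑ A, r A = 1) {M : ℝ} (hM : 0 ≤ M)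
    (B : Finset V) :
    HasSum (fun i : ℕ => Real.exp (-M) * (M^i / (i.factorial : ℝ)) * DD r i B) (FF (M • r) B) := by
  have hc : HasSum (fun i : ℕ => Real.exp (-M) * (M^i / (i.factorial : ℝ))) 1 := by
    have := (real_hasSum_exp M).mul_left (Real.exp (-M))
    rwa [← Real.exp_add, neg_add_cancel, Real.exp_zero] at this
  have hc0 : ∀ i : ℕ, 0 ≤ Real.exp (-M) * (M^i / (i.factorial : ℝ)) := fun i => by positivity
  have hs : ∀ S, Summable (fun i : ℕ => Real.exp (-M) * (M^i / (i.factorial : ℝ)) * pw r i S) := by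
    intro S
    refine Summable.of_nonneg_of_le (fun i => mul_nonneg (hc0 i) (pw_nonneg hr i S)) (fun i => ?_)
      hc.summable
    refine mul_le_of_le_one_right (hc0 i) ?_
    rw [← pw_sum hr1 i]
    exact Finset.single_le_sum (f := pw r i) (fun z _ => pw_nonneg hr i z) (Finset.mem_univ S)
  have e : pois (M • r) = fun S => ∑' i : ℕ, Real.exp (-M) * (M^i / (i.factorial : ℝ)) * pw r i S := by
    apply uz_inj
    intro W
    rw [uz_pois' (fun A => by simpa using mul_nonneg hM (hr A)), uz_eq_sum (fun S => ∑' i : ℕ, _)]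
    have h1 := hasSum_sum (s := Finset.univ) fun S _ =>
      (hs S).hasSum.mul_right (if S ⊆ W then (1:ℝ) else 0)
    rw [← h1.tsum_eq]
    have h2 : ∀ i : ℕ, ∑ S, Real.exp (-M) * (M^i / (i.factorial : ℝ)) * pw r i S *
        (if S ⊆ W then (1:ℝ) else 0) = Real.exp (-M) * ((M * uz r W)^i / (i.factorial : ℝ)) := by
      intro i
      simp_rw [mul_assoc (Real.exp (-M) * (M^i / (i.factorial : ℝ)))]
      rw [← Finset.mul_sum, ← uz_eq_sum, uz_pw, mul_pow]
      ring
    simp_rw [h2]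
    rw [((real_hasSum_exp (M * uz r W)).mul_left (Real.exp (-M))).tsum_eq, ← Real.exp_add]
    congr 1
    have e1 : uz (M • r) W = M * uz r W := by
      rw [uz_eq_sum, uz_eq_sum, Finset.mul_sum]
      simp only [Pi.smul_apply, smul_eq_mul, mul_assoc]
    have e2 : ∑ A, (M • r) A = M := by
      simp only [Pi.smul_apply, smul_eq_mul, ← Finset.mul_sum, hr1, mul_one]
    rw [e1, e2]
    ring
  have h1 := hasSum_sum (s := Finset.univ) fun S _ =>
      (hs S).hasSum.mul_right (if B ⊆ S then (0:ℝ) else 1)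
  unfold FF
  rw [e]
  refine hs_cast h1 (fun i => ?_) rfl
  rw [← fl_pw, fl, Finset.mul_sum]
  refine Finset.sum_congr rfl fun S _ => by ring

lemma FF_ge_DD {r r' : Finset V → ℝ} (hr : ∀ A, 0 ≤ r A) (hr1 : ∑ A, r A = 1)
    (hr' : ∀ A, 0 ≤ r' A) (hr1' : ∑ A, r' A = 1)
    (h : ∀ Φ : Finset V → ℝ, Antitone Φ → ex r Φ ≤ ex r' Φ) {M : ℝ} (hM : 0 ≤ M)
    (j : ℕ) (B : Finset V) : DD r j B * (1 - Real.exp M / 2^j) ≤ FF (M • r') B := by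
  have h1 := FF_hasSum hr' hr1' hM B
  have h2 : HasSum (fun i : ℕ => Real.exp (-M) * (M^i / (i.factorial : ℝ)) *
      (DD r j B * (1 - 2^i / 2^j))) (DD r j B * (1 - Real.exp M / 2^j)) := by
    have a1 := (real_hasSum_exp M).mul_left (Real.exp (-M) * DD r j B)
    have a2 := (real_hasSum_exp (M*2)).mul_left (Real.exp (-M) * DD r j B / 2^j)
    refine hs_cast (a1.sub a2) (fun i => ?_) ?_
    · rw [mul_pow]; ring
    · have : Real.exp (M*2) = Real.exp M * Real.exp M := by rw [← Real.exp_add]; ring_nf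
      rw [this, Real.exp_neg]
      have := Real.exp_pos M
      field_simp
  refine hasSum_le (fun i => ?_) h2 h1
  refine mul_le_mul_of_nonneg_left ?_ (by positivity)
  have hD := DD_nonneg hr j B
  rcases le_or_gt i j with hij | hij
  · calc _ ≤ DD r j B := by
          refine mul_le_of_le_one_right hD ?_
          have : (0:ℝ) ≤ 2^i / 2^j := by positivity
          linarith
      _ ≤ DD r i B := DD_anti hr hr1 B hij
      _ ≤ _ := DD_cmp hr hr' h i B
  · have : (1:ℝ) ≤ 2^i / 2^j := by
      rw [le_div_iff₀ (by positivity), one_mul]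
      exact pow_le_pow_right₀ (by norm_num) hij.le
    have h3 : DD r j B * (1 - 2^i / 2^j) ≤ 0 := mul_nonpos_of_nonneg_of_nonpos hD (by linarith)
    exact h3.trans (DD_nonneg hr' i B)

end Det

section Starts
variable {V : Type*} [Fintype V] [DecidableEq V] {P : V → V → ℝ} {π : V → ℝ}

/-- law of the range from the stationary start -/
def rr (P : V → V → ℝ) (π : V → ℝ) (t : ℕ) (A : Finset V) : ℝ := ∑ x, π x * R P t x A

lemma ex_rr (t : ℕ) (Φ : Finset V → ℝ) : ex (rr P π t) Φ = ∑ x, π x * ex (R P t x) Φ := by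
  simp only [ex, rr, Finset.sum_mul, Finset.mul_sum]
  rw [Finset.sum_comm]
  simp only [mul_assoc]

lemma rr_nonneg (hP : ∀ x y, 0 ≤ P x y) (hπ : ∀ x, 0 < π x) (t : ℕ) (A : Finset V) :
    0 ≤ rr P π t A := Finset.sum_nonneg fun x _ => mul_nonneg (hπ x).le (R_nonneg P hP _ _ _)

lemma rr_sum (hP1 : ∀ x, ∑ y, P x y = 1) (hπ1 : ∑ x, π x = 1) (t : ℕ) : ∑ A, rr P π t A = 1 := by
  unfold rr
  rw [Finset.sum_comm]
  simp_rw [← Finset.mul_sum, R_sum P hP1, mul_one, hπ1]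

lemma ex_rr_anti (hP : ∀ x y, 0 ≤ P x y) (hP1 : ∀ x, ∑ y, P x y = 1) (hπ : ∀ x, 0 < π x)
    {Φ : Finset V → ℝ} (hΦ : Antitone Φ) : Antitone (fun t => ex (rr P π t) Φ) := by
  intro s t h
  simp only [ex_rr]
  exact Finset.sum_le_sum fun x _ => mul_le_mul_of_nonneg_left
    (ex_osig_anti P (fun x => {x}) hP hP1 hΦ x h) (hπ x).le

lemma ex_R_lazy (hP : ∀ x y, 0 ≤ P x y) (hP1 : ∀ x, ∑ y, P x y = 1) {Φ : Finset V → ℝ}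
    (hΦ : Antitone Φ) (S t : ℕ) (x : V) :
    ex (R P (t + S) x) Φ ≤ ∑ y, (LK P ^ t) x y * ex (R P S y) Φ := by
  induction t generalizing x with
  | zero => simp [Matrix.one_apply]
  | succ t ih =>
    have h1 : ex (R P (t + S + 1) x) Φ ≤ ex (R P (t+S) x) Φ :=
      ex_osig_step P (fun x => {x}) hP hP1 hΦ (t+S) x
    have h2 : ex (R P (t + S + 1) x) Φ ≤ ∑ y, P x y * ex (R P (t+S) y) Φ :=
      ex_osig_shift P (fun x => {x}) hP hΦ (t+S) x
    have h3 : ∑ y, LK P x y * ex (R P (t+S) y) Φ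
        = (ex (R P (t+S) x) Φ + ∑ y, P x y * ex (R P (t+S) y) Φ) / 2 := by
      simp_rw [LK_apply]
      have : ∀ y, (P x y + if x = y then 1 else 0) / 2 * ex (R P (t+S) y) Φ
        = (P x y * ex (R P (t+S) y) Φ) / 2 + (if x = y then ex (R P (t+S) y) Φ / 2 else 0) := by
        intro y; split_ifs <;> ring
      simp_rw [this, Finset.sum_add_distrib, ← Finset.sum_div]
      simp; ring
    calc _ = ex (R P (t + S + 1) x) Φ := by rw [add_right_comm]
      _ ≤ ∑ y, LK P x y * ex (R P (t+S) y) Φ := by linarith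
      _ ≤ ∑ y, LK P x y * ∑ z, (LK P ^ t) y z * ex (R P S z) Φ := by
          refine Finset.sum_le_sum fun y _ => mul_le_mul_of_nonneg_left (ih y) ?_
          simpa using LK_nonneg hP 1 x y
      _ = _ := by
          simp_rw [pow_succ', Matrix.mul_apply, Finset.mul_sum, Finset.sum_mul]
          rw [Finset.sum_comm]
          simp_rw [mul_assoc]

lemma ex_R_mixed [Nonempty V] (hP : ∀ x y, 0 ≤ P x y) (hP1 : ∀ x, ∑ y, P x y = 1)
    (hirr : ∀ x y, ∃ n : ℕ, 0 < (Matrix.of P ^ n) x y) (hπ : ∀ x, 0 < π x) (hπ1 : ∑ x, π x = 1)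
    (hr : ∀ x y, π x * P x y = π y * P y x) {Φ : Finset V → ℝ}
    (hΦ : Antitone Φ) (S : ℕ) (x : V) :
    ex (R P (2 * tmix P π + S) x) Φ ≤ ex (rr P π S) Φ / 4 + 3 / 4 * Φ ∅ := by
  refine (ex_R_lazy hP hP1 hΦ S _ x).trans ?_
  have hd := LK_doeblin hP hP1 hirr hπ hπ1 hr x
  have h1 : ∀ y, (LK P ^ (2 * tmix P π)) x y * ex (R P S y) Φ
      ≤ π y * ex (R P S y) Φ / 4 + ((LK P ^ (2 * tmix P π)) x y - π y / 4) * Φ ∅ := by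
    intro y
    have h2 : ex (R P S y) Φ ≤ Φ ∅ := by
      calc _ ≤ ex (R P S y) (fun _ => Φ ∅) := ex_mono (R_nonneg P hP _ _) fun A => hΦ (Finset.empty_subset A)
        _ = _ := ex_const (R_sum P hP1 _ _) _
    have h3 := mul_le_mul_of_nonneg_left h2 (sub_nonneg.2 (hd y))
    linarith
  refine (Finset.sum_le_sum fun y _ => h1 y).trans (le_of_eq ?_)
  rw [Finset.sum_add_distrib, ← Finset.sum_div, ← ex_rr, ← Finset.sum_mul, Finset.sum_sub_distrib,
    LK_sum hP1, ← Finset.sum_div, hπ1]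
  norm_num

lemma MR_nonneg (hP : ∀ x y, 0 ≤ P x y) (k t : ℕ) (x0 : Fin k → V) (A : Finset V) :
    0 ≤ MR P k t x0 A := sig_nonneg _ _ _ (fun a b => ker_nonneg P hP a b) _ _ _

lemma MR_sum (hP1 : ∀ x, ∑ y, P x y = 1) (k t : ℕ) (x0 : Fin k → V) : ∑ A, MR P k t x0 A = 1 :=
  sig_sum _ _ _ (fun a => ker_sum P hP1 a) _ _

lemma fl_MR_succ (k t : ℕ) (x0 : Fin (k+1) → V) (B : Finset V) :
    fl (MR P (k+1) t x0) B = ex (R P t (x0 0)) (fun A => fl (MR P k t (fun i => x0 i.succ)) (B \ A)) :=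
  fl_conv (fun W => by rw [uz_MR, uz_MR, Fin.prod_univ_succ]) B

lemma fl_MR_le [Nonempty V] (hP : ∀ x y, 0 ≤ P x y) (hP1 : ∀ x, ∑ y, P x y = 1)
    (hirr : ∀ x y, ∃ n : ℕ, 0 < (Matrix.of P ^ n) x y) (hπ : ∀ x, 0 < π x) (hπ1 : ∑ x, π x = 1)
    (hr : ∀ x y, π x * P x y = π y * P y x) (S k j : ℕ) (x0 : Fin k → V) (B : Finset V) :
    fl (MR P k (2 * tmix P π + S) x0) B ≤ DD (rr P π S) j B + (7/8)^k * 2^j := by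
  induction k generalizing j B with
  | zero =>
    have h1 : fl (MR P 0 (2 * tmix P π + S) x0) B ≤ 1 :=
      (fl_le (MR_nonneg hP _ _ _) _).trans (MR_sum hP1 _ _ _).le
    have h2 := DD_nonneg (rr_nonneg hP hπ S) j B
    have h3 : (1:ℝ) ≤ 2^j := one_le_pow₀ (by norm_num)
    simp only [pow_zero, one_mul]
    linarith
  | succ k ih =>
    cases j with
    | zero =>
      rw [DD]
      split_ifs with hB
      · rw [hB, fl_empty]; positivity
      · have h1 : fl (MR P (k+1) (2 * tmix P π + S) x0) B ≤ 1 :=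
          (fl_le (MR_nonneg hP _ _ _) _).trans (MR_sum hP1 _ _ _).le
        have : (0:ℝ) ≤ (7/8)^(k+1) * 2^0 := by positivity
        linarith
    | succ j =>
      rw [fl_MR_succ]
      refine (ex_R_mixed hP hP1 hirr hπ hπ1 hr (fun A A' h =>
        fl_mono (MR_nonneg hP _ _ _) (Finset.sdiff_subset_sdiff (subset_refl _) h)) S _).trans ?_
      have h1 : ex (rr P π S) (fun A => fl (MR P k (2 * tmix P π + S) (fun i => x0 i.succ)) (B \ A))
          ≤ DD (rr P π S) (j+1) B + (7/8)^k * 2^j := by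
        refine (ex_mono (rr_nonneg hP hπ S) fun A => ih j _ (B \ A)).trans (le_of_eq ?_)
        simp only [ex, mul_add, Finset.sum_add_distrib, ← Finset.sum_mul, rr_sum hP1 hπ1, DD, one_mul]
      have h2 := ih (j+1) (fun i => x0 i.succ) B
      rw [Finset.sdiff_empty]
      have e : ((7:ℝ)/8)^(k+1) * 2^(j+1) = 1/4 * ((7/8)^k * 2^j) + 3/4 * ((7/8)^k * 2^(j+1)) := by ring
      rw [e]
      linarith

lemma fl_MR_one (hP : ∀ x y, 0 ≤ P x y) (hP1 : ∀ x, ∑ y, P x y = 1) (k t : ℕ)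
    (x0 : Fin (k+1) → V) (B : Finset V) : fl (MR P (k+1) t x0) B ≤ fl (R P t (x0 0)) B := by
  rw [fl_MR_succ]
  refine ex_mono (R_nonneg P hP _ _) fun A => ?_
  split_ifs with h
  · rw [Finset.sdiff_eq_empty_iff_subset.2 h, fl_empty]
  · exact (fl_le (MR_nonneg hP _ _ _) _).trans (MR_sum hP1 _ _ _).le

end Starts


section Geo
variable {V : Type*} [Fintype V] [DecidableEq V] {P : V → V → ℝ} {π : V → ℝ}

/-- intensity: Poisson number of stationary walkers with geometric lifetimes -/
noncomputable def GG (P : V → V → ℝ) (π : V → ℝ) (m q : ℝ) (A : Finset V) : ℝ :=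
  m * ((1 - q) * ∑' j : ℕ, q^j * rr P π j A)

/-- truncated intensity -/
noncomputable def GS (P : V → V → ℝ) (π : V → ℝ) (S : ℕ) (m q : ℝ) (A : Finset V) : ℝ :=
  ∑ j ∈ Finset.range (S+1), m * (1 - q) * q^j * rr P π j A

lemma rr_le_one (hP : ∀ x y, 0 ≤ P x y) (hP1 : ∀ x, ∑ y, P x y = 1) (hπ : ∀ x, 0 < π x)
    (hπ1 : ∑ x, π x = 1) (j : ℕ) (A : Finset V) : rr P π j A ≤ 1 := by
  rw [← rr_sum hP1 hπ1 j]
  exact Finset.single_le_sum (f := rr P π j) (fun z _ => rr_nonneg hP hπ j z) (Finset.mem_univ A)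

lemma GG_summable (hP : ∀ x y, 0 ≤ P x y) (hP1 : ∀ x, ∑ y, P x y = 1) (hπ : ∀ x, 0 < π x)
    (hπ1 : ∑ x, π x = 1) {q : ℝ} (hq0 : 0 ≤ q) (hq1 : q < 1) (A : Finset V) :
    Summable (fun j : ℕ => q^j * rr P π j A) :=
  Summable.of_nonneg_of_le (fun j => mul_nonneg (by positivity) (rr_nonneg hP hπ j A))
    (fun j => mul_le_of_le_one_right (by positivity) (rr_le_one hP hP1 hπ hπ1 j A))
    (summable_geometric_of_lt_one hq0 hq1)

lemma GG_nonneg (hP : ∀ x y, 0 ≤ P x y) (hπ : ∀ x, 0 < π x)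
    {m q : ℝ} (hm : 0 ≤ m) (hq0 : 0 ≤ q) (hq1 : q < 1) (A : Finset V) : 0 ≤ GG P π m q A :=
  mul_nonneg hm (mul_nonneg (by linarith) (tsum_nonneg fun j =>
    mul_nonneg (by positivity) (rr_nonneg hP hπ j A)))

lemma GS_nonneg (hP : ∀ x y, 0 ≤ P x y) (hπ : ∀ x, 0 < π x) (S : ℕ)
    {m q : ℝ} (hm : 0 ≤ m) (hq0 : 0 ≤ q) (hq1 : q < 1) (A : Finset V) : 0 ≤ GS P π S m q A :=
  Finset.sum_nonneg fun j _ => mul_nonneg (mul_nonneg (mul_nonneg hm (by linarith))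
    (by positivity)) (rr_nonneg hP hπ j A)

lemma GG_mono_m (hP : ∀ x y, 0 ≤ P x y) (hπ : ∀ x, 0 < π x)
    {m m' q : ℝ} (hm : m ≤ m') (hq0 : 0 ≤ q) (hq1 : q < 1) (A : Finset V) :
    GG P π m q A ≤ GG P π m' q A :=
  mul_le_mul_of_nonneg_right hm (mul_nonneg (by linarith) (tsum_nonneg fun j =>
    mul_nonneg (by positivity) (rr_nonneg hP hπ j A)))

lemma GG_add (m m' q : ℝ) : GG P π (m + m') q = GG P π m q + GG P π m' q := by
  funext A
  simp only [GG, Pi.add_apply]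
  ring

lemma GG_sum (hP : ∀ x y, 0 ≤ P x y) (hP1 : ∀ x, ∑ y, P x y = 1) (hπ : ∀ x, 0 < π x)
    (hπ1 : ∑ x, π x = 1) {m q : ℝ} (hq0 : 0 ≤ q) (hq1 : q < 1) :
    ∑ A, GG P π m q A = m := by
  simp only [GG, ← Finset.mul_sum]
  rw [← Summable.tsum_finsetSum (fun A _ => GG_summable hP hP1 hπ hπ1 hq0 hq1 A)]
  simp_rw [← Finset.mul_sum, rr_sum hP1 hπ1, mul_one]
  rw [tsum_geometric_of_lt_one hq0 hq1, mul_inv_cancel₀ (by linarith), mul_one]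

/-- comparison property -/
def CmpP (P : V → V → ℝ) (π : V → ℝ) : Prop :=
  ∀ q1 q2 m : ℝ, 0 < q2 → q2 < q1 → q1 < 1 → 0 ≤ m → ∀ B : Finset V,
    FF (GG P π m q1) B ≤ 1/8 →
    FF (GG P π (9 * m * ((1/q2 - 1) / (1/q1 - 1))) q2) B ≤ 8 * FF (GG P π m q1) B

lemma FF_pow (hP : ∀ x y, 0 ≤ P x y) (hπ : ∀ x, 0 < π x)
    {m q : ℝ} (hm : 0 ≤ m) (hq0 : 0 ≤ q) (hq1 : q < 1) (B : Finset V) (r : ℕ) :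
    FF (GG P π (m * (r+1)) q) B ≤ FF (GG P π m q) B ^ (r+1) := by
  induction r with
  | zero => simp
  | succ r ih =>
    have e : m * (((r+1 : ℕ) : ℝ) + 1) = m * (r + 1) + m := by push_cast; ring
    rw [e, GG_add, pow_succ]
    exact (FF_add_le_mul (GG_nonneg hP hπ (by positivity) hq0 hq1) (GG_nonneg hP hπ hm hq0 hq1) B).trans
      (mul_le_mul_of_nonneg_right ih (FF_nonneg _ _))

lemma GG_split (hP : ∀ x y, 0 ≤ P x y) (hP1 : ∀ x, ∑ y, P x y = 1) (hπ : ∀ x, 0 < π x)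
    (hπ1 : ∑ x, π x = 1) {m a : ℝ} (hm : 0 ≤ m) (ha0 : 0 < a) (ha1 : a < 1) (S : ℕ) (A : Finset V) :
    GG P π m (a^2) A ≤ GS P π S m (a^2) A + GG P π (2 * m * a^S) a A := by
  have ha2 : a^2 < 1 := by nlinarith
  have hs := GG_summable hP hP1 hπ hπ1 (sq_nonneg a) ha2 A
  have hs' := GG_summable hP hP1 hπ hπ1 ha0.le ha1 A
  rw [GG, ← hs.sum_add_tsum_nat_add (S+1)]
  have h1 : ∑' j : ℕ, (a^2)^(j+(S+1)) * rr P π (j+(S+1)) A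
      ≤ a^S * ∑' j : ℕ, a^j * rr P π j A := by
    have h2 : ∑' j : ℕ, a^(j+(S+1)) * rr P π (j+(S+1)) A ≤ ∑' j : ℕ, a^j * rr P π j A := by
      rw [← hs'.sum_add_tsum_nat_add (S+1)]
      have : 0 ≤ ∑ j ∈ Finset.range (S+1), a^j * rr P π j A := Finset.sum_nonneg fun j _ =>
        mul_nonneg (by positivity) (rr_nonneg hP hπ j A)
      linarith
    refine le_trans ?_ (mul_le_mul_of_nonneg_left h2 (by positivity))
    rw [← tsum_mul_left]
    have hsS : Summable (fun j : ℕ => (a^2)^(j+(S+1)) * rr P π (j+(S+1)) A) :=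
      (summable_nat_add_iff (f := fun j : ℕ => (a^2)^j * rr P π j A) (S+1)).2 hs
    have hsS' : Summable (fun j : ℕ => a^(j+(S+1)) * rr P π (j+(S+1)) A) :=
      (summable_nat_add_iff (f := fun j : ℕ => a^j * rr P π j A) (S+1)).2 hs'
    have hpt : ∀ j : ℕ, (a^2)^(j+(S+1)) * rr P π (j+(S+1)) A
        ≤ a^S * (a^(j+(S+1)) * rr P π (j+(S+1)) A) := by
      intro j
      have hpw : (a^2)^(j+(S+1)) ≤ a^S * a^(j+(S+1)) := by
        rw [← pow_mul, ← pow_add]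
        exact pow_le_pow_of_le_one ha0.le ha1.le (by omega)
      have := mul_le_mul_of_nonneg_right hpw (rr_nonneg hP hπ (j+(S+1)) A)
      rw [mul_assoc] at this
      exact this
    exact Summable.tsum_le_tsum hpt hsS (hsS'.mul_left _)
  have e1 : GS P π S m (a^2) A = m * ((1 - a^2) * ∑ j ∈ Finset.range (S+1), (a^2)^j * rr P π j A) := by
    rw [GS, Finset.mul_sum, Finset.mul_sum]
    refine Finset.sum_congr rfl fun j _ => by ring
  rw [e1, GG]
  set X := ∑' j : ℕ, a^j * rr P π j A
  have hX : 0 ≤ X := tsum_nonneg fun j => mul_nonneg (by positivity) (rr_nonneg hP hπ j A)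
  have h3 : m * ((1 - a^2) * ∑' j : ℕ, (a^2)^(j+(S+1)) * rr P π (j+(S+1)) A)
      ≤ m * ((1 - a^2) * (a^S * X)) := by
    refine mul_le_mul_of_nonneg_left (mul_le_mul_of_nonneg_left h1 (by linarith)) hm
  have h4 : m * ((1 - a^2) * (a^S * X)) ≤ 2 * m * a^S * ((1 - a) * X) := by
    have : 0 ≤ m * a^S * X * (1 - a) * (1 - a) := by
      have : 0 ≤ 1 - a := by linarith
      positivity
    nlinarith
  rw [mul_add, mul_add]
  linarith

lemma kappa_ratio {a : ℝ} (ha0 : 0 < a) (ha1 : a < 1) :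
    (1/(a^2)^2 - 1) / (1/a - 1) ≤ 4 / a^3 := by
  have h1 : 0 < 1 - a := by linarith
  have e : (1/(a^2)^2 - 1) / (1/a - 1) = (1+a)*(1+a^2) / a^3 := by
    have : 1/a - 1 = (1-a)/a := by field_simp
    rw [this]
    field_simp
    ring
  rw [e]
  refine div_le_div_of_nonneg_right ?_ (by positivity)
  nlinarith [mul_pos ha0 ha0]

lemma trunc_step (hP : ∀ x y, 0 ≤ P x y) (hP1 : ∀ x, ∑ y, P x y = 1) (hπ : ∀ x, 0 < π x)
    (hπ1 : ∑ x, π x = 1) (hC : CmpP P π) {m a m' : ℝ} (hm : 0 ≤ m) (ha0 : 0 < a) (ha1 : a < 1)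
    (S i : ℕ) (hm' : 72 * m * (2^(i+5)+1) * a^S / a^3 ≤ m') (B : Finset V) :
    FF (GG P π m' ((a^2)^2)) B * (1 - 1/2^(i+3)) ≤ FF (GG P π (2 * m * a^S) a) B := by
  have ha4 : (a^2)^2 < a := by
    have : a^2 < a := by nlinarith
    have : (a^2)^2 < a^2 := by nlinarith [sq_nonneg a]
    linarith
  have hm0 : 0 ≤ 2 * m * a^S := by positivity
  set f := FF (GG P π (2 * m * a^S) a) B with hf
  set F := FF (GG P π m' ((a^2)^2)) B with hF
  have hm'0 : 0 ≤ m' := le_trans (by positivity) hm'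
  have hF1 : F ≤ 1 := FF_le_one (GG_nonneg hP hπ hm'0 (by positivity) (by linarith)) B
  have hF0 : 0 ≤ F := FF_nonneg _ _
  have hf0 : 0 ≤ f := FF_nonneg _ _
  set θ : ℝ := 1/2^(i+3) with hθ
  have hθ0 : 0 < θ := by positivity
  have hθ1 : θ ≤ 1 := by
    rw [hθ, div_le_one (by positivity)]; exact one_le_pow₀ (by norm_num)
  rcases le_or_gt (1 - θ) f with h | h
  · nlinarith
  have h1 : f^(2^(i+5)) ≤ 1/8 := by
    calc f^(2^(i+5)) ≤ (Real.exp (-θ))^(2^(i+5)) := by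
          refine pow_le_pow_left₀ hf0 ?_ _
          have := Real.add_one_le_exp (-θ)
          linarith
      _ = Real.exp (-4) := by
          rw [← Real.exp_nat_mul]
          congr 1
          push_cast
          rw [hθ, pow_add, pow_add]
          field_simp
          norm_num
      _ ≤ 1/8 := by
          rw [Real.exp_neg, ← one_div]
          apply one_div_le_one_div_of_le (by norm_num)
          have h2 : (2:ℝ) ≤ Real.exp 1 := by have := Real.add_one_le_exp (1:ℝ); linarith
          calc (8:ℝ) ≤ 2^4 := by norm_num
            _ ≤ Real.exp 1 ^ 4 := pow_le_pow_left₀ (by norm_num) h2 4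
            _ = Real.exp 4 := by rw [← Real.exp_nat_mul]; norm_num
  have h2 := FF_pow hP hπ hm0 ha0.le ha1 B (2^(i+5))
  rw [← hf] at h2
  have hf1 : f ≤ 1 := by linarith
  have h3 : f^(2^(i+5)+1) ≤ 1/8 * f := by
    rw [pow_succ]; exact mul_le_mul_of_nonneg_right h1 hf0
  have h4 := hC a ((a^2)^2) (2 * m * a^S * ((2^(i+5) : ℕ) + 1)) (by positivity) ha4 ha1
    (by positivity) B (by linarith)
  have h5 : F ≤ FF (GG P π (9 * (2 * m * a^S * ((2^(i+5) : ℕ) + 1))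
      * ((1/(a^2)^2 - 1) / (1/a - 1))) ((a^2)^2)) B := by
    refine FF_anti (GG_nonneg hP hπ ?_ (by positivity) (by linarith))
      (GG_mono_m hP hπ ?_ (by positivity) (by linarith)) B
    · have : 0 ≤ (1/(a^2)^2 - 1) / (1/a - 1) := by
        apply div_nonneg
        · rw [sub_nonneg, le_div_iff₀ (by positivity)]; linarith
        · rw [sub_nonneg, le_div_iff₀ (by positivity)]; linarith
      positivity
    · refine le_trans (mul_le_mul_of_nonneg_left (kappa_ratio ha0 ha1) (by positivity)) ?_
      refine le_trans (le_of_eq ?_) hm'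
      push_cast
      ring
  have h6 : F ≤ f := by linarith
  nlinarith

lemma trunc (hP : ∀ x y, 0 ≤ P x y) (hP1 : ∀ x, ∑ y, P x y = 1) (hπ : ∀ x, 0 < π x)
    (hπ1 : ∑ x, π x = 1) (hC : CmpP P π) {m a ε : ℝ} (hm : 0 < m) (ha0 : 0 < a) (ha1 : a < 1)
    (S : ℕ) (ha : a^S / a^3 ≤ 1/2^14) (B : Finset V) (hε : FF (GG P π m (a^2)) B ≤ ε) (I : ℕ) :
    FF ((fun A => ∑ i ∈ Finset.range I, GS P π S (m/2^i) ((a^2^i)^2) A) + GG P π (m/2^I) ((a^2^I)^2)) B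
      ≤ ε * (2 - 1/2^I) := by
  have hb0 : ∀ i, 0 < a^2^i := fun i => by positivity
  have hb1 : ∀ i, a^2^i < 1 := fun i => pow_lt_one₀ ha0.le ha1 (by positivity)
  have hc1 : ∀ i, (a^2^i)^2 < 1 := fun i => pow_lt_one₀ (hb0 i).le (hb1 i) (by norm_num)
  have hc0 : ∀ i, 0 ≤ (a^2^i)^2 := fun i => by positivity
  have hε0 : 0 ≤ ε := (FF_nonneg _ _).trans hε
  induction I with
  | zero =>
    have : ((fun A => ∑ i ∈ Finset.range 0, GS P π S (m/2^i) ((a^2^i)^2) A) + GG P π (m/2^0) ((a^2^0)^2))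
      = GG P π m (a^2) := by funext A; simp
    rw [this]
    simp; linarith
  | succ I ih =>
    set N : Finset V → ℝ := fun A => ∑ i ∈ Finset.range I, GS P π S (m/2^i) ((a^2^i)^2) A with hN
    have hN0 : ∀ A, 0 ≤ N A := fun A => Finset.sum_nonneg fun i _ =>
      GS_nonneg hP hπ S (by positivity) (hc0 i) (hc1 i) A
    set N' : Finset V → ℝ := fun A => ∑ i ∈ Finset.range (I+1), GS P π S (m/2^i) ((a^2^i)^2) A with hN'
    have hN'0 : ∀ A, 0 ≤ N' A := fun A => Finset.sum_nonneg fun i _ =>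
      GS_nonneg hP hπ S (by positivity) (hc0 i) (hc1 i) A
    have e : N' = N + GS P π S (m/2^I) ((a^2^I)^2) := by
      funext A; simp only [hN, hN', Pi.add_apply, Finset.sum_range_succ]
    set L := GG P π (2 * (m/2^I) * (a^2^I)^S) (a^2^I) with hL
    have hL0 : ∀ A, 0 ≤ L A := GG_nonneg hP hπ (by positivity) (hb0 I).le (hb1 I)
    have h1 : FF (N' + L) B ≤ ε * (2 - 1/2^I) := by
      refine le_trans (FF_anti (fun A => add_nonneg (hN0 A)
        (GG_nonneg hP hπ (by positivity) (hc0 I) (hc1 I) A)) (fun A => ?_) B) ih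
      rw [e]
      simp only [Pi.add_apply]
      have := GG_split hP hP1 hπ hπ1 (m := m/2^I) (by positivity) (hb0 I) (hb1 I) S A
      linarith
    have hreq : 72 * (m/2^I) * (2^(I+5)+1) * (a^2^I)^S / (a^2^I)^3 ≤ m/2^(I+1) := by
      have h2 : (a^2^I)^S / (a^2^I)^3 ≤ 1/2^(I+14) := by
        calc _ = (a^S / a^3)^2^I := by
              rw [div_pow, ← pow_mul, ← pow_mul, ← pow_mul, ← pow_mul, mul_comm S, mul_comm 3]
          _ ≤ (1/2^14)^2^I := pow_le_pow_left₀ (by positivity) ha _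
          _ = 1/2^(14*2^I) := by rw [div_pow, one_pow, ← pow_mul]
          _ ≤ _ := by
              apply one_div_le_one_div_of_le (by positivity)
              apply pow_le_pow_right₀ (by norm_num)
              have : I + 1 ≤ 2^I := Nat.lt_two_pow_self
              omega
      calc _ = 72 * (m/2^I) * (2^(I+5)+1) * ((a^2^I)^S / (a^2^I)^3) := by ring
        _ ≤ 72 * (m/2^I) * (2^(I+5)+2^(I+5)) * (1/2^(I+14)) := by
            have : (1:ℝ) ≤ 2^(I+5) := one_le_pow₀ (by norm_num)
            gcongr
        _ = m/2^I * (72 * 2 * 2^5 / 2^14) := by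
            rw [pow_add 2 I 5, pow_add 2 I 14]; field_simp; norm_num
        _ ≤ m/2^I * (1/2) := by
            refine mul_le_mul_of_nonneg_left (by norm_num) (by positivity)
        _ = _ := by rw [pow_succ]; field_simp
    have e2 : (a^2^(I+1)) = (a^2^I)^2 := by rw [← pow_mul, pow_succ]
    have h3 : FF (N' + GG P π (m/2^(I+1)) ((a^2^(I+1))^2)) B * (1 - 1/2^(I+3)) ≤ FF (N' + L) B := by
      rw [FF_add hN'0 hL0, FF_add hN'0 (GG_nonneg hP hπ (by positivity) (hc0 _) (hc1 _)), Finset.sum_mul]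
      refine Finset.sum_le_sum fun T _ => ?_
      rw [mul_assoc]
      refine mul_le_mul_of_nonneg_left ?_ (pois_nonneg _ _)
      rw [e2]
      exact trunc_step hP hP1 hπ hπ1 hC (by positivity) (hb0 I) (hb1 I) S I hreq _
    have hx : (0:ℝ) < 1/2^I := by positivity
    have hx1 : (1:ℝ)/2^I ≤ 1 := by
      rw [div_le_one (by positivity)]; exact one_le_pow₀ (by norm_num)
    set X := FF (N' + GG P π (m/2^(I+1)) ((a^2^(I+1))^2)) B
    have e3 : (1:ℝ)/2^(I+3) = (1/2^I)/8 := by rw [pow_add]; field_simp; norm_num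
    have e4 : (1:ℝ)/2^(I+1) = (1/2^I)/2 := by rw [pow_add]; field_simp
    rw [e3] at h3
    rw [e4]
    set u : ℝ := 1/2^I
    have h5 : X * (1 - u/8) ≤ ε * (2 - u) := h3.trans h1
    have h6 : ε * (2 - u) ≤ ε * (2 - u/2) * (1 - u/8) := by
      rw [mul_assoc]
      refine mul_le_mul_of_nonneg_left ?_ hε0
      nlinarith
    have h7 : 0 < 1 - u/8 := by linarith
    exact le_of_mul_le_mul_right (h5.trans h6) h7

lemma trunc_DD (hP : ∀ x y, 0 ≤ P x y) (hP1 : ∀ x, ∑ y, P x y = 1) (hπ : ∀ x, 0 < π x)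
    (hπ1 : ∑ x, π x = 1) (hC : CmpP P π) {m a ε : ℝ} (hm : 0 < m) (ha0 : 0 < a) (ha1 : a < 1)
    (S : ℕ) (ha : a^S / a^3 ≤ 1/2^14) (B : Finset V) (hε : FF (GG P π m (a^2)) B ≤ ε) (j : ℕ) :
    DD (rr P π S) j B * (1 - Real.exp (2*m) / 2^j) ≤ 4 * ε := by
  have hb0 : ∀ i, 0 < a^2^i := fun i => by positivity
  have hb1 : ∀ i, a^2^i < 1 := fun i => pow_lt_one₀ ha0.le ha1 (by positivity)
  have hc1 : ∀ i, (a^2^i)^2 < 1 := fun i => pow_lt_one₀ (hb0 i).le (hb1 i) (by norm_num)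
  have hc0 : ∀ i, 0 ≤ (a^2^i)^2 := fun i => by positivity
  have hε0 : 0 ≤ ε := (FF_nonneg _ _).trans hε
  obtain ⟨I0, hI0⟩ := exists_pow_lt_of_lt_one (show 0 < 1/(2*m) by positivity)
    (show (1/2:ℝ) < 1 by norm_num)
  set I := I0 + 1 with hI
  have hmI : m/2^I ≤ 1/2 := by
    have h1 : (1/2:ℝ)^I ≤ (1/2)^I0 := pow_le_pow_of_le_one (by norm_num) (by norm_num) (by omega)
    have h2 : (1/2:ℝ)^I < 1/(2*m) := lt_of_le_of_lt h1 hI0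
    rw [one_div_pow] at h2
    have h3 := mul_le_mul_of_nonneg_left h2.le hm.le
    have e : m * (1/(2*m)) = 1/2 := by field_simp
    rw [e] at h3
    calc m/2^I = m * (1/2^I) := by ring
      _ ≤ _ := h3
  have h1 := trunc hP hP1 hπ hπ1 hC hm ha0 ha1 S ha B hε I
  set N : Finset V → ℝ := fun A => ∑ i ∈ Finset.range I, GS P π S (m/2^i) ((a^2^i)^2) A with hN
  have hN0 : ∀ A, 0 ≤ N A := fun A => Finset.sum_nonneg fun i _ =>
      GS_nonneg hP hπ S (by positivity) (hc0 i) (hc1 i) A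
  have h2 := FF_add_ge hN0 (GG_nonneg hP hπ (show 0 ≤ m/2^I by positivity) (hc0 I) (hc1 I)) B
  rw [GG_sum hP hP1 hπ hπ1 (hc0 I) (hc1 I)] at h2
  have h3 : (1/2:ℝ) ≤ Real.exp (-(m/2^I)) := by
    have := Real.add_one_le_exp (-(m/2^I))
    linarith
  have h4 : FF N B ≤ 4 * ε := by
    have h5 := mul_le_mul_of_nonneg_right h3 (FF_nonneg N B)
    have h6 : ε * (2 - 1/2^I) ≤ 2 * ε := by
      have : (0:ℝ) ≤ 1/2^I := by positivity
      nlinarith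
    linarith
  refine le_trans ?_ h4
  -- weights
  let w : ℕ → ℝ := fun l => ∑ i ∈ Finset.range I, (m/2^i) * (1 - (a^2^i)^2) * ((a^2^i)^2)^l
  have hw0 : ∀ l, 0 ≤ w l := fun l => Finset.sum_nonneg fun i _ =>
    mul_nonneg (mul_nonneg (by positivity) (by linarith [hc1 i])) (by positivity)
  have eN : ∀ A, N A = ∑ l ∈ Finset.range (S+1), w l * rr P π l A := by
    intro A
    simp only [hN, GS, w, Finset.sum_mul]
    rw [Finset.sum_comm]
  set M := ∑ l ∈ Finset.range (S+1), w l with hM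
  have hM0 : 0 < M := by
    refine Finset.sum_pos' (fun l _ => hw0 l) ⟨0, by simp, ?_⟩
    refine Finset.sum_pos (fun i _ => ?_) ⟨0, by simp [hI]⟩
    have := hc1 i
    have : 0 < 1 - (a^2^i)^2 := by linarith
    positivity
  have hM2 : M ≤ 2 * m := by
    rw [hM, Finset.sum_comm]
    calc _ ≤ ∑ i ∈ Finset.range I, m/2^i := by
          refine Finset.sum_le_sum fun i _ => ?_
          rw [← Finset.mul_sum]
          have h7 : (1 - (a^2^i)^2) * ∑ l ∈ Finset.range (S+1), ((a^2^i)^2)^l ≤ 1 := by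
            rw [mul_comm, geom_sum_mul_neg]
            have : 0 ≤ ((a^2^i)^2)^(S+1) := by positivity
            linarith
          calc _ = m/2^i * ((1 - (a^2^i)^2) * ∑ l ∈ Finset.range (S+1), ((a^2^i)^2)^l) := by ring
            _ ≤ _ := mul_le_of_le_one_right (by positivity) h7
      _ = m * ∑ i ∈ Finset.range I, (1/2:ℝ)^i := by
          rw [Finset.mul_sum]
          refine Finset.sum_congr rfl fun i _ => by rw [one_div_pow]; ring
      _ ≤ m * 2 := mul_le_mul_of_nonneg_left (sum_geometric_two_le I) hm.le
      _ = _ := by ring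
  have eN2 : N = M • (M⁻¹ • N) := by rw [smul_smul, mul_inv_cancel₀ hM0.ne', one_smul]
  have h8 := FF_ge_DD (rr_nonneg hP hπ S) (rr_sum hP1 hπ1 S) (r' := M⁻¹ • N)
    (fun A => mul_nonneg (by positivity) (hN0 A)) (by
      simp only [Pi.smul_apply, smul_eq_mul, ← Finset.mul_sum, eN]
      rw [Finset.sum_comm]
      simp only [← Finset.mul_sum, rr_sum hP1 hπ1, mul_one]
      exact inv_mul_cancel₀ hM0.ne') (fun Φ hΦ => by
      have : ex (M⁻¹ • N) Φ = M⁻¹ * ∑ l ∈ Finset.range (S+1), w l * ex (rr P π l) Φ := by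
        simp only [ex, Pi.smul_apply, smul_eq_mul, eN, Finset.mul_sum, Finset.sum_mul]
        rw [Finset.sum_comm]
        simp only [mul_assoc]
      rw [this, inv_mul_eq_div, le_div_iff₀ hM0, hM, Finset.mul_sum]
      refine Finset.sum_le_sum fun l hl => ?_
      rw [mul_comm]
      exact mul_le_mul_of_nonneg_left (ex_rr_anti hP hP1 hπ hΦ
        (by simpa using Nat.lt_succ_iff.1 (Finset.mem_range.1 hl))) (hw0 l)) hM0.le j B
  rw [← eN2] at h8
  refine le_trans (mul_le_mul_of_nonneg_left ?_ (DD_nonneg (rr_nonneg hP hπ S) j B)) h8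
  have := Real.exp_le_exp.2 hM2
  have : Real.exp M / 2^j ≤ Real.exp (2*m) / 2^j := div_le_div_of_nonneg_right this (by positivity)
  linarith

end Geo


section Assemble
variable {V : Type*} [Fintype V] [DecidableEq V] {P : V → V → ℝ} {π : V → ℝ}

lemma multi_le_of_tail (hP : ∀ x y, 0 ≤ P x y) (hP1 : ∀ x, ∑ y, P x y = 1) (k T : ℕ)
    (h : ∀ x0 : Fin k → V, fl (MR P k T x0) Finset.univ ≤ 1/2) (x0 : Fin k → V) :
    multiExpCov P k x0 ≤ 2 * T := by
  rw [multiExpCov_eq]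
  have := (fl_osig_sum (fun a b : Fin k → V => ∏ i, P (a i) (b i)) (fun a => Finset.univ.image a)
    (fun a b => ker_nonneg P hP a b) (fun a => ker_sum P hP1 a) T (1/2) (by norm_num) (by norm_num)
    h x0).2
  refine this.trans (le_of_eq ?_)
  norm_num
  ring

lemma R_univ (hP1 : ∀ x, ∑ y, P x y = 1) (t : ℕ) (x : V) :
    R P t x Finset.univ = 1 - fl (R P t x) Finset.univ := by
  rw [← R_sum P hP1 t x, fl, ← Finset.sum_sub_distrib]
  rw [Finset.sum_eq_single Finset.univ]
  · simp
  · intro b _ hb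
    rw [if_neg]
    · ring
    · intro h
      exact hb (Finset.univ_subset_iff.1 h)
  · simp

lemma rr_univ_ge [Nonempty V] (hP : ∀ x y, 0 ≤ P x y) (hP1 : ∀ x, ∑ y, P x y = 1)
    (hirr : ∀ x y, ∃ n : ℕ, 0 < (Matrix.of P ^ n) x y) (hπ : ∀ x, 0 < π x) (hπ1 : ∑ x, π x = 1)
    (s t : ℕ) (hs : 0 < s) (hst : 4 * tcov P ≤ s) (ht : s ≤ t) : 3/4 ≤ rr P π t Finset.univ := by
  have h : ∀ x, 3/4 ≤ R P t x Finset.univ := by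
    intro x
    rw [R_univ hP1]
    have h1 := tail_le_tcov P hP hP1 hirr x s
    have h2 := fl_R_anti P hP hP1 x Finset.univ ht
    have hs' : (0:ℝ) < s := by exact_mod_cast hs
    dsimp only at h2
    have : fl (R P s x) Finset.univ ≤ 1/4 := by
      rw [← mul_le_mul_iff_right₀ hs']
      linarith
    linarith
  calc (3/4:ℝ) = ∑ x, π x * (3/4) := by rw [← Finset.sum_mul, hπ1, one_mul]
    _ ≤ _ := Finset.sum_le_sum fun x _ => mul_le_mul_of_nonneg_left (h x) (hπ x).le

lemma GG_univ_ge (hP : ∀ x y, 0 ≤ P x y) (hP1 : ∀ x, ∑ y, P x y = 1) (hπ : ∀ x, 0 < π x)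
    (hπ1 : ∑ x, π x = 1) {m q : ℝ} (hm : 0 ≤ m) (hq0 : 0 ≤ q) (hq1 : q < 1) (s : ℕ)
    (h : ∀ t, s ≤ t → 3/4 ≤ rr P π t Finset.univ) :
    m * (q^s * (3/4)) ≤ GG P π m q Finset.univ := by
  unfold GG
  refine mul_le_mul_of_nonneg_left ?_ hm
  have hs := GG_summable hP hP1 hπ hπ1 hq0 hq1 Finset.univ
  have h1 : ∑' j : ℕ, q^s * (3/4) * q^j ≤ ∑' j : ℕ, q^j * rr P π j Finset.univ := by
    rw [← hs.sum_add_tsum_nat_add s]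
    have h0 : 0 ≤ ∑ j ∈ Finset.range s, q^j * rr P π j Finset.univ := Finset.sum_nonneg fun j _ =>
      mul_nonneg (by positivity) (rr_nonneg hP hπ j _)
    have hsS : Summable (fun j : ℕ => q^(j+s) * rr P π (j+s) Finset.univ) :=
      (summable_nat_add_iff (f := fun j : ℕ => q^j * rr P π j Finset.univ) s).2 hs
    have h2 : ∑' j : ℕ, q^s * (3/4) * q^j ≤ ∑' j : ℕ, q^(j+s) * rr P π (j+s) Finset.univ := by
      refine Summable.tsum_le_tsum (fun j => ?_) ((summable_geometric_of_lt_one hq0 hq1).mul_left _) hsS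
      have := mul_le_mul_of_nonneg_left (h (j+s) (by omega)) (show 0 ≤ q^(j+s) by positivity)
      calc q^s * (3/4) * q^j = q^(j+s) * (3/4) := by rw [pow_add]; ring
        _ ≤ _ := this
    linarith
  rw [tsum_mul_left, tsum_geometric_of_lt_one hq0 hq1] at h1
  have h3 := mul_le_mul_of_nonneg_left h1 (show 0 ≤ 1 - q by linarith)
  refine le_trans (le_of_eq ?_) h3
  have : 1 - q ≠ 0 := by linarith
  field_simp

lemma exp_neg_seven : Real.exp (-7) ≤ 1/512 := by
  rw [Real.exp_neg, ← one_div]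
  apply one_div_le_one_div_of_le (by norm_num)
  have h2 : (2.7:ℝ) ≤ Real.exp 1 := by have := Real.exp_one_gt_d9; linarith
  calc (512:ℝ) ≤ 2.7^7 := by norm_num
    _ ≤ Real.exp 1 ^ 7 := pow_le_pow_left₀ (by norm_num) h2 7
    _ = Real.exp 7 := by rw [← Real.exp_nat_mul]; norm_num

lemma FF_start [Nonempty V] (hP : ∀ x y, 0 ≤ P x y) (hP1 : ∀ x, ∑ y, P x y = 1)
    (hirr : ∀ x y, ∃ n : ℕ, 0 < (Matrix.of P ^ n) x y) (hπ : ∀ x, 0 < π x) (hπ1 : ∑ x, π x = 1)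
    (s : ℕ) (hs : 0 < s) (hst : 4 * tcov P ≤ s) :
    FF (GG P π 14 (1 - 1/(3*s))) Finset.univ ≤ 1/512 := by
  have hs' : (1:ℝ) ≤ s := by exact_mod_cast hs
  have hx : (1:ℝ)/(3*s) ≤ 1/3 := by
    apply one_div_le_one_div_of_le (by norm_num); linarith
  have hx0 : (0:ℝ) < 1/(3*s) := by positivity
  have h1 := GG_univ_ge hP hP1 hπ hπ1 (m := 14) (q := 1 - 1/(3*s)) (by norm_num) (by linarith)
    (by linarith) s (fun t ht => rr_univ_ge hP hP1 hirr hπ hπ1 s t hs hst ht)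
  have h2 := one_add_mul_le_pow (a := -(1/(3*(s:ℝ)))) (by linarith) s
  have e : (s:ℝ) * -(1/(3*(s:ℝ))) = -(1/3) := by field_simp
  rw [e, ← sub_eq_add_neg 1 (1/(3*(s:ℝ)))] at h2
  refine (FF_le_exp (GG_nonneg hP hπ (by norm_num) (by linarith) (by linarith)) _).trans
    (le_trans (Real.exp_le_exp.2 ?_) exp_neg_seven)
  linarith

lemma exp_two_pow (j : ℕ) (hj : 2 ≤ j) {y : ℝ} (hy : y ≤ ((j:ℝ) - 1)/2) : Real.exp y / 2^j ≤ 1/2 := by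
  obtain ⟨i, rfl⟩ : ∃ i, j = i + 1 := ⟨j - 1, by omega⟩
  have h1 : Real.exp (1/2) ≤ 2 := by
    have h : Real.exp (1/2) ^ 2 ≤ 2^2 := by
      rw [← Real.exp_nat_mul]
      have := Real.exp_one_lt_d9
      norm_num
      linarith
    exact (pow_le_pow_iff_left₀ (Real.exp_pos _).le (by norm_num) (by norm_num)).1 h
  have h2 : Real.exp y ≤ 2^i := by
    calc Real.exp y ≤ Real.exp (i * (1/2)) := Real.exp_le_exp.2 (by push_cast at hy; linarith)
      _ = Real.exp (1/2) ^ i := by rw [Real.exp_nat_mul]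
      _ ≤ 2^i := pow_le_pow_left₀ (Real.exp_pos _).le h1 i
  rw [div_le_iff₀ (by positivity), pow_succ]
  linarith

set_option maxHeartbeats 1000000 in
lemma assemble [Nontrivial V] (hP : ∀ x y, 0 ≤ P x y) (hP1 : ∀ x, ∑ y, P x y = 1)
    (hirr : ∀ x y, ∃ n : ℕ, 0 < (Matrix.of P ^ n) x y) (hπ : ∀ x, 0 < π x) (hπ1 : ∑ x, π x = 1)
    (hr : ∀ x y, π x * P x y = π y * P y x) (hC : CmpP P π) (k : ℕ) (hk : 0 < k) (x0 : Fin k → V) :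
    multiExpCov P k x0 ≤ (1000 * 2^14) * ((tmix P π : ℝ) + tcov P / k) := by
  have htc := one_le_tcov P hP hP1 hirr
  have htm : (1:ℝ) ≤ tmix P π := by exact_mod_cast tmix_pos hP hP1 hirr hπ hπ1 hr
  have hk' : (0:ℝ) < k := by exact_mod_cast hk
  rcases le_or_gt k (2^14) with hk1 | hk1
  · -- few walkers
    have hk2 : (k:ℝ) ≤ 2^14 := by exact_mod_cast hk1
    set T := ⌈2 * tcov P⌉₊ with hT
    have hT1 : 2 * tcov P ≤ T := Nat.le_ceil _
    have hT2 : (T:ℝ) ≤ 2 * tcov P + 1 := (Nat.ceil_lt_add_one (by linarith)).le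
    obtain ⟨k, rfl⟩ : ∃ i, k = i + 1 := ⟨k - 1, by omega⟩
    have := multi_le_of_tail hP hP1 (k+1) T (fun x0 => by
      refine (fl_MR_one hP hP1 k T x0 _).trans ?_
      have h1 := tail_le_tcov P hP hP1 hirr (x0 0) T
      have h2 : (0:ℝ) < T := by linarith
      rw [← mul_le_mul_iff_right₀ h2]
      linarith) x0
    have h3 : tcov P ≤ 2^14 * (tcov P / ((k+1:ℕ):ℝ)) := by
      rw [mul_div_assoc', le_div_iff₀ hk', mul_comm]
      exact mul_le_mul_of_nonneg_right hk2 (by linarith)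
    nlinarith
  set s := ⌈4 * tcov P⌉₊ with hs
  have hs1 : 4 * tcov P ≤ s := Nat.le_ceil _
  have hs2 : (s:ℝ) ≤ 4 * tcov P + 1 := (Nat.ceil_lt_add_one (by linarith)).le
  have hs0 : (4:ℝ) ≤ s := by linarith
  have hs00 : 0 < s := by
    have : (0:ℝ) < s := by linarith
    exact_mod_cast this
  have hkC : (2:ℝ)^14 < k := by exact_mod_cast hk1
  set κ1 : ℝ := 1/(3*s-1) with hκ1
  have hκ1p : 0 < κ1 := by rw [hκ1]; apply one_div_pos.2; linarith
  set κ2 : ℝ := k * κ1 / 2^14 with hκ2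
  have hκ2p : 0 < κ2 := by positivity
  have hκ12 : κ1 < κ2 := by
    rw [hκ2, lt_div_iff₀ (by positivity), mul_comm]
    exact mul_lt_mul_of_pos_right hkC hκ1p
  set q1 : ℝ := 1 - 1/(3*s) with hq1
  have hq1' : q1 = 1/(1+κ1) := by
    rw [hq1, hκ1]
    have : (3*(s:ℝ)-1) ≠ 0 := by linarith
    have h3 : 1 + 1/(3*(s:ℝ)-1) = 3*s/(3*s-1) := by field_simp; ring
    rw [h3]
    field_simp
  set q2 : ℝ := 1/(1+κ2) with hq2
  have e1 : 1/q1 - 1 = κ1 := by rw [hq1', one_div_one_div]; ring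
  have e2 : 1/q2 - 1 = κ2 := by rw [hq2, one_div_one_div]; ring
  have hq2p : 0 < q2 := by positivity
  have hq21 : q2 < q1 := by
    rw [hq1', hq2]; exact one_div_lt_one_div_of_lt (by positivity) (by linarith)
  have hq11 : q1 < 1 := by
    rw [hq1', div_lt_one (by positivity)]; linarith
  have h0 := FF_start hP hP1 hirr hπ hπ1 s hs00 hs1
  have h1 := hC q1 q2 14 hq2p hq21 hq11 (by norm_num) Finset.univ (h0.trans (by norm_num))
  rw [e1, e2] at h1
  set m0 : ℝ := 9 * 14 * (κ2/κ1) with hm0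
  have hm0' : m0 = 126 * k / 2^14 := by
    rw [hm0, hκ2]; field_simp; norm_num
  have hm0p : 0 < m0 := by positivity
  have h2 : FF (GG P π m0 q2) Finset.univ ≤ 1/64 := by linarith
  set a := Real.sqrt q2 with ha
  have ha2 : a^2 = q2 := Real.sq_sqrt hq2p.le
  have hap : 0 < a := Real.sqrt_pos.2 hq2p
  have ha1 : a < 1 := by
    by_contra h
    have : 1 ≤ a^2 := one_le_pow₀ (not_lt.1 h)
    linarith
  set n := ⌈1/κ2⌉₊ with hn
  have hn1 : 1/κ2 ≤ n := Nat.le_ceil _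
  have hn2 : (n:ℝ) ≤ 1/κ2 + 1 := (Nat.ceil_lt_add_one (by positivity)).le
  have hpow : 2 ≤ (1+κ2)^n := by
    have h3 := one_add_mul_le_pow (a := κ2) (by linarith) n
    have : 1 ≤ n * κ2 := by
      rw [div_le_iff₀ hκ2p] at hn1; linarith
    linarith
  set S := 3 + 28 * n with hS
  have haS : a^S / a^3 ≤ 1/2^14 := by
    rw [hS, pow_add, mul_div_cancel_left₀ _ (by positivity)]
    have : a^(28*n) = 1/((1+κ2)^n)^14 := by
      rw [show 28 * n = 2 * (n * 14) by ring, pow_mul, ha2, hq2, div_pow, one_pow, pow_mul]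
    rw [this]
    exact one_div_le_one_div_of_le (by positivity) (pow_le_pow_left₀ (by norm_num) hpow 14)
  set j := k / 8 with hj
  have hj1 : 2048 ≤ j := by omega
  have hj2 : k < 8 * j + 8 := by omega
  have hj3 : 8 * j ≤ k := by omega
  have hj1' : (2048:ℝ) ≤ j := by exact_mod_cast hj1
  have hj2' : (k:ℝ) < 8 * j + 8 := by exact_mod_cast hj2
  have h4 := trunc_DD (ε := 1/64) hP hP1 hπ hπ1 hC hm0p hap ha1 S haS Finset.univ (by rw [ha2]; exact h2) j
  have h5 : Real.exp (2*m0) / 2^j ≤ 1/2 := by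
    apply exp_two_pow j (by omega)
    rw [hm0']
    norm_num
    linarith
  have hD0 := DD_nonneg (rr_nonneg hP hπ S) j (Finset.univ : Finset V)
  have h6 : DD (rr P π S) j Finset.univ ≤ 1/8 := by nlinarith
  have h7 : (7/8:ℝ)^k * 2^j ≤ 1/4 := by
    calc (7/8:ℝ)^k * 2^j ≤ (7/8)^(8*j) * 2^j := by
          refine mul_le_mul_of_nonneg_right ?_ (by positivity)
          exact pow_le_pow_of_le_one (by norm_num) (by norm_num) hj3
      _ = ((7/8)^8 * 2)^j := by rw [pow_mul, mul_pow]
      _ ≤ (7/10)^j := pow_le_pow_left₀ (by norm_num) (by norm_num) j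
      _ ≤ (7/10)^4 := pow_le_pow_of_le_one (by norm_num) (by norm_num) (by omega)
      _ ≤ 1/4 := by norm_num
  have h8 := multi_le_of_tail hP hP1 k (2 * tmix P π + S) (fun x0 => by
    have := fl_MR_le hP hP1 hirr hπ hπ1 hr S k j x0 Finset.univ
    linarith) x0
  have h9 : (S:ℝ) ≤ 31 + 28 * (2^14 * (15 * (tcov P / k))) := by
    have e3 : 1/κ2 = 2^14 * ((3*s-1)/k) := by
      rw [hκ2, hκ1]
      have : (3*(s:ℝ)-1) ≠ 0 := by linarith
      field_simp
    have h10 : (3*s-1)/k ≤ 15 * (tcov P / k) := by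
      rw [mul_div_assoc']
      exact div_le_div_of_nonneg_right (by linarith) hk'.le
    have : (S:ℝ) = 3 + 28 * n := by rw [hS]; push_cast; ring
    rw [this]
    rw [e3] at hn2
    set u := (3*(s:ℝ)-1)/k
    set v := tcov P / k
    clear_value u v
    norm_num at hn2 ⊢
    linarith
  push_cast at h8
  have h11 : 0 ≤ tcov P / k := by positivity
  set v := tcov P / k
  clear_value v
  norm_num at h8 h9 ⊢
  linarith

end Assemble


section QF
open MeasureTheory
variable {V : Type*} [Fintype V]

/-- quadratic form `∑ d φ² - ∑∑ c φ φ` -/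
def qf (d : V → ℝ) (c : V → V → ℝ) (φ : V → ℝ) : ℝ :=
  ∑ x, d x * φ x ^ 2 - ∑ x, ∑ y, c x y * φ x * φ y

/-- its linear operator -/
def qm (d : V → ℝ) (c : V → V → ℝ) (φ : V → ℝ) (x : V) : ℝ :=
  d x * φ x - ∑ y, c x y * φ y

lemma qf_eq (d : V → ℝ) (c : V → V → ℝ) (φ : V → ℝ) : qf d c φ = ∑ x, φ x * qm d c φ x := by
  simp only [qf, qm, mul_sub, Finset.sum_sub_distrib, Finset.mul_sum]
  congr 1
  · exact Finset.sum_congr rfl fun x _ => by ring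
  · exact Finset.sum_congr rfl fun x _ => Finset.sum_congr rfl fun y _ => by ring

lemma qm_symm {d : V → ℝ} {c : V → V → ℝ} (hc : ∀ x y, c x y = c y x) (φ ψ : V → ℝ) :
    ∑ x, φ x * qm d c ψ x = ∑ x, ψ x * qm d c φ x := by
  simp only [qm, mul_sub, Finset.sum_sub_distrib, Finset.mul_sum]
  congr 1
  · exact Finset.sum_congr rfl fun x _ => by ring
  · rw [Finset.sum_comm]
    exact Finset.sum_congr rfl fun x _ => Finset.sum_congr rfl fun y _ => by rw [hc x y]; ring

lemma qm_sub (d : V → ℝ) (c : V → V → ℝ) (φ ψ : V → ℝ) (x : V) :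
    qm d c (φ - ψ) x = qm d c φ x - qm d c ψ x := by
  simp only [qm, Pi.sub_apply, mul_sub, Finset.sum_sub_distrib]; ring

lemma qf_sub {d : V → ℝ} {c : V → V → ℝ} (hc : ∀ x y, c x y = c y x) (φ ψ : V → ℝ) :
    qf d c (φ - ψ) = qf d c φ - 2 * ∑ x, φ x * qm d c ψ x + qf d c ψ := by
  simp only [qf_eq, qm_sub, Pi.sub_apply, sub_mul, mul_sub, Finset.sum_sub_distrib]
  rw [qm_symm hc ψ φ]; ring

lemma qf_neg (d : V → ℝ) (c : V → V → ℝ) (φ : V → ℝ) : qf d c (-φ) = qf d c φ := by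
  simp [qf]

lemma qf_ge {d e : V → ℝ} {c : V → V → ℝ} (hc : ∀ x y, c x y = c y x) (hc0 : ∀ x y, 0 ≤ c x y)
    (he : ∀ x, ∑ y, c x y ≤ e x) (φ : V → ℝ) : ∑ x, (d x - e x) * φ x ^ 2 ≤ qf d c φ := by
  have h1 : ∑ x, ∑ y, c x y * φ x * φ y ≤ ∑ x, ∑ y, (c x y * φ x^2 + c x y * φ y^2) / 2 := by
    refine Finset.sum_le_sum fun x _ => Finset.sum_le_sum fun y _ => ?_
    nlinarith [mul_nonneg (hc0 x y) (sq_nonneg (φ x - φ y))]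
  have h2 : ∑ x, ∑ y, (c x y * φ x^2 + c x y * φ y^2) / 2 = ∑ x, (∑ y, c x y) * φ x^2 := by
    simp only [add_div, Finset.sum_add_distrib]
    rw [Finset.sum_comm (f := fun x y => c x y * φ y^2 / 2)]
    rw [← Finset.sum_add_distrib]
    refine Finset.sum_congr rfl fun x _ => ?_
    rw [← Finset.sum_add_distrib, Finset.sum_mul]
    refine Finset.sum_congr rfl fun y _ => ?_
    rw [hc y x]; ring
  have h3 : ∑ x, (∑ y, c x y) * φ x^2 ≤ ∑ x, e x * φ x^2 :=
    Finset.sum_le_sum fun x _ => mul_le_mul_of_nonneg_right (he x) (sq_nonneg _)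
  unfold qf
  simp only [sub_mul, Finset.sum_sub_distrib]
  linarith

lemma shift_pt {d : V → ℝ} {c : V → V → ℝ} (hc : ∀ x y, c x y = c y x) {b v : V → ℝ}
    (hv : ∀ x, qm d c v x = b x) (φ : V → ℝ) :
    -(1/2) * qf d c φ + ∑ x, b x * φ x = 1/2 * ∑ x, b x * v x + -(1/2) * qf d c (φ - v) := by
  have e1 : ∑ x, φ x * qm d c v x = ∑ x, b x * φ x :=
    Finset.sum_congr rfl fun x _ => by rw [hv, mul_comm]
  have e2 : qf d c v = ∑ x, b x * v x := by
    rw [qf_eq]; exact Finset.sum_congr rfl fun x _ => by rw [hv, mul_comm]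
  rw [qf_sub hc, e1, e2]; ring

lemma qf_cont (d : V → ℝ) (c : V → V → ℝ) : Continuous (qf d c) := by
  unfold qf; fun_prop

/-- Gaussian weight -/
noncomputable def gw (d : V → ℝ) (c : V → V → ℝ) (φ : V → ℝ) : ℝ := Real.exp (-(1/2) * qf d c φ)

lemma gw_cont (d : V → ℝ) (c : V → V → ℝ) : Continuous (gw d c) :=
  Real.continuous_exp.comp (continuous_const.mul (qf_cont d c))

lemma gw_pos (d : V → ℝ) (c : V → V → ℝ) (φ : V → ℝ) : 0 < gw d c φ := Real.exp_pos _

lemma gauss1_integrable {ε : ℝ} (hε : 0 < ε) (b : ℝ) :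
    Integrable (fun t : ℝ => Real.exp (-ε * t^2 + b * t)) := by
  have h := (integrable_exp_neg_mul_sq hε).comp_sub_right (b/(2*ε))
  have h2 := h.const_mul (Real.exp (b^2/(4*ε)))
  refine h2.congr (Filter.Eventually.of_forall fun t => ?_)
  dsimp only
  rw [← Real.exp_add]
  congr 1
  field_simp
  ring

lemma gauss_integrable {ε : ℝ} (hε : 0 < ε) (b : V → ℝ) {f : (V → ℝ) → ℝ} (hf : Continuous f)
    (hb : ∀ φ, f φ ≤ -ε * ∑ x, φ x^2 + ∑ x, b x * φ x) :
    Integrable (fun φ : V → ℝ => Real.exp (f φ)) := by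
  have h : Integrable (fun φ : V → ℝ => ∏ x, Real.exp (-ε * φ x^2 + b x * φ x)) :=
    Integrable.fintype_prod (f := fun x t => Real.exp (-ε * t^2 + b x * t))
      (fun x => gauss1_integrable hε (b x))
  refine h.mono' (Real.continuous_exp.comp hf).aestronglyMeasurable
    (Filter.Eventually.of_forall fun φ => ?_)
  rw [Real.norm_eq_abs, abs_of_pos (Real.exp_pos _), ← Real.exp_sum]
  refine Real.exp_le_exp.2 ((hb φ).trans (le_of_eq ?_))
  rw [Finset.sum_add_distrib, Finset.mul_sum]

lemma shift_int {d : V → ℝ} {c : V → V → ℝ} (hc : ∀ x y, c x y = c y x) {b v : V → ℝ}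
    (hv : ∀ x, qm d c v x = b x) :
    ∫ φ : V → ℝ, Real.exp (-(1/2) * qf d c φ + ∑ x, b x * φ x)
      = Real.exp (1/2 * ∑ x, b x * v x) * ∫ φ : V → ℝ, gw d c φ := by
  simp_rw [shift_pt hc hv, Real.exp_add]
  rw [integral_const_mul]
  congr 1
  exact integral_sub_right_eq_self (fun φ => gw d c φ) v

lemma exists_pos_lb {p : V → ℝ} (hp : ∀ x, 0 < p x) : ∃ ε, 0 < ε ∧ ∀ x, ε ≤ p x := by
  rcases isEmpty_or_nonempty V with h | h
  · exact ⟨1, one_pos, fun x => h.elim x⟩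
  · obtain ⟨x0, h0⟩ := Finite.exists_min p
    exact ⟨p x0, hp x0, h0⟩

lemma gwb_integrable {d e : V → ℝ} {c : V → V → ℝ} (hc : ∀ x y, c x y = c y x)
    (hc0 : ∀ x y, 0 ≤ c x y) (he : ∀ x, ∑ y, c x y ≤ e x) (hd : ∀ x, e x < d x) (b : V → ℝ) :
    Integrable (fun φ : V → ℝ => Real.exp (-(1/2) * qf d c φ + ∑ x, b x * φ x)) := by
  obtain ⟨ε, hε, h⟩ := exists_pos_lb (p := fun x => d x - e x) (fun x => sub_pos.2 (hd x))
  refine gauss_integrable (ε := ε/2) (by positivity) b (by have := qf_cont d c; fun_prop)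
    (fun φ => ?_)
  have h1 := qf_ge (d := d) hc hc0 he φ
  have h2 : ε * ∑ x, φ x^2 ≤ ∑ x, (d x - e x) * φ x^2 := by
    rw [Finset.mul_sum]
    exact Finset.sum_le_sum fun x _ => mul_le_mul_of_nonneg_right (h x) (sq_nonneg _)
  linarith

lemma gw_integrable {d e : V → ℝ} {c : V → V → ℝ} (hc : ∀ x y, c x y = c y x)
    (hc0 : ∀ x y, 0 ≤ c x y) (he : ∀ x, ∑ y, c x y ≤ e x) (hd : ∀ x, e x < d x) :
    Integrable (gw d c) := by
  have := gwb_integrable hc hc0 he hd (fun _ => 0)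
  refine this.congr (Filter.Eventually.of_forall fun φ => ?_)
  simp [gw]

lemma gw_integral_pos {d e : V → ℝ} {c : V → V → ℝ} (hc : ∀ x y, c x y = c y x)
    (hc0 : ∀ x y, 0 ≤ c x y) (he : ∀ x, ∑ y, c x y ≤ e x) (hd : ∀ x, e x < d x) :
    0 < ∫ φ : V → ℝ, gw d c φ := by
  rw [integral_pos_iff_support_of_nonneg (fun φ => (gw_pos d c φ).le) (gw_integrable hc hc0 he hd)]
  have : Function.support (gw d c) = Set.univ := by
    ext φ; simp [(gw_pos d c φ).ne']
  rw [this]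
  exact isOpen_univ.measure_pos volume Set.univ_nonempty

/-- geometric series solution -/
lemma geo_fix {K : V → V → ℝ} {g : V → ℝ} (hK : ∀ x y, 0 ≤ K x y) (hK1 : ∀ x, ∑ y, K x y ≤ 1)
    (hg : ∀ x, 0 ≤ g x) (hg1 : ∀ x, g x ≤ 1) {z : ℕ → V → ℝ} (hz0 : ∀ x, z 0 x = g x)
    (hz : ∀ j x, z (j+1) x = ∑ y, K x y * z j y) {q : ℝ} (hq0 : 0 ≤ q) (hq1 : q < 1) :
    (∀ x, Summable fun j => q^j * z j x) ∧
    ∀ x, ∑' j, q^j * z j x = g x + q * ∑ y, K x y * ∑' j, q^j * z j y := by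
  have h01 : ∀ j x, 0 ≤ z j x ∧ z j x ≤ 1 := by
    intro j
    induction j with
    | zero => intro x; rw [hz0]; exact ⟨hg x, hg1 x⟩
    | succ j ih =>
      intro x
      rw [hz]
      refine ⟨Finset.sum_nonneg fun y _ => mul_nonneg (hK x y) (ih y).1, le_trans ?_ (hK1 x)⟩
      exact Finset.sum_le_sum fun y _ => mul_le_of_le_one_right (hK x y) (ih y).2
  have hs : ∀ x, Summable fun j => q^j * z j x := fun x =>
    Summable.of_nonneg_of_le (fun j => mul_nonneg (by positivity) (h01 j x).1)
      (fun j => mul_le_of_le_one_right (by positivity) (h01 j x).2)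
      (summable_geometric_of_lt_one hq0 hq1)
  refine ⟨hs, fun x => ?_⟩
  rw [(hs x).tsum_eq_zero_add]
  simp only [pow_zero, one_mul, hz0]
  congr 1
  have e : ∀ j, q^(j+1) * z (j+1) x = ∑ y, q * K x y * (q^j * z j y) := by
    intro j
    rw [hz, Finset.mul_sum]
    exact Finset.sum_congr rfl fun y _ => by ring
  simp_rw [e]
  rw [Summable.tsum_finsetSum (fun y _ => (hs y).mul_left _), Finset.mul_sum]
  refine Finset.sum_congr rfl fun y _ => ?_
  rw [tsum_mul_left]; ring

end QF


section FK
variable {ι : Type*} [Fintype ι] [DecidableEq ι] {G : Type*} [CommGroup G] [Fintype G]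

lemma char_sum_nonneg (f : G →* ℝ) : 0 ≤ ∑ g, f g := by
  classical
  rw [sum_hom_units]
  split_ifs <;> positivity

lemma char_prod_nonneg (χ : ι → G →* ℝ) {a b : ι → ℝ} (ha : ∀ e, 0 ≤ a e) (hb : ∀ e, 0 ≤ b e)
    (S : Finset ι) : 0 ≤ ∑ g, ∏ e ∈ S, (a e + b e * χ e g) := by
  simp_rw [Finset.prod_add]
  rw [Finset.sum_comm]
  refine Finset.sum_nonneg fun T _ => ?_
  have : ∀ g, (∏ e ∈ T, a e) * ∏ e ∈ S \ T, b e * χ e g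
      = ((∏ e ∈ T, a e) * ∏ e ∈ S \ T, b e) * (∏ e ∈ S \ T, χ e) g := by
    intro g
    rw [Finset.prod_mul_distrib, MonoidHom.finsetProd_apply]; ring
  simp_rw [this]
  rw [← Finset.mul_sum]
  exact mul_nonneg (mul_nonneg (Finset.prod_nonneg fun e _ => ha e)
    (Finset.prod_nonneg fun e _ => hb e)) (char_sum_nonneg _)

lemma char_exp_nonneg (χ : ι → G →* ℝ) (hχ : ∀ e g, χ e g = 1 ∨ χ e g = -1) {J : ι → ℝ}
    (hJ : ∀ e, 0 ≤ J e) (S : Finset ι) :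
    0 ≤ ∑ g, ∏ e ∈ S, (Real.exp (J e * χ e g) - 1) := by
  have h := char_prod_nonneg χ (a := fun e => Real.cosh (J e) - 1) (b := fun e => Real.sinh (J e))
    (fun e => by have := Real.one_le_cosh (J e); linarith)
    (fun e => Real.sinh_nonneg_iff.2 (hJ e)) S
  refine h.trans (le_of_eq (Finset.sum_congr rfl fun g _ => Finset.prod_congr rfl fun e _ => ?_))
  rcases hχ e g with h1 | h1
  · rw [h1, mul_one, mul_one, ← Real.cosh_add_sinh]; ring
  · rw [h1, mul_neg, mul_neg, mul_one, mul_one, ← Real.cosh_sub_sinh]; ring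

lemma sum_powerset_ite (W : Finset ι) (f : Finset ι → ℝ) :
    ∑ S ∈ W.powerset, f S = ∑ S, if S ⊆ W then f S else 0 := by
  rw [← Finset.sum_filter]
  congr 1
  ext S; simp

lemma fk_ineq (χ : ι → G →* ℝ) (hχ : ∀ e g, χ e g = 1 ∨ χ e g = -1) {J : ι → ℝ}
    (hJ : ∀ e, 0 ≤ J e) (conn : Finset ι → Prop) [DecidablePred conn]
    (hmono : ∀ S T, S ⊆ T → conn S → conn T) (H : G → Prop) [DecidablePred H]
    (hH : ∀ ω g, conn ω → (∀ e ∈ ω, χ e g = 1) → H g) :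
    ∑ g, (∑ S, if conn S then ∏ e ∈ S, (Real.exp (J e * χ e g) - 1) else 0)
      ≤ ∑ g, if H g then ∏ e, Real.exp (J e * χ e g) else 0 := by
  set a : Finset ι → ℝ := fun S => ∑ g, ∏ e ∈ S, (Real.exp (J e * χ e g) - 1) with ha
  have ha0 : ∀ S, 0 ≤ a S := fun S => char_exp_nonneg χ hχ hJ S
  have hp0 : ∀ e, 0 ≤ 1 - Real.exp (-J e) := fun e => by
    have : Real.exp (-J e) ≤ 1 := Real.exp_le_one_iff.2 (by linarith [hJ e]); linarith
  have L : ∑ g, (∑ S, if conn S then ∏ e ∈ S, (Real.exp (J e * χ e g) - 1) else 0)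
      = ∑ S, if conn S then a S else 0 := by
    rw [Finset.sum_comm]
    refine Finset.sum_congr rfl fun S _ => ?_
    split_ifs
    · rfl
    · simp
  rw [L]
  -- sprinkle
  let wt : Finset ι → Finset ι → ℝ := fun S ω =>
    (∏ e ∈ ω \ S, (1 - Real.exp (-J e))) * ∏ e ∈ ωᶜ, Real.exp (-J e)
  have hwt0 : ∀ S ω, 0 ≤ wt S ω := fun S ω => mul_nonneg (Finset.prod_nonneg fun e _ => hp0 e)
    (Finset.prod_nonneg fun e _ => (Real.exp_pos _).le)
  have hwt : ∀ S : Finset ι, ∑ ω : Finset ι, (if S ⊆ ω then wt S ω else 0) = 1 := by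
    intro S
    have h1 : ∏ e ∈ Sᶜ, ((1 - Real.exp (-J e)) + Real.exp (-J e)) = 1 := by simp
    rw [Finset.prod_add] at h1
    rw [← h1, ← Finset.sum_filter]
    refine Finset.sum_bij' (fun ω _ => ω \ S) (fun T _ => T ∪ S) ?_ ?_ ?_ ?_ ?_
    · intro ω hω
      simp only [Finset.mem_powerset]
      intro e he
      simp only [Finset.mem_sdiff] at he
      simpa using he.2
    · intro T _; simp
    · intro ω hω
      simp only [Finset.mem_filter, Finset.mem_univ, true_and] at hω
      exact Finset.sdiff_union_of_subset hω
    · intro T hT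
      simp only [Finset.mem_powerset] at hT
      ext e
      simp only [Finset.mem_sdiff, Finset.mem_union]
      constructor
      · rintro ⟨h | h, h2⟩
        · exact h
        · exact absurd h h2
      · intro h
        exact ⟨Or.inl h, by simpa using hT h⟩
    · intro ω hω
      simp only [Finset.mem_filter, Finset.mem_univ, true_and] at hω
      simp only [wt]
      congr 2
      ext e
      simp only [Finset.mem_compl, Finset.mem_sdiff]
      constructor
      · intro h
        exact ⟨fun h2 => h (hω h2), fun h2 => h h2.1⟩
      · rintro ⟨h1, h2⟩ h3
        exact h2 ⟨h3, h1⟩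
  have hin : ∀ (ω : Finset ι) (g : G), ∑ S : Finset ι, (if S ⊆ ω then wt S ω * ∏ e ∈ S, (Real.exp (J e * χ e g) - 1) else 0)
      = (∏ e ∈ ω, (Real.exp (J e * χ e g) - Real.exp (-J e))) * ∏ e ∈ ωᶜ, Real.exp (-J e) := by
    intro ω g
    have : ∀ e, Real.exp (J e * χ e g) - Real.exp (-J e)
      = (Real.exp (J e * χ e g) - 1) + (1 - Real.exp (-J e)) := fun e => by ring
    simp_rw [this]
    rw [Finset.prod_add, sum_powerset_ite, Finset.sum_mul]
    refine Finset.sum_congr rfl fun S _ => ?_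
    split_ifs
    · simp only [wt]; ring
    · simp
  have hpos : ∀ e g, 0 ≤ Real.exp (J e * χ e g) - Real.exp (-J e) := by
    intro e g
    rw [sub_nonneg, Real.exp_le_exp]
    rcases hχ e g with h | h <;> rw [h] <;> linarith [hJ e]
  have hposω : ∀ (ω : Finset ι) g,
      0 ≤ (∏ e ∈ ω, (Real.exp (J e * χ e g) - Real.exp (-J e))) * ∏ e ∈ ωᶜ, Real.exp (-J e) :=
    fun ω g => mul_nonneg (Finset.prod_nonneg fun e _ => hpos e g)
      (Finset.prod_nonneg fun e _ => (Real.exp_pos _).le)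
  calc ∑ S, (if conn S then a S else 0)
      = ∑ S : Finset ι, ∑ ω : Finset ι, (if S ⊆ ω then wt S ω else 0) * (if conn S then a S else 0) := by
        refine Finset.sum_congr rfl fun S _ => ?_
        rw [← Finset.sum_mul, hwt, one_mul]
    _ = ∑ ω : Finset ι, ∑ S : Finset ι, (if S ⊆ ω then wt S ω else 0) * (if conn S then a S else 0) := Finset.sum_comm
    _ ≤ ∑ ω : Finset ι, if conn ω then ∑ S : Finset ι, (if S ⊆ ω then wt S ω * a S else 0) else 0 := by
        refine Finset.sum_le_sum fun ω _ => ?_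
        split_ifs with hω
        · refine Finset.sum_le_sum fun S _ => ?_
          by_cases h1 : S ⊆ ω
          · simp only [h1, if_true]
            refine mul_le_mul_of_nonneg_left ?_ (hwt0 _ _)
            split_ifs
            · exact le_rfl
            · exact ha0 S
          · simp [h1]
        · refine le_of_eq (Finset.sum_eq_zero fun S _ => ?_)
          by_cases h1 : S ⊆ ω
          · rw [if_neg (fun h => hω (hmono S ω h1 h)), mul_zero]
          · simp [h1]
    _ = ∑ ω, if conn ω then ∑ g, (∏ e ∈ ω, (Real.exp (J e * χ e g) - Real.exp (-J e)))
          * ∏ e ∈ ωᶜ, Real.exp (-J e) else 0 := by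
        refine Finset.sum_congr rfl fun ω _ => ?_
        congr 1
        simp_rw [← hin]
        rw [Finset.sum_comm]
        refine Finset.sum_congr rfl fun S _ => ?_
        split_ifs
        · rw [ha, Finset.mul_sum]
        · simp
    _ ≤ ∑ ω, ∑ g, if H g then (∏ e ∈ ω, (Real.exp (J e * χ e g) - Real.exp (-J e)))
          * ∏ e ∈ ωᶜ, Real.exp (-J e) else 0 := by
        refine Finset.sum_le_sum fun ω _ => ?_
        split_ifs with hω
        · refine Finset.sum_le_sum fun g _ => ?_
          split_ifs with hg
          · exact le_rfl
          · have : ∃ e ∈ ω, χ e g ≠ 1 := by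
              by_contra! h
              exact hg (hH ω g hω h)
            obtain ⟨e, he, h1⟩ := this
            have h2 := (hχ e g).resolve_left h1
            rw [Finset.prod_eq_zero he (by rw [h2]; simp), zero_mul]
        · refine Finset.sum_nonneg fun g _ => ?_
          split_ifs
          · exact hposω ω g
          · exact le_rfl
    _ = _ := by
        rw [Finset.sum_comm]
        refine Finset.sum_congr rfl fun g _ => ?_
        split_ifs
        · have : ∏ e, Real.exp (J e * χ e g)
              = ∏ e, ((Real.exp (J e * χ e g) - Real.exp (-J e)) + Real.exp (-J e)) := by simp
          rw [this, Finset.prod_add, Finset.powerset_univ]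
          refine Finset.sum_congr rfl fun ω _ => ?_
          rw [Finset.compl_eq_univ_sdiff]
        · simp

end FK


section EdgeB
open MeasureTheory
variable {V : Type*} [Fintype V] [DecidableEq V]

lemma uz_GM {ι : Type*} [Fintype ι] [DecidableEq ι] {r : ℕ → Finset ι → ℝ} (h0 : ∀ j A, 0 ≤ r j A)
    (h1 : ∀ j A, r j A ≤ 1) (m : ℝ) {q : ℝ} (hq0 : 0 ≤ q) (hq1 : q < 1) (W : Finset ι) :
    uz (fun A => m * ((1 - q) * ∑' j : ℕ, q^j * r j A)) W
      = m * ((1 - q) * ∑' j : ℕ, q^j * uz (r j) W) := by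
  have hs : ∀ A, Summable (fun j : ℕ => q^j * r j A) := fun A =>
    Summable.of_nonneg_of_le (fun j => mul_nonneg (by positivity) (h0 j A))
      (fun j => mul_le_of_le_one_right (by positivity) (h1 j A))
      (summable_geometric_of_lt_one hq0 hq1)
  simp only [uz_eq_sum]
  have e : ∀ A, m * ((1 - q) * ∑' j : ℕ, q^j * r j A) * (if A ⊆ W then 1 else 0)
      = m * ((1-q) * ∑' j : ℕ, q^j * (r j A * (if A ⊆ W then 1 else 0))) := by
    intro A; split_ifs <;> simp
  simp_rw [e]
  rw [← Finset.mul_sum, ← Finset.mul_sum, ← Summable.tsum_finsetSum]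
  · simp_rw [Finset.mul_sum]
  · intro A _
    split_ifs
    · simpa using hs A
    · simpa using summable_zero

/-- restricted conductances -/
def cE (c : V → V → ℝ) (E : Finset (V ⊕ Sym2 V)) (x y : V) : ℝ :=
  if Sum.inr s(x,y) ∈ E then c x y else 0

/-- restricted field -/
def bE (β : V → ℝ) (E : Finset (V ⊕ Sym2 V)) (x : V) : ℝ :=
  if Sum.inl x ∈ E then β x else 0

/-- edge energies -/
noncomputable def JJ (β : V → ℝ) (c : V → V → ℝ) (φ : V → ℝ) : V ⊕ Sym2 V → ℝ
  | Sum.inl x => β x * φ x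
  | Sum.inr s => ∑ p : V × V, if s(p.1, p.2) = s then 1/2 * c p.1 p.2 * φ p.1 * φ p.2 else 0

lemma JJ_sum (β : V → ℝ) (c : V → V → ℝ) (φ : V → ℝ) (E : Finset (V ⊕ Sym2 V)) :
    ∑ e ∈ E, JJ β c φ e = ∑ x, bE β E x * φ x + 1/2 * ∑ x, ∑ y, cE c E x y * φ x * φ y := by
  have h1 : ∑ e ∈ E, JJ β c φ e = ∑ e, if e ∈ E then JJ β c φ e else 0 := by
    rw [← Finset.sum_filter]; congr 1; ext; simp
  rw [h1, Fintype.sum_sum_type]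
  congr 1
  · refine Finset.sum_congr rfl fun x _ => ?_
    simp only [bE, JJ]; split_ifs <;> simp
  · have h2 : ∀ s : Sym2 V, (if Sum.inr s ∈ E then JJ β c φ (Sum.inr s) else 0)
        = ∑ p : V × V, if s(p.1,p.2) = s then
            (if Sum.inr s(p.1,p.2) ∈ E then 1/2 * c p.1 p.2 * φ p.1 * φ p.2 else 0) else 0 := by
      intro s
      simp only [JJ]
      split_ifs with h
      · refine Finset.sum_congr rfl fun p _ => ?_
        split_ifs with h3 h4
        · rfl
        · rw [h3] at h4; exact absurd h h4
        · rfl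
      · symm
        refine Finset.sum_eq_zero fun p _ => ?_
        split_ifs with h3 h4
        · rw [h3] at h4; exact absurd h4 h
        · rfl
        · rfl
    simp_rw [h2]
    rw [Finset.sum_comm, Finset.mul_sum, Fintype.sum_prod_type]
    refine Finset.sum_congr rfl fun x _ => ?_
    rw [Finset.mul_sum]
    refine Finset.sum_congr rfl fun y _ => ?_
    simp only [Finset.sum_ite_eq, Finset.mem_univ, if_true, cE]
    split_ifs <;> ring

lemma JJ_cont (β : V → ℝ) (c : V → V → ℝ) (e : V ⊕ Sym2 V) :
    Continuous (fun φ => JJ β c φ e) := by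
  rcases e with x | s
  · simp only [JJ]; fun_prop
  · simp only [JJ]
    refine continuous_finset_sum _ fun p _ => ?_
    split_ifs <;> fun_prop

/-- diagonal weight -/
noncomputable def dw (d : V → ℝ) (φ : V → ℝ) : ℝ := Real.exp (-(1/2) * ∑ x, d x * φ x^2)

lemma dw_pos (d φ : V → ℝ) : 0 < dw d φ := Real.exp_pos _

lemma exp_JJ (β : V → ℝ) (c : V → V → ℝ) (d φ : V → ℝ) (E : Finset (V ⊕ Sym2 V)) :
    (∏ e ∈ E, Real.exp (JJ β c φ e)) * dw d φ
      = Real.exp (-(1/2) * qf d (cE c E) φ + ∑ x, bE β E x * φ x) := by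
  rw [← Real.exp_sum, dw, ← Real.exp_add, JJ_sum, qf]
  congr 1; ring

/-- sign characters -/
def chz : V ⊕ Sym2 V → ((V → ℤˣ) →* ℤˣ)
  | Sum.inl x => Pi.evalMonoidHom _ x
  | Sum.inr s => Sym2.lift ⟨fun x y => (Pi.evalMonoidHom (fun _ : V => ℤˣ) x) *
      (Pi.evalMonoidHom (fun _ : V => ℤˣ) y), fun x y => mul_comm _ _⟩ s

/-- real characters -/
def chr (e : V ⊕ Sym2 V) : (V → ℤˣ) →* ℝ :=
  ((Int.castRingHom ℝ : ℤ →* ℝ).comp (Units.coeHom ℤ)).comp (chz e)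

lemma chr_inl (x : V) (σ : V → ℤˣ) : chr (Sum.inl x) σ = ((σ x : ℤ) : ℝ) := rfl
lemma chr_inr (x y : V) (σ : V → ℤˣ) :
    chr (Sum.inr s(x,y)) σ = ((σ x : ℤ) : ℝ) * ((σ y : ℤ) : ℝ) := by
  simp [chr, chz]

lemma chr_pm (e : V ⊕ Sym2 V) (σ : V → ℤˣ) : chr e σ = 1 ∨ chr e σ = -1 := by
  have : chr e σ = (((chz e σ : ℤˣ) : ℤ) : ℝ) := rfl
  rw [this]
  rcases Int.units_eq_one_or (chz e σ) with h | h <;> simp [h]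

/-- sign flip -/
def flipS (σ : V → ℤˣ) (φ : V → ℝ) (x : V) : ℝ := ((σ x : ℤ) : ℝ) * φ x

lemma JJ_flip (β : V → ℝ) (c : V → V → ℝ) (φ : V → ℝ) (σ : V → ℤˣ) (e : V ⊕ Sym2 V) :
    JJ β c (flipS σ φ) e = JJ β c φ e * chr e σ := by
  rcases e with x | s
  · simp only [JJ, flipS, chr_inl]; ring
  · simp only [JJ, flipS, Finset.sum_mul]
    refine Finset.sum_congr rfl fun p _ => ?_
    split_ifs with h
    · rw [← h, chr_inr]; ring
    · simp

lemma sgn_sq (u : ℤˣ) : ((u : ℤ) : ℝ)^2 = 1 := by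
  rcases Int.units_eq_one_or u with h | h <;> simp [h]

lemma dw_flip (d φ : V → ℝ) (σ : V → ℤˣ) : dw d (flipS σ φ) = dw d φ := by
  simp only [dw, flipS, mul_pow, sgn_sq, one_mul]

lemma flip_mp (σ : V → ℤˣ) : MeasurePreserving (flipS σ) := by
  refine volume_preserving_pi (fun x => ?_) (f := fun x t => ((σ x : ℤ) : ℝ) * t)
  rcases Int.units_eq_one_or (σ x) with h | h
  · simp only [h, Units.val_one, Int.cast_one, one_mul]
    exact MeasurePreserving.id _
  · simp only [h, Units.val_neg, Units.val_one, Int.cast_neg, Int.cast_one, neg_mul, one_mul]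
    exact Measure.measurePreserving_neg _

lemma flipS_flipS (σ τ : V → ℤˣ) (φ : V → ℝ) : flipS σ (flipS τ φ) = flipS (σ * τ) φ := by
  funext x; simp [flipS]; ring

lemma flip_emb (σ : V → ℤˣ) : MeasurableEmbedding (flipS σ) := by
  have h : ∀ φ, flipS σ⁻¹ (flipS σ φ) = φ := fun φ => by
    rw [flipS_flipS]; funext x; simp [flipS]
  have h' : ∀ φ, flipS σ (flipS σ⁻¹ φ) = φ := fun φ => by
    rw [flipS_flipS]; funext x; simp [flipS]
  exact (MeasurableEquiv.mk ⟨flipS σ, flipS σ⁻¹, h, h'⟩ (flip_mp σ).measurable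
    (flip_mp σ⁻¹).measurable).measurableEmbedding

lemma flip_integral (σ : V → ℤˣ) (F : (V → ℝ) → ℝ) : ∫ φ, F (flipS σ φ) = ∫ φ, F φ :=
  (flip_mp σ).integral_comp (flip_emb σ) F

lemma flip_sum_abs (F : (V → ℝ) → ℝ) (φ : V → ℝ) :
    ∃ ψ : V → ℝ, (∀ x, 0 ≤ ψ x) ∧ ∑ σ, F (flipS σ φ) = ∑ σ, F (flipS σ ψ) := by
  let τ : V → ℤˣ := fun x => if 0 ≤ φ x then 1 else -1
  refine ⟨flipS τ φ, fun x => ?_, ?_⟩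
  · simp only [flipS, τ]
    split_ifs with h
    · simpa using h
    · simp; linarith
  · simp_rw [flipS_flipS]
    exact (Equiv.sum_comp (Equiv.mulRight τ) (fun σ => F (flipS σ φ))).symm

lemma flip_compare {F G : (V → ℝ) → ℝ} (hF : Integrable F) (hG : Integrable G)
    (h : ∀ ψ : V → ℝ, (∀ x, 0 ≤ ψ x) → ∑ σ, F (flipS σ ψ) ≤ ∑ σ, G (flipS σ ψ)) :
    ∫ φ, F φ ≤ ∫ φ, G φ := by
  have key : ∀ {H : (V → ℝ) → ℝ}, Integrable H →
      ∫ φ, ∑ σ, H (flipS σ φ) = (Fintype.card (V → ℤˣ)) * ∫ φ, H φ := by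
    intro H hH
    have hi : ∀ σ, Integrable (fun φ => H (flipS σ φ)) :=
      fun σ => ((flip_mp σ).integrable_comp_emb (flip_emb σ)).2 hH
    rw [integral_finsetSum _ (fun σ _ => hi σ)]
    simp_rw [flip_integral]
    simp
  have hI : ∀ {H : (V → ℝ) → ℝ}, Integrable H → Integrable (fun φ => ∑ σ, H (flipS σ φ)) :=
    fun hH => integrable_finsetSum _ fun σ _ => ((flip_mp σ).integrable_comp_emb (flip_emb σ)).2 hH
  have h1 : ∫ φ, ∑ σ, F (flipS σ φ) ≤ ∫ φ, ∑ σ, G (flipS σ φ) := by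
    refine integral_mono (hI hF) (hI hG) fun φ => ?_
    obtain ⟨ψ, hψ, e⟩ := flip_sum_abs (fun φ => F φ - G φ) φ
    simp only [Finset.sum_sub_distrib] at e
    have := h ψ hψ
    dsimp only
    linarith
  rw [key hF, key hG] at h1
  have hc : (0:ℝ) < Fintype.card (V → ℤˣ) := by exact_mod_cast Fintype.card_pos
  exact le_of_mul_le_mul_left h1 hc

end EdgeB


section PartB
open MeasureTheory
variable {V : Type*} [Fintype V] [DecidableEq V]

lemma cE_symm {c : V → V → ℝ} (hc : ∀ x y, c x y = c y x) (E : Finset (V ⊕ Sym2 V)) (x y : V) :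
    cE c E x y = cE c E y x := by
  simp only [cE, hc x y, Sym2.eq_swap (a := x) (b := y)]

lemma cE_nonneg {c : V → V → ℝ} (hc0 : ∀ x y, 0 ≤ c x y) (E : Finset (V ⊕ Sym2 V)) (x y : V) :
    0 ≤ cE c E x y := by
  simp only [cE]; split_ifs
  · exact hc0 x y
  · exact le_rfl

lemma cE_le {c : V → V → ℝ} (hc0 : ∀ x y, 0 ≤ c x y) (E : Finset (V ⊕ Sym2 V)) (x y : V) :
    cE c E x y ≤ c x y := by
  simp only [cE]; split_ifs
  · exact le_rfl
  · exact hc0 x y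

lemma cE_sum {c : V → V → ℝ} {e : V → ℝ} (hc0 : ∀ x y, 0 ≤ c x y) (he : ∀ x, ∑ y, c x y ≤ e x)
    (E : Finset (V ⊕ Sym2 V)) (x : V) : ∑ y, cE c E x y ≤ e x :=
  (Finset.sum_le_sum fun y _ => cE_le hc0 E x y).trans (he x)

/-- edge expansion weights -/
noncomputable def KK (β : V → ℝ) (c : V → V → ℝ) (d : V → ℝ) (S : Finset (V ⊕ Sym2 V)) : ℝ :=
  ∫ φ : V → ℝ, (∏ e ∈ S, (Real.exp (JJ β c φ e) - 1)) * dw d φ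

lemma KK_int (β : V → ℝ) {c : V → V → ℝ} {d e : V → ℝ} (hc : ∀ x y, c x y = c y x)
    (hc0 : ∀ x y, 0 ≤ c x y) (he : ∀ x, ∑ y, c x y ≤ e x) (hd : ∀ x, e x < d x)
    (S : Finset (V ⊕ Sym2 V)) :
    Integrable (fun φ : V → ℝ => (∏ e ∈ S, (Real.exp (JJ β c φ e) - 1)) * dw d φ) := by
  have h : (fun φ : V → ℝ => (∏ e ∈ S, (Real.exp (JJ β c φ e) - 1)) * dw d φ)
      = fun φ => ∑ T ∈ S.powerset, (∏ e ∈ S \ T, (-1:ℝ)) *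
        Real.exp (-(1/2) * qf d (cE c T) φ + ∑ x, bE β T x * φ x) := by
    funext φ
    simp_rw [← exp_JJ, sub_eq_add_neg]
    rw [Finset.prod_add, Finset.sum_mul]
    exact Finset.sum_congr rfl fun T _ => by ring
  rw [h]
  refine integrable_finsetSum _ fun T _ => Integrable.const_mul ?_ _
  exact gwb_integrable (cE_symm hc T) (cE_nonneg hc0 T) (cE_sum hc0 he T) hd _

lemma uz_KK (β : V → ℝ) {c : V → V → ℝ} {d e : V → ℝ} (hc : ∀ x y, c x y = c y x)
    (hc0 : ∀ x y, 0 ≤ c x y) (he : ∀ x, ∑ y, c x y ≤ e x) (hd : ∀ x, e x < d x)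
    (W : Finset (V ⊕ Sym2 V)) :
    uz (KK β c d) W
      = ∫ φ : V → ℝ, Real.exp (-(1/2) * qf d (cE c W) φ + ∑ x, bE β W x * φ x) := by
  rw [uz, ← sum_powerset_ite]
  unfold KK
  rw [← integral_finsetSum _ (fun S _ => KK_int β hc hc0 he hd S)]
  congr 1; funext φ
  rw [← exp_JJ, ← Finset.sum_mul]
  congr 1
  have := Finset.prod_add (fun e => Real.exp (JJ β c φ e) - 1) (fun _ => (1:ℝ)) W
  simp only [sub_add_cancel, Finset.prod_const_one, mul_one] at this
  exact this.symm

lemma JJ_nonneg {β : V → ℝ} {c : V → V → ℝ} (hβ : ∀ x, 0 ≤ β x) (hc0 : ∀ x y, 0 ≤ c x y)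
    {ψ : V → ℝ} (hψ : ∀ x, 0 ≤ ψ x) (e : V ⊕ Sym2 V) : 0 ≤ JJ β c ψ e := by
  rcases e with x | s
  · exact mul_nonneg (hβ x) (hψ x)
  · refine Finset.sum_nonneg fun p _ => ?_
    split_ifs
    · have := hc0 p.1 p.2; have := hψ p.1; have := hψ p.2; positivity
    · exact le_rfl

lemma KK_nonneg {β : V → ℝ} {c : V → V → ℝ} {d e : V → ℝ} (hβ : ∀ x, 0 ≤ β x)
    (hc : ∀ x y, c x y = c y x)
    (hc0 : ∀ x y, 0 ≤ c x y) (he : ∀ x, ∑ y, c x y ≤ e x) (hd : ∀ x, e x < d x)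
    (S : Finset (V ⊕ Sym2 V)) : 0 ≤ KK β c d S := by
  have := flip_compare (F := fun _ => 0) (integrable_zero _ _ _) (KK_int β hc hc0 he hd S) (by
    intro ψ hψ
    simp only [JJ_flip, dw_flip, Finset.sum_const_zero]
    rw [← Finset.sum_mul]
    exact mul_nonneg (char_exp_nonneg chr chr_pm (JJ_nonneg hβ hc0 hψ) S) (dw_pos _ _).le)
  simpa [KK] using this

/-- every vertex of `B` is joined to the ghost vertex in `S` -/
def conn (B : Finset V) (S : Finset (V ⊕ Sym2 V)) : Prop :=
  ∀ σ : V → ℤˣ, (∀ e ∈ S, chr e σ = 1) → ∀ x ∈ B, σ x = 1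

lemma conn_mono (B : Finset V) (S T : Finset (V ⊕ Sym2 V)) (h : S ⊆ T) (hS : conn B S) :
    conn B T := fun σ hσ => hS σ fun e he => hσ e (h he)

open Classical in
lemma KK_fk {β : V → ℝ} {c : V → V → ℝ} {d e : V → ℝ} (hβ : ∀ x, 0 ≤ β x)
    (hc : ∀ x y, c x y = c y x)
    (hc0 : ∀ x y, 0 ≤ c x y) (he : ∀ x, ∑ y, c x y ≤ e x) (hd : ∀ x, e x < d x) (B : Finset V) :
    ∑ S, KK β c d S * (if conn B S then 1 else 0)
      ≤ ∫ φ : V → ℝ, {φ : V → ℝ | ∀ x ∈ B, 0 ≤ φ x}.indicator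
          (fun φ => Real.exp (-(1/2) * qf d c φ + ∑ x, β x * φ x)) φ := by
  have e1 : ∀ S, KK β c d S * (if conn B S then 1 else 0)
      = ∫ φ : V → ℝ, if conn B S then (∏ e ∈ S, (Real.exp (JJ β c φ e) - 1)) * dw d φ else 0 := by
    intro S; split_ifs <;> simp [KK]
  have hi : ∀ S, Integrable (fun φ : V → ℝ =>
      if conn B S then (∏ e ∈ S, (Real.exp (JJ β c φ e) - 1)) * dw d φ else 0) := by
    intro S; split_ifs
    · exact KK_int β hc hc0 he hd S
    · exact integrable_zero _ _ _
  have hm : MeasurableSet {φ : V → ℝ | ∀ x ∈ B, 0 ≤ φ x} := by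
    have : {φ : V → ℝ | ∀ x ∈ B, 0 ≤ φ x} = ⋂ x ∈ B, {φ | 0 ≤ φ x} := by ext; simp
    rw [this]
    exact Finset.measurableSet_biInter _ fun x _ => measurableSet_le measurable_const (measurable_pi_apply x)
  simp_rw [e1]
  rw [← integral_finsetSum _ (fun S _ => hi S)]
  refine flip_compare (integrable_finsetSum _ fun S _ => hi S)
    ((gwb_integrable hc hc0 he hd β).indicator hm) fun ψ hψ => ?_
  have h := fk_ineq chr chr_pm (JJ_nonneg hβ hc0 hψ) (conn B) (conn_mono B)
    (fun σ => ∀ x ∈ B, σ x = 1) (fun ω g h1 h2 => h1 g h2)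
  have h2 := mul_le_mul_of_nonneg_right h (dw_pos d ψ).le
  refine le_trans (le_of_eq ?_) (h2.trans ?_)
  · rw [Finset.sum_mul]
    refine Finset.sum_congr rfl fun σ _ => ?_
    rw [Finset.sum_mul]
    refine Finset.sum_congr rfl fun S _ => ?_
    split_ifs
    · simp only [JJ_flip, dw_flip]
    · simp
  · rw [Finset.sum_mul]
    refine Finset.sum_le_sum fun σ _ => ?_
    have hE := exp_JJ β c d (flipS σ ψ) Finset.univ
    have hcu : cE c Finset.univ = c := by funext x y; simp [cE]
    have hbu : bE β Finset.univ = β := by funext x; simp [bE]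
    rw [hcu, hbu] at hE
    simp only [Set.indicator, Set.mem_setOf_eq]
    rw [← hE]
    simp only [JJ_flip, dw_flip]
    by_cases hs : ∀ x ∈ B, σ x = 1
    · have : ∀ x ∈ B, 0 ≤ flipS σ ψ x := fun x hx => by simp [flipS, hs x hx, hψ x]
      rw [if_pos hs, if_pos this]
    · rw [if_neg hs, zero_mul]
      split_ifs
      · exact mul_nonneg (Finset.prod_nonneg fun e _ => (Real.exp_pos _).le) (dw_pos _ _).le
      · exact le_rfl

/-- law of the edges of the path -/
noncomputable def sE (P : V → V → ℝ) : ℕ → V → Finset (V ⊕ Sym2 V) → ℝ :=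
  sig (fun x => {Sum.inl x}) (fun x y => {Sum.inr s(x,y)}) P

/-- law of the edges of the closed path -/
noncomputable def eE (P : V → V → ℝ) (π : V → ℝ) (j : ℕ) (A : Finset (V ⊕ Sym2 V)) : ℝ :=
  ∑ x, π x * cv (fun A => if A = {Sum.inl x} then 1 else 0) (sE P j x) A

lemma uz_eE (P : V → V → ℝ) (π : V → ℝ) (j : ℕ) (W : Finset (V ⊕ Sym2 V)) :
    uz (eE P π j) W = ∑ x, π x * ((if Sum.inl x ∈ W then 1 else 0) * uz (sE P j x) W) := by
  have h : ∀ x : V, uz (fun A : Finset (V ⊕ Sym2 V) => if A = {Sum.inl x} then (1:ℝ) else 0) W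
      = if Sum.inl x ∈ W then 1 else 0 := by
    intro x
    rw [uz_eq_sum]
    simp only [ite_mul, one_mul, zero_mul, Finset.sum_ite_eq', Finset.mem_univ, if_true,
      Finset.singleton_subset_iff]
  simp_rw [← h, ← uz_cv]
  simp only [uz_eq_sum, eE, Finset.sum_mul, Finset.mul_sum]
  rw [Finset.sum_comm]
  exact Finset.sum_congr rfl fun x _ => Finset.sum_congr rfl fun A _ => by ring

lemma uz_univ {ι : Type*} [Fintype ι] [DecidableEq ι] (f : Finset ι → ℝ) :
    uz f Finset.univ = ∑ S, f S := by simp [uz]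

section
variable {P : V → V → ℝ} {π : V → ℝ} (hP : ∀ x y, 0 ≤ P x y) (hP1 : ∀ x, ∑ y, P x y = 1)
  (hπ : ∀ x, 0 < π x) (hπ1 : ∑ x, π x = 1)
include hP hπ

lemma eE_nonneg (j : ℕ) (A : Finset (V ⊕ Sym2 V)) : 0 ≤ eE P π j A := by
  refine Finset.sum_nonneg fun x _ => mul_nonneg (hπ x).le (cv_nonneg ?_ ?_ _)
  · intro S; split_ifs <;> norm_num
  · exact sig_nonneg _ _ P hP j x

include hP1 hπ1
lemma eE_sum (j : ℕ) : ∑ A, eE P π j A = 1 := by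
  rw [← uz_univ, uz_eE]
  have : ∀ x, uz (sE P j x) Finset.univ = 1 := fun x => by
    rw [uz_univ]; exact sig_sum _ _ P hP1 j x
  simp [this, hπ1]

lemma eE_le (j : ℕ) (A : Finset (V ⊕ Sym2 V)) : eE P π j A ≤ 1 := by
  rw [← eE_sum hP hP1 hπ hπ1 j]
  exact Finset.single_le_sum (fun A _ => eE_nonneg hP hπ j A) (Finset.mem_univ A)
end

/-- edge intensity -/
noncomputable def nE (P : V → V → ℝ) (π : V → ℝ) (m q : ℝ) (A : Finset (V ⊕ Sym2 V)) : ℝ :=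
  m * ((1 - q) * ∑' j : ℕ, q^j * eE P π j A)

/-- vertices of an edge -/
def Ve : V ⊕ Sym2 V → Finset V
  | Sum.inl x => {x}
  | Sum.inr s => s.toFinset

/-- vertices of an edge set -/
def VV (S : Finset (V ⊕ Sym2 V)) : Finset V := S.biUnion Ve

lemma VV_union (S T : Finset (V ⊕ Sym2 V)) : VV (S ∪ T) = VV S ∪ VV T := Finset.union_biUnion

lemma sE_good (P : V → V → ℝ) (j : ℕ) : ∀ x A, sE P j x A ≠ 0 → ∀ σ : V → ℤˣ,
    (∀ e ∈ A, chr e σ = 1) → σ x = 1 ∧ ∀ y ∈ VV A, σ y = 1 := by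
  have one : ∀ u : ℤˣ, ((u : ℤ) : ℝ) = 1 → u = 1 := by
    intro u hu; ext; rw [Units.val_one]; exact Int.cast_eq_one.1 hu
  induction j with
  | zero =>
    intro x A h σ hσ
    simp only [sE, sig] at h
    have hA : {Sum.inl x} = A := by by_contra h'; simp [h'] at h
    subst hA
    have : σ x = 1 := one _ (by rw [← chr_inl]; exact hσ _ (by simp))
    exact ⟨this, by simp [VV, Ve, this]⟩
  | succ j ih =>
    intro x A h σ hσ
    simp only [sE, sig] at h
    obtain ⟨y, _, h1⟩ := Finset.exists_ne_zero_of_sum_ne_zero h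
    obtain ⟨A', _, h2⟩ := Finset.exists_ne_zero_of_sum_ne_zero (right_ne_zero_of_mul h1)
    have hA : {Sum.inr s(x,y)} ∪ A' = A := by
      by_contra h'; exact h2 (if_neg h')
    rw [if_pos hA] at h2
    subst hA
    obtain ⟨i1, i2⟩ := ih y A' h2 σ fun e he => hσ e (by simp [he])
    have h3 : chr (Sum.inr s(x,y)) σ = 1 := hσ _ (by simp)
    rw [chr_inr, i1] at h3
    have hx : σ x = 1 := one _ (by simpa using h3)
    refine ⟨hx, fun z hz => ?_⟩
    rw [VV_union, Finset.mem_union] at hz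
    rcases hz with hz | hz
    · simp only [VV, Finset.singleton_biUnion, Ve, Sym2.mem_toFinset, Sym2.mem_iff] at hz
      rcases hz with rfl | rfl
      · exact hx
      · exact i1
    · exact i2 z hz

lemma nE_good (P : V → V → ℝ) (π : V → ℝ) (m q : ℝ) (A : Finset (V ⊕ Sym2 V))
    (h : nE P π m q A ≠ 0) : conn (VV A) A := by
  have h1 : ∃ j, eE P π j A ≠ 0 := by
    by_contra! h'
    simp [nE, h'] at h
  obtain ⟨j, hj⟩ := h1
  obtain ⟨x, _, h2⟩ := Finset.exists_ne_zero_of_sum_ne_zero hj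
  obtain ⟨T, _, h3⟩ := Finset.exists_ne_zero_of_sum_ne_zero (right_ne_zero_of_mul h2)
  obtain ⟨A', _, h4⟩ := Finset.exists_ne_zero_of_sum_ne_zero h3
  have hA : T ∪ A' = A := by by_contra h'; simp [h'] at h4
  rw [if_pos hA] at h4
  have hT : T = {Sum.inl x} := by
    by_contra h'; simp [h'] at h4
  subst hA
  subst hT
  intro σ hσ y hy
  obtain ⟨i1, i2⟩ := sE_good P j x A' (right_ne_zero_of_mul h4) σ fun e he => hσ e (by simp [he])
  rw [VV_union, Finset.mem_union] at hy
  rcases hy with hy | hy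
  · simp [VV, Ve] at hy
    rw [hy]; exact i1
  · exact i2 y hy

/-- edges inside W -/
def EW (W : Finset V) : Finset (V ⊕ Sym2 V) := Finset.univ.filter fun e => Ve e ⊆ W

lemma VV_sub (S : Finset (V ⊕ Sym2 V)) (W : Finset V) : VV S ⊆ W ↔ S ⊆ EW W := by
  rw [VV, Finset.biUnion_subset]
  simp only [EW, Finset.subset_iff (s₁ := S), Finset.mem_filter, Finset.mem_univ, true_and]

lemma uz_sE_R (P : V → V → ℝ) (W : Finset V) (j : ℕ) : ∀ x,
    (if Sum.inl x ∈ EW W then 1 else 0) * uz (sE P j x) (EW W) = uz (R P j x) W := by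
  have hx : ∀ x, (Sum.inl x ∈ EW W) = (x ∈ W) := fun x => by
    simp only [EW, Finset.mem_filter, Finset.mem_univ, true_and]
    simp only [Ve, Finset.singleton_subset_iff]
  have hxy : ∀ x y, (Sum.inr s(x,y) ∈ EW W) = (x ∈ W ∧ y ∈ W) := fun x y => by
    simp only [EW, Finset.mem_filter, Finset.mem_univ, true_and]
    simp [Ve, Finset.subset_iff]
  induction j with
  | zero =>
    intro x
    rw [sE, R, osig, uz_sig_zero, uz_sig_zero]
    simp only [Finset.singleton_subset_iff, hx]
    split_ifs <;> simp
  | succ j ih =>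
    intro x
    rw [R, osig, uz_sig_succ]
    rw [sE, uz_sig_succ, ← sE]
    have ih' : ∀ y, uz (sig (fun x => {x}) (fun x _ => {x}) P j y) W = _ := fun y => (ih y).symm
    simp_rw [ih']
    simp only [Finset.singleton_subset_iff, hx, hxy, Finset.mul_sum]
    refine Finset.sum_congr rfl fun y _ => ?_
    by_cases h1 : x ∈ W <;> by_cases h2 : y ∈ W <;> simp [h1, h2]

end PartB


section PartB2
open MeasureTheory
variable {V : Type*} [Fintype V] [DecidableEq V] {P : V → V → ℝ} {π : V → ℝ}

lemma tsum_pi_swap (a : V → ℝ) {z : ℕ → V → ℝ} {q : ℝ} (hs : ∀ x, Summable fun j : ℕ => q^j * z j x) :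
    ∑ x, a x * ∑' j : ℕ, q^j * z j x = ∑' j : ℕ, q^j * ∑ x, a x * z j x := by
  simp_rw [← tsum_mul_left]
  rw [← Summable.tsum_finsetSum (fun x _ => (hs x).mul_left _)]
  refine tsum_congr fun j => ?_
  rw [Finset.mul_sum]
  exact Finset.sum_congr rfl fun x _ => by ring

lemma nE_sum (hP : ∀ x y, 0 ≤ P x y) (hP1 : ∀ x, ∑ y, P x y = 1) (hπ : ∀ x, 0 < π x)
    (hπ1 : ∑ x, π x = 1) {m q : ℝ} (hq0 : 0 ≤ q) (hq1 : q < 1) :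
    ∑ A, nE P π m q A = m := by
  rw [← uz_univ]
  unfold nE
  rw [uz_GM (eE_nonneg hP hπ) (eE_le hP hP1 hπ hπ1) m hq0 hq1]
  simp_rw [uz_univ, eE_sum hP hP1 hπ hπ1, mul_one]
  rw [tsum_geometric_of_lt_one hq0 hq1, mul_inv_cancel₀ (by linarith), mul_one]

lemma uz_nE_GG (hP : ∀ x y, 0 ≤ P x y) (hP1 : ∀ x, ∑ y, P x y = 1) (hπ : ∀ x, 0 < π x)
    (hπ1 : ∑ x, π x = 1) {m q : ℝ} (hq0 : 0 ≤ q) (hq1 : q < 1) (W : Finset V) :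
    uz (nE P π m q) (EW W) = uz (GG P π m q) W := by
  unfold nE GG
  rw [uz_GM (eE_nonneg hP hπ) (eE_le hP hP1 hπ hπ1) m hq0 hq1,
    uz_GM (rr_nonneg hP hπ) (rr_le_one hP hP1 hπ hπ1) m hq0 hq1]
  congr 2
  refine tsum_congr fun j => ?_
  congr 1
  rw [uz_eE]
  simp_rw [uz_sE_R]
  simp only [uz_eq_sum, rr, Finset.sum_mul, Finset.mul_sum]
  rw [Finset.sum_comm]
  exact Finset.sum_congr rfl fun x _ => Finset.sum_congr rfl fun A _ => by ring

lemma nE_nonneg (hP : ∀ x y, 0 ≤ P x y) (hπ : ∀ x, 0 < π x)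
    {m q : ℝ} (hm : 0 ≤ m) (hq0 : 0 ≤ q) (hq1 : q < 1) (A : Finset (V ⊕ Sym2 V)) :
    0 ≤ nE P π m q A :=
  mul_nonneg hm (mul_nonneg (by linarith) (tsum_nonneg fun j =>
    mul_nonneg (by positivity) (eE_nonneg hP hπ j A)))

lemma pois_push (hP : ∀ x y, 0 ≤ P x y) (hP1 : ∀ x, ∑ y, P x y = 1) (hπ : ∀ x, 0 < π x)
    (hπ1 : ∑ x, π x = 1) {m q : ℝ} (hm : 0 ≤ m) (hq0 : 0 ≤ q) (hq1 : q < 1) (Φ : Finset V → ℝ) :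
    ∑ S, pois (nE P π m q) S * Φ (VV S) = ∑ T, pois (GG P π m q) T * Φ T := by
  have h : pois (GG P π m q) = fun T => ∑ S, if VV S = T then pois (nE P π m q) S else 0 := by
    refine uz_inj fun W => ?_
    rw [uz_pois' (GG_nonneg hP hπ hm hq0 hq1), GG_sum hP hP1 hπ hπ1 hq0 hq1,
      ← uz_nE_GG hP hP1 hπ hπ1 hq0 hq1]
    have h2 := uz_pois' (nE_nonneg hP hπ hm hq0 hq1) (EW W)
    rw [nE_sum hP hP1 hπ hπ1 hq0 hq1] at h2
    rw [← h2]
    rw [uz_eq_sum, uz_eq_sum]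
    simp_rw [Finset.sum_mul]
    rw [Finset.sum_comm]
    refine Finset.sum_congr rfl fun S _ => ?_
    simp only [ite_mul, zero_mul, Finset.sum_ite_eq, Finset.mem_univ, if_true, VV_sub]
  rw [h]
  simp_rw [Finset.sum_mul]
  rw [Finset.sum_comm]
  refine Finset.sum_congr rfl fun S _ => ?_
  simp only [ite_mul, zero_mul, Finset.sum_ite_eq, Finset.mem_univ, if_true]

lemma shiftE (hP : ∀ x y, 0 ≤ P x y) (hP1 : ∀ x, ∑ y, P x y = 1) (hπ : ∀ x, 0 < π x)
    (hπ1 : ∑ x, π x = 1) (hr : ∀ x y, π x * P x y = π y * P y x) {κ h m : ℝ} (hκ : 0 < κ)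
    (hm : h^2 * κ = 2 * m) (W : Finset (V ⊕ Sym2 V)) :
    uz (KK (fun x => h * κ * π x) (fun x y => π x * P x y) (fun x => (1+κ) * π x)) W
      = Real.exp (uz (nE P π m (1/(1+κ))) W) *
        uz (KK (fun x => 0) (fun x y => π x * P x y) (fun x => (1+κ) * π x)) W := by
  set q := 1/(1+κ) with hq
  have hq0 : 0 ≤ q := by positivity
  have hq1 : q < 1 := by rw [hq, div_lt_one (by linarith)]; linarith
  have hqk : q * (1+κ) = 1 := by rw [hq]; field_simp
  set c : V → V → ℝ := fun x y => π x * P x y with hc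
  set d : V → ℝ := fun x => (1+κ) * π x with hd
  have hc0 : ∀ x y, 0 ≤ c x y := fun x y => mul_nonneg (hπ x).le (hP x y)
  have he : ∀ x, ∑ y, c x y ≤ π x := fun x => by
    simp only [hc]; rw [← Finset.mul_sum, hP1, mul_one]
  have hdl : ∀ x, π x < d x := fun x => by
    simp only [hd]; nlinarith [hπ x]
  rw [uz_KK _ hr hc0 he hdl, uz_KK _ hr hc0 he hdl]
  have hb0 : ∀ φ : V → ℝ, ∑ x, bE (fun _ : V => (0:ℝ)) W x * φ x = 0 := fun φ => by simp [bE]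
  simp_rw [hb0, add_zero]
  set g : V → ℝ := fun x => if Sum.inl x ∈ W then 1 else 0 with hg
  set K : V → V → ℝ := fun x y => P x y * (if Sum.inr s(x,y) ∈ W then 1 else 0) with hK
  have hK0 : ∀ x y, 0 ≤ K x y := fun x y => by
    simp only [hK]; split_ifs <;> simp [hP]
  have hK1 : ∀ x, ∑ y, K x y ≤ 1 := fun x => by
    rw [← hP1 x]
    refine Finset.sum_le_sum fun y _ => ?_
    simp only [hK]; split_ifs <;> simp [hP]
  obtain ⟨hs, hfix⟩ := geo_fix (K := K) (g := g) hK0 hK1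
    (fun x => by simp only [hg]; split_ifs <;> norm_num)
    (fun x => by simp only [hg]; split_ifs <;> norm_num)
    (z := fun j x => uz (sE P j x) W)
    (fun x => by simp only [sE, uz_sig_zero, Finset.singleton_subset_iff, hg])
    (fun j x => by
      simp only [sE, uz_sig_succ, Finset.singleton_subset_iff, hK]
      exact Finset.sum_congr rfl fun y _ => by ring) hq0 hq1
  set Z : V → ℝ := fun x => ∑' j, q^j * uz (sE P j x) W with hZ
  have hfix' : ∀ x, Z x = g x + q * ∑ y, K x y * Z y := hfix
  rw [shift_int (v := fun x => h * κ * q * Z x) (cE_symm hr W)]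
  · congr 1
    · congr 1
      unfold nE
      rw [uz_GM (eE_nonneg hP hπ) (eE_le hP hP1 hπ hπ1) m hq0 hq1]
      simp_rw [uz_eE, ← mul_assoc (π _)]
      rw [← tsum_pi_swap (fun x => π x * (if Sum.inl x ∈ W then 1 else 0)) hs]
      have e1 : ∀ x, bE (fun x => h*κ*π x) W x * (h*κ*q*Z x)
          = (2 * m * (1 - q)) * (π x * (if Sum.inl x ∈ W then 1 else 0) * Z x) := by
        intro x
        have : 1 - q = κ * q := by linarith
        rw [this, ← hm]
        simp only [bE]; split_ifs <;> ring
      simp_rw [e1]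
      rw [← Finset.mul_sum]
      ring
  · intro x
    simp only [qm, hd, cE, bE, hc]
    have e2 : ∑ y, (if Sum.inr s(x,y) ∈ W then π x * P x y else 0) * (h*κ*q*Z y)
        = π x * (h*κ) * (q * ∑ y, K x y * Z y) := by
      rw [Finset.mul_sum, Finset.mul_sum]
      refine Finset.sum_congr rfl fun y _ => ?_
      simp only [hK]; split_ifs <;> ring
    rw [e2]
    have e3 : q * ∑ y, K x y * Z y = Z x - g x := by rw [hfix' x]; ring
    rw [e3]
    have e4 : (1+κ)*π x*(h*κ*q*Z x) = (q * (1+κ)) * (π x * (h*κ) * Z x) := by ring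
    rw [e4, hqk]
    simp only [hg]; split_ifs <;> ring

open Classical in
lemma partB (hP : ∀ x y, 0 ≤ P x y) (hP1 : ∀ x, ∑ y, P x y = 1) (hπ : ∀ x, 0 < π x)
    (hπ1 : ∑ x, π x = 1) (hr : ∀ x y, π x * P x y = π y * P y x) {κ h m : ℝ} (hκ : 0 < κ)
    (hh : 0 ≤ h) (hm : h^2 * κ = 2 * m) (B : Finset V) :
    (1 - FF (GG P π m (1/(1+κ))) B) * ∫ φ : V → ℝ, gw (fun x => (1+κ) * π x) (fun x y => π x * P x y) φ
      ≤ ∫ φ : V → ℝ, {φ : V → ℝ | ∀ x ∈ B, -h ≤ φ x}.indicator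
          (gw (fun x => (1+κ) * π x) (fun x y => π x * P x y)) φ := by
  have hS := shiftE hP hP1 hπ hπ1 hr hκ hm
  set q := 1/(1+κ) with hq
  have hq0 : 0 ≤ q := by positivity
  have hq1 : q < 1 := by rw [hq, div_lt_one (by linarith)]; linarith
  have hm0 : 0 ≤ m := by nlinarith [mul_nonneg (sq_nonneg h) hκ.le]
  set c : V → V → ℝ := fun x y => π x * P x y with hc
  set d : V → ℝ := fun x => (1+κ) * π x with hd
  have hc0 : ∀ x y, 0 ≤ c x y := fun x y => mul_nonneg (hπ x).le (hP x y)
  have hcsy : ∀ x y, c x y = c y x := hr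
  have hcs : ∀ x, ∑ y, c x y = π x := fun x => by
    simp only [hc]; rw [← Finset.mul_sum, hP1, mul_one]
  have he : ∀ x, ∑ y, c x y ≤ π x := fun x => (hcs x).le
  have hdl : ∀ x, π x < d x := fun x => by
    simp only [hd]; nlinarith [hπ x]
  have hβ0 : ∀ x, 0 ≤ h * κ * π x := fun x => by have := (hπ x).le; positivity
  set K0 := KK (fun _ => 0) c d with hK0
  set K1 := KK (fun x => h*κ*π x) c d with hK1
  have hn0 := nE_nonneg hP hπ hm0 hq0 hq1
  have hK00 : ∀ S, 0 ≤ K0 S := fun S => KK_nonneg (fun _ => le_rfl) hcsy hc0 he hdl S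
  have hcv := conv_sum (f := fun S => Real.exp (-m) * K1 S) (g := pois (nE P π m q)) (k := K0)
    (fun W => by
      have : uz (fun S => Real.exp (-m) * K1 S) W = Real.exp (-m) * uz K1 W := by
        simp only [uz_eq_sum, Finset.mul_sum, mul_assoc]
      rw [this, hS W, uz_pois' hn0, nE_sum hP hP1 hπ hπ1 hq0 hq1, ← mul_assoc, ← Real.exp_add]
      congr 2; ring) (fun S => if conn B S then 1 else 0)
  have hK0s : ∑ S, K0 S = ∫ φ : V → ℝ, gw d c φ := by
    rw [← uz_univ, hK0, uz_KK _ hcsy hc0 he hdl]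
    congr 1; funext φ
    have hcu : cE c Finset.univ = c := by funext x y; simp [cE]
    simp [hcu, bE, gw]
  have low : (1 - FF (GG P π m q) B) * ∑ S, K0 S
      ≤ ∑ T, ∑ T', pois (nE P π m q) T * K0 T' * (if conn B (T ∪ T') then 1 else 0) := by
    have e1 : 1 - FF (GG P π m q) B = ∑ T, pois (nE P π m q) T * (if B ⊆ VV T then 1 else 0) := by
      rw [pois_push hP hP1 hπ hπ1 hm0 hq0 hq1 (fun T => if B ⊆ T then (1:ℝ) else 0),
        FF, fl, sub_eq_iff_eq_add, ← Finset.sum_add_distrib]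
      refine (pois_sum (GG_nonneg hP hπ hm0 hq0 hq1)).symm.trans ?_
      refine Finset.sum_congr rfl fun T _ => ?_
      split_ifs <;> ring
    rw [e1, Finset.sum_mul_sum]
    refine Finset.sum_le_sum fun T _ => Finset.sum_le_sum fun T' _ => ?_
    rw [mul_right_comm]
    by_cases hT : pois (nE P π m q) T = 0
    · simp [hT]
    have hg := pois_good hn0 (fun S => conn (VV S) S) (by intro σ _ x hx; simp [VV] at hx)
      (by
        intro S T hS hT σ hσ x hx
        rw [VV_union, Finset.mem_union] at hx
        rcases hx with hx | hx
        · exact hS σ (fun e he => hσ e (by simp [he])) x hx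
        · exact hT σ (fun e he => hσ e (by simp [he])) x hx) (nE_good P π m q) T hT
    refine mul_le_mul_of_nonneg_left ?_ (mul_nonneg (pois_nonneg _ _) (hK00 _))
    by_cases hB : B ⊆ VV T
    · have : conn B (T ∪ T') := fun σ hσ x hx =>
        hg σ (fun e he => hσ e (by simp [he])) x (hB hx)
      rw [if_pos this]; split_ifs <;> norm_num
    · rw [if_neg hB]; split_ifs <;> norm_num
  rw [hK0s, ← hcv] at low
  refine low.trans ?_
  have hfk := mul_le_mul_of_nonneg_left (KK_fk hβ0 hcsy hc0 he hdl B) (Real.exp_pos (-m)).le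
  rw [Finset.mul_sum] at hfk
  simp_rw [mul_assoc]
  refine hfk.trans (le_of_eq ?_)
  rw [← integral_const_mul]
  rw [← integral_sub_right_eq_self (fun φ => {φ : V → ℝ | ∀ x ∈ B, -h ≤ φ x}.indicator (gw d c) φ)
    (fun _ => h)]
  congr 1; funext φ
  have hv : ∀ x, qm d c (fun _ => h) x = h*κ*π x := fun x => by
    simp only [qm]; rw [← Finset.sum_mul, hcs]; simp only [hd]; ring
  have e5 : 1/2 * ∑ x, h*κ*π x * h = m := by
    have : ∀ x, h*κ*π x*h = 2 * m * π x := fun x => by rw [← hm]; ring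
    simp_rw [this]; rw [← Finset.mul_sum, hπ1]; ring
  have e7 := shift_pt hcsy hv φ
  rw [e5] at e7
  simp only [Set.indicator, Set.mem_setOf_eq, Pi.sub_apply, gw]
  have e6 : (∀ x ∈ B, -h ≤ φ x - h) ↔ ∀ x ∈ B, 0 ≤ φ x := by
    refine forall₂_congr fun x _ => ?_
    constructor <;> intro _ <;> linarith
  simp only [e6, e7]
  split_ifs
  · rw [← Real.exp_add]; congr 1; ring
  · simp

end PartB2


section PartC
open MeasureTheory
open scoped ENNReal
variable {V : Type*} [Fintype V]

/-- Gaussian measure (unnormalised) -/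
noncomputable def mg (d : V → ℝ) (c : V → V → ℝ) : Measure (V → ℝ) :=
  volume.withDensity fun φ => ENNReal.ofReal (gw d c φ)

lemma gw_ofReal_meas (d : V → ℝ) (c : V → V → ℝ) :
    Measurable fun φ => ENNReal.ofReal (gw d c φ) :=
  (gw_cont d c).measurable.ennreal_ofReal

lemma mg_lintegral (d : V → ℝ) (c : V → V → ℝ) {f : (V → ℝ) → ℝ≥0∞} (hf : Measurable f) :
    ∫⁻ φ, f φ ∂(mg d c) = ∫⁻ φ, f φ * ENNReal.ofReal (gw d c φ) := by
  rw [mg, lintegral_withDensity_eq_lintegral_mul _ (gw_ofReal_meas d c) hf]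
  exact lintegral_congr fun φ => by simp [mul_comm]

lemma mg_apply (d : V → ℝ) (c : V → V → ℝ) {S : Set (V → ℝ)} (hS : MeasurableSet S) :
    mg d c S = ∫⁻ φ, S.indicator 1 φ * ENNReal.ofReal (gw d c φ) := by
  rw [← mg_lintegral d c (measurable_one.indicator hS), lintegral_indicator_one hS]

lemma mg_finite {d e : V → ℝ} {c : V → V → ℝ} (hc : ∀ x y, c x y = c y x)
    (hc0 : ∀ x y, 0 ≤ c x y) (he : ∀ x, ∑ y, c x y ≤ e x) (hd : ∀ x, e x < d x) :
    IsFiniteMeasure (mg d c) :=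
  isFiniteMeasure_withDensity_ofReal (gw_integrable hc hc0 he hd).2

lemma mg_ne_zero (d : V → ℝ) (c : V → V → ℝ) : mg d c Set.univ ≠ 0 := by
  intro h
  rw [Measure.measure_univ_eq_zero, mg, withDensity_eq_zero_iff (gw_ofReal_meas d c).aemeasurable] at h
  have h2 : ∀ᵐ φ : V → ℝ, False := by
    filter_upwards [h] with φ hφ
    simp only [Pi.zero_apply, ENNReal.ofReal_eq_zero] at hφ
    exact absurd (gw_pos d c φ) (not_lt.2 hφ)
  rw [Filter.eventually_false_iff_eq_bot, ae_eq_bot] at h2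
  have h3 : (volume : Measure (V → ℝ)) Set.univ ≠ 0 :=
    (isOpen_univ.measure_pos volume Set.univ_nonempty).ne'
  rw [h2] at h3; simp at h3

lemma mg_real {d e : V → ℝ} {c : V → V → ℝ} (hc : ∀ x y, c x y = c y x)
    (hc0 : ∀ x y, 0 ≤ c x y) (he : ∀ x, ∑ y, c x y ≤ e x) (hd : ∀ x, e x < d x)
    {S : Set (V → ℝ)} (hS : MeasurableSet S) :
    ∫ φ, S.indicator (gw d c) φ = (mg d c).real S := by
  rw [integral_indicator hS, Measure.real, mg, withDensity_apply _ hS,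
    integral_eq_lintegral_of_nonneg_ae (Filter.Eventually.of_forall fun φ => (gw_pos d c φ).le)
      (gw_cont d c).aestronglyMeasurable]

lemma qm_surj {d e : V → ℝ} {c : V → V → ℝ} (hc : ∀ x y, c x y = c y x)
    (hc0 : ∀ x y, 0 ≤ c x y) (he : ∀ x, ∑ y, c x y ≤ e x) (hd : ∀ x, e x < d x) (b : V → ℝ) :
    ∃ v, ∀ x, qm d c v x = b x := by
  let L : (V → ℝ) →ₗ[ℝ] (V → ℝ) :=
    { toFun := fun v x => qm d c v x
      map_add' := fun u v => by
        funext x; simp only [qm, Pi.add_apply, mul_add, Finset.sum_add_distrib]; ring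
      map_smul' := fun a v => by
        funext x
        simp only [qm, Pi.smul_apply, smul_eq_mul, RingHom.id_apply, mul_sub, Finset.mul_sum]
        congr 1
        · ring
        · exact Finset.sum_congr rfl fun y _ => by ring }
  have hinj : Function.Injective L := by
    rw [← LinearMap.ker_eq_bot, LinearMap.ker_eq_bot']
    intro v hv
    have h0 : qf d c v = 0 := by
      rw [qf_eq]
      refine Finset.sum_eq_zero fun x _ => ?_
      have : qm d c v x = 0 := congrFun hv x
      rw [this, mul_zero]
    have h1 := qf_ge (d := d) hc hc0 he v
    rw [h0] at h1
    have h2 : ∀ x, 0 ≤ (d x - e x) * v x^2 := fun x =>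
      mul_nonneg (sub_pos.2 (hd x)).le (sq_nonneg _)
    have h3 := (Finset.sum_eq_zero_iff_of_nonneg (fun x _ => h2 x)).1
      (le_antisymm h1 (Finset.sum_nonneg fun x _ => h2 x))
    funext x
    have := h3 x (Finset.mem_univ x)
    rcases mul_eq_zero.1 this with h | h
    · exact absurd h (sub_pos.2 (hd x)).ne'
    · simpa using h
  obtain ⟨v, hv⟩ := (LinearMap.injective_iff_surjective.1 hinj) b
  exact ⟨v, fun x => congrFun hv x⟩

/-- the form of the complementary noise -/
noncomputable def qN (d δ : V → ℝ) (c : V → V → ℝ) (ζ : V → ℝ) : ℝ :=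
  ∑ x, (δ x)⁻¹ * (qm d c ζ x)^2 + qf d c ζ

lemma qN_id {d δ : V → ℝ} {c : V → V → ℝ} (hc : ∀ x y, c x y = c y x) (hδ : ∀ x, 0 < δ x)
    (α ζ : V → ℝ) :
    qf (fun x => d x + δ x) c (α - ζ) + qN d δ c ζ
      = qf d c α + ∑ x, (δ x)⁻¹ * (qm (fun x => d x + δ x) c ζ x - δ x * α x)^2 := by
  have e1 : qf (fun x => d x + δ x) c (α - ζ) = qf d c (α - ζ) + ∑ x, δ x * (α x - ζ x)^2 := by
    simp only [qf, Pi.sub_apply, add_mul, Finset.sum_add_distrib]; ring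
  rw [e1, qf_sub hc, qN]
  have e2 : ∀ x, (δ x)⁻¹ * (qm (fun x => d x + δ x) c ζ x - δ x * α x)^2
      = (δ x)⁻¹ * (qm d c ζ x)^2 + δ x * (α x - ζ x)^2 + 2 * (ζ x * qm d c ζ x)
        - 2 * (α x * qm d c ζ x) := by
    intro x
    have : qm (fun x => d x + δ x) c ζ x = qm d c ζ x + δ x * ζ x := by simp only [qm]; ring
    rw [this]
    have := (hδ x).ne'
    field_simp
    ring
  simp_rw [e2]
  rw [Finset.sum_sub_distrib, Finset.sum_add_distrib, Finset.sum_add_distrib, ← Finset.mul_sum,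
    ← Finset.mul_sum, ← qf_eq]
  ring

lemma qm_cont (d : V → ℝ) (c : V → V → ℝ) (x : V) : Continuous fun ζ => qm d c ζ x := by
  unfold qm; fun_prop

lemma qN_cont (d δ : V → ℝ) (c : V → V → ℝ) : Continuous (qN d δ c) := by
  have := qm_cont d c
  have := qf_cont d c
  unfold qN; fun_prop

lemma qN_neg (d δ : V → ℝ) (c : V → V → ℝ) (ζ : V → ℝ) : qN d δ c (-ζ) = qN d δ c ζ := by
  have : ∀ x, qm d c (-ζ) x = - qm d c ζ x := fun x => by
    simp only [qm, Pi.neg_apply, mul_neg, Finset.sum_neg_distrib]; ring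
  simp [qN, this, qf_neg]

lemma conv_key {d δ e : V → ℝ} {c : V → V → ℝ} (hc : ∀ x y, c x y = c y x)
    (hc0 : ∀ x y, 0 ≤ c x y) (he : ∀ x, ∑ y, c x y ≤ e x) (hd : ∀ x, e x < d x)
    (hδ : ∀ x, 0 < δ x) : ∃ c0 : ℝ≥0∞, ∀ f : (V → ℝ) → ℝ≥0∞, Measurable f →
      ∫⁻ ζ, ENNReal.ofReal (Real.exp (-(1/2) * qN d δ c ζ)) *
        ∫⁻ η, f (η + ζ) ∂(mg (fun x => d x + δ x) c) = c0 * ∫⁻ φ, f φ ∂(mg d c) := by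
  set G : (V → ℝ) → (V → ℝ) → ℝ≥0∞ := fun α ζ => ENNReal.ofReal (Real.exp (-(1/2) *
    ∑ x, (δ x)⁻¹ * (qm (fun x => d x + δ x) c ζ x - δ x * α x)^2)) with hG
  refine ⟨∫⁻ ζ, G 0 ζ, fun f hf => ?_⟩
  have hG0 : ∀ α, ∫⁻ ζ, G α ζ = ∫⁻ ζ, G 0 ζ := by
    intro α
    obtain ⟨v, hv⟩ := qm_surj (d := fun x => d x + δ x) hc hc0 he
      (fun x => by have := hd x; have := hδ x; linarith) (fun x => δ x * α x)
    rw [← lintegral_sub_right_eq_self (fun ζ => G 0 ζ) v]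
    refine lintegral_congr fun ζ => ?_
    simp only [hG, qm_sub, hv, Pi.zero_apply, mul_zero, sub_zero]
  have hm2 := qm_cont (fun x => d x + δ x) c
  have hNm : Measurable fun ζ => ENNReal.ofReal (Real.exp (-(1/2) * qN d δ c ζ)) :=
    (Real.continuous_exp.comp (continuous_const.mul (qN_cont d δ c))).measurable.ennreal_ofReal
  have hgm := gw_ofReal_meas (fun x => d x + δ x) c
  have hGm : Measurable (Function.uncurry fun ζ α => G α ζ) := by
    have : Continuous (Function.uncurry fun (ζ : V → ℝ) (α : V → ℝ) => Real.exp (-(1/2) *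
      ∑ x, (δ x)⁻¹ * (qm (fun x => d x + δ x) c ζ x - δ x * α x)^2)) := by
      simp only [qm]; unfold Function.uncurry; fun_prop
    exact this.measurable.ennreal_ofReal
  have hGa : ∀ α, Measurable fun ζ => G α ζ := by
    intro α
    have : Continuous fun ζ : V → ℝ => Real.exp (-(1/2) *
      ∑ x, (δ x)⁻¹ * (qm (fun x => d x + δ x) c ζ x - δ x * α x)^2) := by
      simp only [qm]; fun_prop
    exact this.measurable.ennreal_ofReal
  clear_value G
  calc ∫⁻ ζ, ENNReal.ofReal (Real.exp (-(1/2) * qN d δ c ζ)) *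
        ∫⁻ η, f (η + ζ) ∂(mg (fun x => d x + δ x) c)
      = ∫⁻ ζ, ∫⁻ α, f α * ENNReal.ofReal (gw d c α) * G α ζ := by
        refine lintegral_congr fun ζ => ?_
        have hfz : Measurable fun η => f (η + ζ) := hf.comp (measurable_add_const ζ)
        rw [mg_lintegral _ _ hfz]
        rw [← lintegral_sub_right_eq_self (fun η => f (η + ζ) *
          ENNReal.ofReal (gw (fun x => d x + δ x) c η)) ζ]
        rw [← lintegral_const_mul]
        · refine lintegral_congr fun α => ?_
          simp only [sub_add_cancel]
          rw [mul_comm, mul_assoc, mul_assoc]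
          congr 1
          simp only [gw, hG]
          rw [← ENNReal.ofReal_mul (Real.exp_pos _).le, ← ENNReal.ofReal_mul (Real.exp_pos _).le,
            ← Real.exp_add, ← Real.exp_add, ← mul_add, ← mul_add, qN_id hc hδ]
        · simp only [sub_add_cancel]
          exact hf.mul (hgm.comp (measurable_sub_const ζ))
    _ = ∫⁻ α, ∫⁻ ζ, f α * ENNReal.ofReal (gw d c α) * G α ζ := by
        refine lintegral_lintegral_swap (Measurable.aemeasurable ?_)
        exact ((hf.mul (gw_ofReal_meas d c)).comp measurable_snd).mul hGm
    _ = ∫⁻ α, f α * ENNReal.ofReal (gw d c α) * ∫⁻ ζ, G 0 ζ := by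
        refine lintegral_congr fun α => ?_
        rw [lintegral_const_mul _ (hGa α), hG0]
    _ = (∫⁻ ζ, G 0 ζ) * ∫⁻ φ, f φ ∂(mg d c) := by
        have hfg : Measurable fun α => f α * ENNReal.ofReal (gw d c α) :=
          hf.mul (gw_ofReal_meas d c)
        rw [lintegral_mul_const _ hfg, mg_lintegral _ _ hf, mul_comm]

lemma partC {d δ e : V → ℝ} {c : V → V → ℝ} (hc : ∀ x y, c x y = c y x)
    (hc0 : ∀ x y, 0 ≤ c x y) (he : ∀ x, ∑ y, c x y ≤ e x) (hd : ∀ x, e x < d x)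
    (hδ : ∀ x, 0 < δ x) {D : Set (V → ℝ)} (hDm : MeasurableSet D)
    (hD : ∀ η ζ, η ∈ D → η + ζ ∈ D ∨ η - ζ ∈ D) :
    mg (fun x => d x + δ x) c D * mg d c Set.univ
      ≤ 2 * mg d c D * mg (fun x => d x + δ x) c Set.univ := by
  obtain ⟨c0, key⟩ := conv_key hc hc0 he hd hδ
  set μ2 := mg (fun x => d x + δ x) c with hμ2
  set w : (V → ℝ) → ℝ≥0∞ := fun ζ => ENNReal.ofReal (Real.exp (-(1/2) * qN d δ c ζ)) with hw
  have hwm : Measurable w :=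
    (Real.continuous_exp.comp (continuous_const.mul (qN_cont d δ c))).measurable.ennreal_ofReal
  have hwn : ∀ ζ, w (-ζ) = w ζ := fun ζ => by simp only [hw, qN_neg]
  have hfin2 : IsFiniteMeasure μ2 := mg_finite hc hc0 he
    (fun x => by have := hd x; have := hδ x; linarith)
  have hfin1 : IsFiniteMeasure (mg d c) := mg_finite hc hc0 he hd
  set ZN := ∫⁻ ζ, w ζ with hZN
  have hle : ∀ ζ, w ζ ≤ ENNReal.ofReal (gw d c ζ) := fun ζ => by
    refine ENNReal.ofReal_le_ofReal (Real.exp_le_exp.2 ?_)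
    have : 0 ≤ ∑ x, (δ x)⁻¹ * (qm d c ζ x)^2 := Finset.sum_nonneg fun x _ =>
      mul_nonneg (inv_nonneg.2 (hδ x).le) (sq_nonneg _)
    simp only [qN]; linarith
  have hZt : ZN ≠ ⊤ := by
    have h1 : ZN ≤ mg d c Set.univ := by
      rw [mg_apply d c MeasurableSet.univ]
      exact lintegral_mono fun ζ => by simpa using hle ζ
    exact ne_top_of_le_ne_top (measure_ne_top _ _) h1
  have hZ0 : ZN ≠ 0 := by
    intro h
    rw [hZN, lintegral_eq_zero_iff hwm] at h
    have h2 : ∀ᵐ φ : V → ℝ, False := by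
      filter_upwards [h] with φ hφ
      simp only [Pi.zero_apply, hw, ENNReal.ofReal_eq_zero] at hφ
      exact absurd (Real.exp_pos _) (not_lt.2 hφ)
    rw [Filter.eventually_false_iff_eq_bot, ae_eq_bot] at h2
    have h3 : (volume : Measure (V → ℝ)) Set.univ ≠ 0 :=
      (isOpen_univ.measure_pos volume Set.univ_nonempty).ne'
    rw [h2] at h3; simp at h3
  have k1 : ZN * μ2 Set.univ = c0 * mg d c Set.univ := by
    have := key (fun _ => 1) measurable_const
    simp only [lintegral_one] at this
    rw [lintegral_mul_const _ hwm] at this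
    exact this
  have hDi : Measurable (D.indicator (1 : (V → ℝ) → ℝ≥0∞)) := measurable_one.indicator hDm
  have kD := key (D.indicator 1) hDi
  rw [lintegral_indicator_one hDm] at kD
  change ∫⁻ ζ, w ζ * ∫⁻ η, D.indicator 1 (η + ζ) ∂μ2 = _ at kD
  have hjm : Measurable fun ζ => ∫⁻ η, D.indicator (1 : (V → ℝ) → ℝ≥0∞) (η + ζ) ∂μ2 :=
    Measurable.lintegral_prod_left' (f := fun p : (V → ℝ) × (V → ℝ) => D.indicator 1 (p.1 + p.2))
      (hDi.comp measurable_add)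
  have k2 : ZN * μ2 D ≤ 2 * (c0 * mg d c D) := by
    rw [← kD]
    have hneg : ∫⁻ ζ, w ζ * ∫⁻ η, D.indicator 1 (η + ζ) ∂μ2
        = ∫⁻ ζ, w ζ * ∫⁻ η, D.indicator 1 (η - ζ) ∂μ2 := by
      rw [← lintegral_neg_eq_self (fun ζ => w ζ * ∫⁻ η, D.indicator 1 (η + ζ) ∂μ2)]
      refine lintegral_congr fun ζ => ?_
      rw [hwn]; simp only [sub_eq_add_neg]
    rw [two_mul]
    nth_rewrite 2 [hneg]
    have hwj : Measurable fun ζ => w ζ * ∫⁻ η, D.indicator (1 : (V → ℝ) → ℝ≥0∞) (η + ζ) ∂μ2 :=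
      hwm.mul hjm
    rw [← lintegral_add_left hwj, ← lintegral_mul_const _ hwm]
    refine lintegral_mono fun ζ => ?_
    dsimp only
    rw [← mul_add]
    refine mul_le_mul_right ?_ _
    have hDz : Measurable fun η => D.indicator (1 : (V → ℝ) → ℝ≥0∞) (η + ζ) :=
      hDi.comp (measurable_add_const ζ)
    rw [← lintegral_add_left hDz, ← lintegral_indicator_one hDm]
    refine lintegral_mono fun η => ?_
    by_cases h : η ∈ D
    · rcases hD η ζ h with h' | h' <;> simp [h, h']
    · simp [h]
  have k3 : ZN * (μ2 D * mg d c Set.univ) ≤ ZN * (2 * mg d c D * μ2 Set.univ) := by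
    calc ZN * (μ2 D * mg d c Set.univ) = (ZN * μ2 D) * mg d c Set.univ := by ring
      _ ≤ (2 * (c0 * mg d c D)) * mg d c Set.univ := by gcongr
      _ = 2 * mg d c D * (c0 * mg d c Set.univ) := by ring
      _ = ZN * (2 * mg d c D * μ2 Set.univ) := by rw [← k1]; ring
  exact (ENNReal.mul_le_mul_iff_right hZ0 hZt).1 k3

end PartC


section PartA1
open MeasureTheory ProbabilityTheory
open scoped ENNReal NNReal
variable {V : Type*} [Fintype V] [DecidableEq V]

/-- exponential variable at site `x` -/
noncomputable def eps (d : V → ℝ) (x : V) : Measure (V → ℝ≥0) :=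
  (volume.withDensity (exponentialPDF (d x / 2))).map (fun t : ℝ => Pi.single x t.toNNReal)

instance (d : V → ℝ) (x : V) : SFinite (eps d x) := by unfold eps; infer_instance

/-- occupation field of a path with `j` steps -/
noncomputable def NJ (P : V → V → ℝ) (d : V → ℝ) : ℕ → V → Measure (V → ℝ≥0)
  | 0, x => eps d x
  | j+1, x => (eps d x).conv (Measure.sum fun y => ENNReal.ofReal (P x y) • NJ P d j y)

instance NJ_sf (P : V → V → ℝ) (d : V → ℝ) (j : ℕ) (x : V) : SFinite (NJ P d j x) := by
  induction j generalizing x with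
  | zero => unfold NJ; infer_instance
  | succ j ih => unfold NJ; infer_instance

/-- intensity -/
noncomputable def nuM (P : V → V → ℝ) (π d : V → ℝ) (m q : ℝ) : Measure (V → ℝ≥0) :=
  Measure.sum fun j : ℕ => ENNReal.ofReal (m * (1 - q) * q^j) •
    Measure.sum fun x => ENNReal.ofReal (π x) • NJ P d j x

instance (P : V → V → ℝ) (π d : V → ℝ) (m q : ℝ) : SFinite (nuM P π d m q) := by
  unfold nuM; infer_instance

/-- powers -/
noncomputable def cpow (ν : Measure (V → ℝ≥0)) : ℕ → Measure (V → ℝ≥0)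
  | 0 => Measure.dirac 0
  | i+1 => ν.conv (cpow ν i)

instance cpow_sf (ν : Measure (V → ℝ≥0)) [SFinite ν] (j : ℕ) : SFinite (cpow ν j) := by
  induction j with
  | zero => unfold cpow; infer_instance
  | succ j ih => unfold cpow; infer_instance

/-- compound Poisson -/
noncomputable def rhoM (ν : Measure (V → ℝ≥0)) (m : ℝ) : Measure (V → ℝ≥0) :=
  Measure.sum fun i : ℕ => ENNReal.ofReal (Real.exp (-m) / (i.factorial)) • cpow ν i

instance (ν : Measure (V → ℝ≥0)) [SFinite ν] (m : ℝ) : SFinite (rhoM ν m) := by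
  unfold rhoM; infer_instance

lemma lint_conv {χ : (V → ℝ≥0) → ℝ≥0∞} (hm : Measurable χ) (ha : ∀ a b, χ (a+b) = χ a * χ b)
    (μ ν : Measure (V → ℝ≥0)) [SFinite ν] :
    ∫⁻ z, χ z ∂(μ.conv ν) = (∫⁻ z, χ z ∂μ) * ∫⁻ z, χ z ∂ν := by
  rw [Measure.lintegral_conv hm]
  simp only [ha]
  rw [← lintegral_mul_const _ hm]
  exact lintegral_congr fun x => lintegral_const_mul _ hm

lemma lint_NJ {χ : (V → ℝ≥0) → ℝ≥0∞} (hm : Measurable χ) (ha : ∀ a b, χ (a+b) = χ a * χ b)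
    {P : V → V → ℝ} {d s : V → ℝ} (hP : ∀ x y, 0 ≤ P x y) (hs : ∀ x, 0 ≤ s x)
    (he : ∀ x, ∫⁻ z, χ z ∂(eps d x) = ENNReal.ofReal (s x)) {z : ℕ → V → ℝ}
    (hz0 : ∀ x, z 0 x = s x) (hz : ∀ j x, z (j+1) x = s x * ∑ y, P x y * z j y) (j : ℕ) :
    (∀ x, 0 ≤ z j x) ∧ ∀ x, ∫⁻ z, χ z ∂(NJ P d j x) = ENNReal.ofReal (z j x) := by
  induction j with
  | zero => exact ⟨fun x => by rw [hz0]; exact hs x, fun x => by rw [hz0]; exact he x⟩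
  | succ j ih =>
    refine ⟨fun x => by rw [hz]; exact mul_nonneg (hs x) (Finset.sum_nonneg fun y _ => mul_nonneg (hP x y) (ih.1 y)), fun x => ?_⟩
    rw [NJ, lint_conv hm ha, he, lintegral_sum_measure, tsum_fintype, hz, ENNReal.ofReal_mul (hs x),
      ENNReal.ofReal_sum_of_nonneg fun y _ => mul_nonneg (hP x y) (ih.1 y)]
    congr 1
    refine Finset.sum_congr rfl fun y _ => ?_
    rw [lintegral_smul_measure, ih.2, ENNReal.ofReal_mul (hP x y), smul_eq_mul]

lemma lint_nu {χ : (V → ℝ≥0) → ℝ≥0∞} (hm : Measurable χ) (ha : ∀ a b, χ (a+b) = χ a * χ b)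
    {P : V → V → ℝ} {π d s : V → ℝ} {m q : ℝ} (hP : ∀ x y, 0 ≤ P x y) (hs : ∀ x, 0 ≤ s x)
    (hπ : ∀ x, 0 < π x) (hm0 : 0 ≤ m) (hq0 : 0 ≤ q) (hq1 : q < 1)
    (he : ∀ x, ∫⁻ z, χ z ∂(eps d x) = ENNReal.ofReal (s x)) {z : ℕ → V → ℝ}
    (hz0 : ∀ x, z 0 x = s x) (hz : ∀ j x, z (j+1) x = s x * ∑ y, P x y * z j y)
    (hS : Summable fun j => q^j * ∑ x, π x * z j x) :
    ∫⁻ z, χ z ∂(nuM P π d m q) = ENNReal.ofReal (m * (1-q) * ∑' j, q^j * ∑ x, π x * z j x) := by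
  have h0 : ∀ j, 0 ≤ ∑ x, π x * z j x := fun j => Finset.sum_nonneg fun x _ =>
    mul_nonneg (hπ x).le ((lint_NJ hm ha hP hs he hz0 hz j).1 x)
  have hmq : 0 ≤ m * (1 - q) := mul_nonneg hm0 (by linarith)
  rw [nuM, lintegral_sum_measure, ← tsum_mul_left, ENNReal.ofReal_tsum_of_nonneg
    (fun j => mul_nonneg hmq (mul_nonneg (pow_nonneg hq0 j) (h0 j))) (hS.mul_left _)]
  refine tsum_congr fun j => ?_
  rw [lintegral_smul_measure, lintegral_sum_measure, tsum_fintype, ← mul_assoc,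
    ENNReal.ofReal_mul (mul_nonneg hmq (pow_nonneg hq0 j)), smul_eq_mul,
    ENNReal.ofReal_sum_of_nonneg fun x _ => mul_nonneg (hπ x).le ((lint_NJ hm ha hP hs he hz0 hz j).1 x)]
  congr 1
  refine Finset.sum_congr rfl fun x _ => ?_
  rw [lintegral_smul_measure, (lint_NJ hm ha hP hs he hz0 hz j).2, ENNReal.ofReal_mul (hπ x).le, smul_eq_mul]

lemma lint_rho {χ : (V → ℝ≥0) → ℝ≥0∞} (hm : Measurable χ) (h0 : χ 0 = 1)
    (ha : ∀ a b, χ (a+b) = χ a * χ b) {ν : Measure (V → ℝ≥0)} [SFinite ν] {t m : ℝ} (ht : 0 ≤ t)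
    (hν : ∫⁻ z, χ z ∂ν = ENNReal.ofReal t) :
    ∫⁻ z, χ z ∂(rhoM ν m) = ENNReal.ofReal (Real.exp (t - m)) := by
  have hc : ∀ i, ∫⁻ z, χ z ∂(cpow ν i) = ENNReal.ofReal (t^i) := by
    intro i
    induction i with
    | zero => rw [cpow, lintegral_dirac' _ hm, h0]; simp
    | succ i ih => rw [cpow, lint_conv hm ha, ih, hν, pow_succ', ENNReal.ofReal_mul ht]
  have he : HasSum (fun i : ℕ => Real.exp (-m) * (t^i / i.factorial)) (Real.exp (-m) * Real.exp t) := by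
    have := NormedSpace.expSeries_div_hasSum_exp (𝔸 := ℝ) t
    rw [← Real.exp_eq_exp_ℝ] at this
    exact this.mul_left _
  have : Real.exp (t - m) = ∑' i : ℕ, Real.exp (-m) * (t^i / i.factorial) := by
    rw [he.tsum_eq, ← Real.exp_add]; congr 1; ring
  rw [rhoM, lintegral_sum_measure, this, ENNReal.ofReal_tsum_of_nonneg (fun i => by positivity) he.summable]
  refine tsum_congr fun i => ?_
  rw [lintegral_smul_measure, hc, smul_eq_mul, ← ENNReal.ofReal_mul (by positivity)]
  congr 1; ring

lemma lint_eps {χ : (V → ℝ≥0) → ℝ≥0∞} (hm : Measurable χ) (d : V → ℝ) (x : V) :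
    ∫⁻ z, χ z ∂(eps d x) = ∫⁻ t : ℝ, exponentialPDF (d x / 2) t * χ (Pi.single x t.toNNReal) := by
  have hg : Measurable (fun t : ℝ => (Pi.single x t.toNNReal : V → ℝ≥0)) := by
    refine measurable_pi_lambda _ fun y => ?_
    by_cases h : y = x
    · subst h; simpa using measurable_real_toNNReal
    · simp [Pi.single_eq_of_ne h]
  have hp : Measurable (exponentialPDF (d x / 2)) := (measurable_exponentialPDFReal _).ennreal_ofReal
  rw [eps, lintegral_map hm hg]
  exact lintegral_withDensity_eq_lintegral_mul _ hp (hm.comp hg)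

/-- Laplace character -/
noncomputable def chiL (l : V → ℝ) (y : V → ℝ≥0) : ℝ≥0∞ := ENNReal.ofReal (Real.exp (-(1/2) * ∑ x, l x * (y x : ℝ)))

lemma chiL_meas (l : V → ℝ) : Measurable (chiL l) := by
  unfold chiL; fun_prop

lemma chiL_zero (l : V → ℝ) : chiL l 0 = 1 := by simp [chiL]

lemma chiL_add (l : V → ℝ) (a b) : chiL l (a+b) = chiL l a * chiL l b := by
  rw [chiL, chiL, chiL, ← ENNReal.ofReal_mul (Real.exp_pos _).le, ← Real.exp_add, ← mul_add, ← Finset.sum_add_distrib]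
  simp [mul_add]

lemma lint_eps_L {d l : V → ℝ} (hd : ∀ x, 0 < d x) (hl : ∀ x, 0 ≤ l x) (x : V) :
    ∫⁻ z, chiL l z ∂(eps d x) = ENNReal.ofReal (d x / (d x + l x)) := by
  have h1 := hd x
  have h2 := hl x
  have h3 : 0 < (d x + l x)/2 := by positivity
  have : ∀ t : ℝ, exponentialPDF (d x / 2) t * chiL l (Pi.single x t.toNNReal) =
      ENNReal.ofReal (d x / (d x + l x)) * exponentialPDF ((d x + l x)/2) t := by
    intro t
    by_cases ht : 0 ≤ t
    · rw [exponentialPDF_of_nonneg ht, exponentialPDF_of_nonneg ht, chiL, ← ENNReal.ofReal_mul (by positivity),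
        ← ENNReal.ofReal_mul (by positivity)]
      have : ∑ y, l y * (((Pi.single x t.toNNReal : V → ℝ≥0) y : ℝ≥0) : ℝ) = l x * t := by
        rw [Finset.sum_eq_single x]
        · simp [ht]
        · intro y _ hy; simp [Pi.single_eq_of_ne hy]
        · simp
      have e2 : d x / (d x + l x) * ((d x + l x) / 2) = d x / 2 := by field_simp
      rw [this, mul_assoc, ← Real.exp_add, ← mul_assoc (d x / (d x + l x)), e2]
      congr 3; ring
    · rw [exponentialPDF_of_neg (not_le.mp ht), exponentialPDF_of_neg (not_le.mp ht)]; simp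
  rw [lint_eps (chiL_meas l)]
  simp only [this]
  have hp : Measurable (exponentialPDF ((d x + l x) / 2)) := (measurable_exponentialPDFReal _).ennreal_ofReal
  rw [lintegral_const_mul _ hp,
    lintegral_exponentialPDF_eq_one h3, mul_one]

/-- support character -/
noncomputable def chiS (W : Finset V) (y : V → ℝ≥0) : ℝ≥0∞ := {y : V → ℝ≥0 | ∀ x ∉ W, y x = 0}.indicator 1 y

lemma suppset_meas (W : Finset V) : MeasurableSet {y : V → ℝ≥0 | ∀ x ∉ W, y x = 0} := by
  simp only [Set.setOf_forall]
  exact MeasurableSet.iInter fun x => MeasurableSet.iInter fun _ =>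
    measurableSet_eq_fun (measurable_pi_apply x) measurable_const

lemma chiS_meas (W : Finset V) : Measurable (chiS W) := 
  measurable_one.indicator (suppset_meas W)

lemma chiS_zero (W : Finset V) : chiS W 0 = 1 := by simp [chiS]

lemma chiS_add (W : Finset V) (a b) : chiS W (a+b) = chiS W a * chiS W b := by
  classical
  simp only [chiS, Set.indicator_apply, Set.mem_setOf_eq, Pi.add_apply, add_eq_zero, Pi.one_apply]
  by_cases h1 : ∀ x ∉ W, a x = 0 <;> by_cases h2 : ∀ x ∉ W, b x = 0
  · rw [if_pos h1, if_pos h2, if_pos fun x hx => ⟨h1 x hx, h2 x hx⟩, one_mul]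
  · rw [if_neg h2, if_neg fun h => h2 fun x hx => (h x hx).2, mul_zero]
  · rw [if_neg h1, if_neg fun h => h1 fun x hx => (h x hx).1, zero_mul]
  · rw [if_neg h1, if_neg fun h => h1 fun x hx => (h x hx).1, zero_mul]

lemma lint_eps_S {d : V → ℝ} (hd : ∀ x, 0 < d x) (W : Finset V) (x : V) :
    ∫⁻ z, chiS W z ∂(eps d x) = ENNReal.ofReal (if x ∈ W then 1 else 0) := by
  have h1 := hd x
  rw [lint_eps (chiS_meas W)]
  by_cases hx : x ∈ W
  · have : ∀ t : ℝ, chiS W (Pi.single x t.toNNReal) = 1 := by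
      intro t
      rw [chiS, Set.indicator_of_mem]; rfl
      intro y hy
      rw [Pi.single_eq_of_ne]; rintro rfl; exact hy hx
    simp only [this, mul_one, hx, if_true]
    rw [lintegral_exponentialPDF_eq_one (by positivity)]; simp
  · simp only [hx, if_false, ENNReal.ofReal_zero]
    rw [← lintegral_zero (μ := (volume : Measure ℝ))]
    refine lintegral_congr_ae ?_
    filter_upwards [Measure.ae_ne volume 0] with t ht
    rcases lt_or_gt_of_ne ht with h | h
    · rw [exponentialPDF_of_neg h, zero_mul]
    · rw [chiS, Set.indicator_of_notMem, mul_zero]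
      intro hh
      have := hh x hx
      simp at this
      linarith

end PartA1


section PartA2
open MeasureTheory ProbabilityTheory
open scoped ENNReal NNReal
variable {V : Type*} [Fintype V] [DecidableEq V]

lemma zz_facts {P : V → V → ℝ} {π s : V → ℝ} {q : ℝ} (hP : ∀ x y, 0 ≤ P x y) (hP1 : ∀ x, ∑ y, P x y = 1)
    (hs : ∀ x, 0 ≤ s x) (hs1 : ∀ x, s x ≤ 1) (hq0 : 0 ≤ q) (hq1 : q < 1) {z : ℕ → V → ℝ}
    (hz0 : ∀ x, z 0 x = s x) (hz : ∀ j x, z (j+1) x = s x * ∑ y, P x y * z j y) :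
    (∀ x, Summable fun j => q^j * z j x) ∧
    (∀ x, ∑' j, q^j * z j x = s x + q * (s x * ∑ y, P x y * ∑' j, q^j * z j y)) ∧
    Summable (fun j => q^j * ∑ x, π x * z j x) := by
  obtain ⟨h1, h2⟩ := geo_fix (K := fun x y => s x * P x y) (g := s) (z := z) (q := q)
    (fun x y => mul_nonneg (hs x) (hP x y))
    (fun x => by rw [← Finset.mul_sum, hP1, mul_one]; exact hs1 x) hs hs1 hz0
    (fun j x => by rw [hz, Finset.mul_sum]; exact Finset.sum_congr rfl fun y _ => by ring) hq0 hq1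
  refine ⟨h1, fun x => ?_, ?_⟩
  · rw [h2 x]
    congr 2
    rw [Finset.mul_sum]
    exact Finset.sum_congr rfl fun y _ => by ring
  · have : (fun j => q^j * ∑ x, π x * z j x) = fun j => ∑ x, π x * (q^j * z j x) := by
      funext j; rw [Finset.mul_sum]; exact Finset.sum_congr rfl fun y _ => by ring
    rw [this]
    exact summable_sum fun x _ => (h1 x).mul_left _

lemma rho_supp {P : V → V → ℝ} {π d : V → ℝ} (hP : ∀ x y, 0 ≤ P x y) (hP1 : ∀ x, ∑ y, P x y = 1)
    (hπ : ∀ x, 0 < π x) (hπ1 : ∑ x, π x = 1) {m q : ℝ} (hm0 : 0 ≤ m) (hq0 : 0 ≤ q) (hq1 : q < 1)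
    (hd : ∀ x, 0 < d x) (W : Finset V) :
    rhoM (nuM P π d m q) m {y | ∀ x ∉ W, y x = 0} = ENNReal.ofReal (uz (pois (GG P π m q)) W) := by
  have hz0 : ∀ x, uz (R P 0 x) W = if x ∈ W then 1 else 0 := fun x => by
    rw [R, osig, uz_sig_zero]; simp
  have hz : ∀ j x, uz (R P (j+1) x) W = (if x ∈ W then 1 else 0) * ∑ y, P x y * uz (R P j y) W := by
    intro j x
    rw [R, osig, uz_sig_succ, Finset.mul_sum]
    refine Finset.sum_congr rfl fun y _ => ?_
    simp only [Finset.singleton_subset_iff]; ring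
  have hs : ∀ x, (0:ℝ) ≤ if x ∈ W then 1 else 0 := fun x => by split_ifs <;> norm_num
  have hs1 : ∀ x, (if x ∈ W then 1 else 0 : ℝ) ≤ 1 := fun x => by split_ifs <;> norm_num
  obtain ⟨f1, f2, f3⟩ := zz_facts (π := π) (z := fun j x => uz (R P j x) W) hP hP1 hs hs1 hq0 hq1 hz0 hz
  have hν := lint_nu (z := fun j x => uz (R P j x) W) (chiS_meas W) (chiS_add W) hP hs hπ hm0 hq0 hq1 (lint_eps_S hd W) hz0 hz f3
  have ht : 0 ≤ m * (1-q) * ∑' j, q^j * ∑ x, π x * uz (R P j x) W := by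
    refine mul_nonneg (mul_nonneg hm0 (by linarith)) (tsum_nonneg fun j => mul_nonneg (pow_nonneg hq0 j) ?_)
    exact Finset.sum_nonneg fun x _ => mul_nonneg (hπ x).le
      ((lint_NJ (z := fun j x => uz (R P j x) W) (chiS_meas W) (chiS_add W) hP hs (lint_eps_S hd W) hz0 hz j).1 x)
  have hρ := lint_rho (m := m) (chiS_meas W) (chiS_zero W) (chiS_add W) ht hν
  have e1 : ∫⁻ z, chiS W z ∂(rhoM (nuM P π d m q) m) = rhoM (nuM P π d m q) m {y | ∀ x ∉ W, y x = 0} :=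
    lintegral_indicator_one (suppset_meas W)
  rw [← e1, hρ, uz_pois' (GG_nonneg hP hπ hm0 hq0 hq1), GG_sum hP hP1 hπ hπ1 hq0 hq1]
  congr 3
  have e2 : GG P π m q = fun A => m * ((1 - q) * ∑' j : ℕ, q^j * rr P π j A) := rfl
  rw [e2, uz_GM (fun j A => rr_nonneg hP hπ j A) (fun j A => rr_le_one hP hP1 hπ hπ1 j A) m hq0 hq1, mul_assoc]
  congr 2
  refine tsum_congr fun j => ?_
  congr 1
  simp only [uz, rr, Finset.mul_sum]
  rw [Finset.sum_comm]
  refine Finset.sum_congr rfl fun A _ => ?_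
  split_ifs <;> simp

/-- measure of exact support -/
lemma rho_exact {P : V → V → ℝ} {π d : V → ℝ} (hP : ∀ x y, 0 ≤ P x y) (hP1 : ∀ x, ∑ y, P x y = 1)
    (hπ : ∀ x, 0 < π x) (hπ1 : ∑ x, π x = 1) {m q : ℝ} (hm0 : 0 ≤ m) (hq0 : 0 ≤ q) (hq1 : q < 1)
    (hd : ∀ x, 0 < d x) :
    IsProbabilityMeasure (rhoM (nuM P π d m q) m) ∧ ∀ S : Finset V,
    (rhoM (nuM P π d m q) m).real {y | ∀ x, y x ≠ 0 ↔ x ∈ S} = pois (GG P π m q) S := by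
  have hG : ∀ A, 0 ≤ GG P π m q A := GG_nonneg hP hπ hm0 hq0 hq1
  set ρ := rhoM (nuM P π d m q) m with hρ
  have hpr : IsProbabilityMeasure ρ := by
    constructor
    have := rho_supp hP hP1 hπ hπ1 hm0 hq0 hq1 hd (Finset.univ : Finset V)
    rw [uz_univ, pois_sum hG] at this
    simpa using this
  refine ⟨hpr, ?_⟩
  have key : (fun S : Finset V => ρ.real {y | ∀ x, y x ≠ 0 ↔ x ∈ S}) = pois (GG P π m q) := by
    refine uz_inj fun W => ?_
    have h1 := rho_supp hP hP1 hπ hπ1 hm0 hq0 hq1 hd W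
    have h0 : 0 ≤ uz (pois (GG P π m q)) W := by
      unfold uz; refine Finset.sum_nonneg fun S _ => ?_
      split_ifs
      · exact pois_nonneg _ _
      · exact le_rfl
    have h2 : ρ.real {y | ∀ x ∉ W, y x = 0} = uz (pois (GG P π m q)) W := by
      rw [Measure.real, h1, ENNReal.toReal_ofReal h0]
    rw [← h2, uz, ← Finset.sum_filter]
    have h3 : {y : V → ℝ≥0 | ∀ x ∉ W, y x = 0}
        = ⋃ S ∈ Finset.univ.filter (fun S : Finset V => S ⊆ W), {y | ∀ x, y x ≠ 0 ↔ x ∈ S} := by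
      ext y
      simp only [Set.mem_setOf_eq, Set.mem_iUnion, Finset.mem_filter, Finset.mem_univ, true_and, exists_prop]
      constructor
      · intro h
        refine ⟨Finset.univ.filter fun x => y x ≠ 0, fun x hx => ?_, fun x => by simp⟩
        by_contra hc
        exact (Finset.mem_filter.1 hx).2 (h x hc)
      · rintro ⟨S, hS, h⟩ x hx
        by_contra hc
        exact hx (hS ((h x).1 hc))
    rw [h3, measureReal_biUnion_finset]
    · intro S _ T _ hST
      refine Set.disjoint_left.2 fun y hy hy' => hST ?_
      ext x
      rw [← hy x, ← hy' x]
    · intro S _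
      simp only [Set.setOf_forall]
      refine MeasurableSet.iInter fun x => ?_
      by_cases hx : x ∈ S
      · simp only [hx, iff_true]
        exact (measurableSet_eq_fun (measurable_pi_apply x) measurable_const).compl
      · simp only [hx, iff_false, not_not]
        exact measurableSet_eq_fun (measurable_pi_apply x) measurable_const
  intro S
  exact congrFun key S

/-- square map -/
noncomputable def sqm (h : ℝ) (φ : V → ℝ) (x : V) : ℝ≥0 := ((φ x + h)^2).toNNReal

lemma sqm_meas (h : ℝ) : Measurable (sqm h : (V → ℝ) → V → ℝ≥0) := by
  unfold sqm; fun_prop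

lemma lap {P : V → V → ℝ} {π : V → ℝ} (hP : ∀ x y, 0 ≤ P x y) (hP1 : ∀ x, ∑ y, P x y = 1)
    (hπ : ∀ x, 0 < π x) (hr : ∀ x y, π x * P x y = π y * P y x) (hπ1 : ∑ x, π x = 1)
    {κ h : ℝ} (hκ : 0 < κ)
    {l v : V → ℝ} (hl : ∀ x, 0 ≤ l x)
    (hv : ∀ x, qm (fun x => (1+κ) * π x + l x) (fun x y => π x * P x y) v x = h * κ * π x) :
    ∫⁻ z, chiL l z ∂((mg (fun x => (1+κ) * π x) (fun x y => π x * P x y)).map (sqm h)) =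
      ENNReal.ofReal (Real.exp (1/2 * ∑ x, h * κ * π x * v x - h^2*κ/2)
        * ∫ φ, gw (fun x => (1+κ) * π x + l x) (fun x y => π x * P x y) φ) := by
  set d : V → ℝ := fun x => (1+κ) * π x with hd
  set c : V → V → ℝ := fun x y => π x * P x y with hc
  have hcs : ∀ x y, c x y = c y x := hr
  have hc0 : ∀ x y, 0 ≤ c x y := fun x y => mul_nonneg (hπ x).le (hP x y)
  have he : ∀ x, ∑ y, c x y ≤ π x := fun x => by simp only [hc]; rw [← Finset.mul_sum, hP1, mul_one]
  have hdl : ∀ x, π x < d x + l x := fun x => by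
    have := mul_pos hκ (hπ x); have := hl x; simp only [hd]; nlinarith
  rw [lintegral_map (chiL_meas l) (sqm_meas h)]
  have hfm : Measurable fun φ : V → ℝ => chiL l (sqm h φ) := (chiL_meas l).comp (sqm_meas h)
  rw [mg_lintegral d c hfm]
  rw [← lintegral_sub_right_eq_self _ (fun _ : V => h)]
  have hvh : ∀ x, qm d c (fun _ => h) x = h * κ * π x := by
    intro x
    simp only [qm, hd, hc]
    rw [← Finset.sum_mul, ← Finset.mul_sum, hP1]; ring
  have pt : ∀ φ : V → ℝ, chiL l (sqm h (φ - fun _ => h)) * ENNReal.ofReal (gw d c (φ - fun _ => h))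
      = ENNReal.ofReal (Real.exp (-(h^2*κ/2)) *
        Real.exp (-(1/2) * qf (fun x => d x + l x) c φ + ∑ x, h * κ * π x * φ x)) := by
    intro φ
    rw [chiL, gw, ← ENNReal.ofReal_mul (Real.exp_pos _).le, ← Real.exp_add, ← Real.exp_add]
    congr 2
    have e1 := shift_pt hcs hvh φ
    have e2 : ∑ x, h * κ * π x * h = h^2*κ := by
      rw [← Finset.sum_mul, ← Finset.mul_sum, hπ1]; ring
    have e3 : qf (fun x => d x + l x) c φ = qf d c φ + ∑ x, l x * φ x^2 := by
      simp only [qf, add_mul, Finset.sum_add_distrib]; ring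
    have e4 : ∑ x, l x * ((sqm h (φ - fun _ => h) x : ℝ≥0) : ℝ) = ∑ x, l x * φ x^2 := by
      refine Finset.sum_congr rfl fun x _ => ?_
      simp only [sqm, Pi.sub_apply, sub_add_cancel]
      rw [Real.coe_toNNReal _ (sq_nonneg _)]
    rw [e3, e4]
    rw [e2] at e1
    linarith
  rw [lintegral_congr pt, ← ofReal_integral_eq_lintegral_ofReal, integral_const_mul, shift_int hcs hv, ← mul_assoc,
    ← Real.exp_add]
  · congr 3; ring
  · exact (gwb_integrable hcs hc0 he hdl _).const_mul _
  · exact Filter.Eventually.of_forall fun φ => by positivity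

end PartA2


section PartA3
open MeasureTheory ProbabilityTheory
open scoped ENNReal NNReal BoundedContinuousFunction
variable {V : Type*} [Fintype V] [DecidableEq V]

/-- exponentials -/
def expSet (V : Type*) [Fintype V] : Set ((V → ℝ≥0) →ᵇ ℝ) :=
  {g | ∃ l : V → ℝ, (∀ x, 0 ≤ l x) ∧ ∀ y, g y = Real.exp (-(1/2) * ∑ x, l x * (y x : ℝ))}

lemma expSet_exists {l : V → ℝ} (hl : ∀ x, 0 ≤ l x) :
    ∃ g ∈ expSet V, ∀ y, g y = Real.exp (-(1/2) * ∑ x, l x * (y x : ℝ)) := by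
  have hcont : Continuous fun y : V → ℝ≥0 => Real.exp (-(1/2) * ∑ x, l x * (y x : ℝ)) := by fun_prop
  refine ⟨BoundedContinuousFunction.ofNormedAddCommGroup _ hcont 1 fun y => ?_, ⟨l, hl, fun y => rfl⟩, fun y => rfl⟩
  rw [Real.norm_eq_abs, abs_of_pos (Real.exp_pos _), Real.exp_le_one_iff]
  have : 0 ≤ ∑ x, l x * (y x : ℝ) := Finset.sum_nonneg fun x _ => mul_nonneg (hl x) (y x).2
  linarith

lemma expSet_closure : ((Submonoid.closure (expSet V) : Submonoid _) : Set ((V → ℝ≥0) →ᵇ ℝ)) = expSet V := by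
  apply Set.Subset.antisymm _ Submonoid.subset_closure
  intro g hg
  induction hg using Submonoid.closure_induction with
  | mem g h => exact h
  | one => exact ⟨0, fun x => le_rfl, fun y => by simp⟩
  | mul a b _ _ ha hb =>
    obtain ⟨l, hl, h1⟩ := ha
    obtain ⟨l', hl', h2⟩ := hb
    refine ⟨l + l', fun x => add_nonneg (hl x) (hl' x), fun y => ?_⟩
    rw [BoundedContinuousFunction.mul_apply, h1, h2, ← Real.exp_add, ← mul_add, ← Finset.sum_add_distrib]
    simp [add_mul]

lemma laplace_unique {μ ν : Measure (V → ℝ≥0)} [IsFiniteMeasure μ] [IsFiniteMeasure ν]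
    (h : ∀ l : V → ℝ, (∀ x, 0 ≤ l x) → ∫⁻ y, chiL l y ∂μ = ∫⁻ y, chiL l y ∂ν) : μ = ν := by
  let A : StarSubalgebra ℝ ((V → ℝ≥0) →ᵇ ℝ) :=
    { Algebra.adjoin ℝ (expSet V) with
      star_mem' := fun {a} ha => by
        have : star a = a := by ext y; simp
        rw [this]; exact ha }
  refine ext_of_forall_mem_subalgebra_integral_eq_of_polish (𝕜 := ℝ) (A := A) ?_ ?_
  · intro x y hxy
    obtain ⟨a, ha⟩ := Function.ne_iff.1 hxy
    obtain ⟨g, hg, hg'⟩ := expSet_exists (l := Pi.single a (1:ℝ)) (fun x => by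
      by_cases hx : x = a
      · subst hx; simp
      · simp [Pi.single_eq_of_ne hx])
    have hgA : g ∈ A := Algebra.subset_adjoin hg
    refine ⟨_, ⟨_, StarSubalgebra.mem_map.2 ⟨g, hgA, rfl⟩, rfl⟩, ?_⟩
    change g x ≠ g y
    rw [hg', hg']
    have e : ∀ z : V → ℝ≥0, ∑ x, (Pi.single a (1:ℝ) : V → ℝ) x * (z x : ℝ) = z a := by
      intro z
      rw [Finset.sum_eq_single a]
      · simp
      · intro b _ hb; simp [Pi.single_eq_of_ne hb]
      · simp
    rw [e, e]
    intro hh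
    have := Real.exp_injective hh
    apply ha
    have h2 : (x a : ℝ) = y a := by linarith
    exact_mod_cast h2
  · intro g hg
    have hg2 : g ∈ Submodule.span ℝ ((Submonoid.closure (expSet V) : Submonoid _) : Set ((V → ℝ≥0) →ᵇ ℝ)) := by
      rw [← Algebra.adjoin_eq_span]; exact hg
    rw [expSet_closure] at hg2
    clear hg
    induction hg2 using Submodule.span_induction with
    | mem g hg =>
      obtain ⟨l, hl, h1⟩ := hg
      have key : ∀ (μ : Measure (V → ℝ≥0)), ∫ y, g y ∂μ = (∫⁻ y, chiL l y ∂μ).toReal := by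
        intro μ
        rw [integral_eq_lintegral_of_nonneg_ae]
        · congr 1
          refine lintegral_congr fun y => ?_
          rw [h1, chiL]
        · exact Filter.Eventually.of_forall fun y => by rw [h1]; exact (Real.exp_pos _).le
        · exact g.continuous.aestronglyMeasurable
      rw [key, key, h l hl]
    | zero => simp
    | add a b ha hb h1 h2 =>
      simp only [BoundedContinuousFunction.coe_add, Pi.add_apply]
      rw [integral_add (a.integrable _) (b.integrable _), integral_add (a.integrable _) (b.integrable _),
        h1, h2]
    | smul r a ha h1 =>
      simp only [BoundedContinuousFunction.coe_smul, integral_smul]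
      rw [h1]

lemma dynkin {P : V → V → ℝ} {π : V → ℝ} (hP : ∀ x y, 0 ≤ P x y) (hP1 : ∀ x, ∑ y, P x y = 1)
    (hπ : ∀ x, 0 < π x) (hr : ∀ x y, π x * P x y = π y * P y x) (hπ1 : ∑ x, π x = 1)
    {κ h m : ℝ} (hκ : 0 < κ) (hm : h^2 * κ = 2 * m) :
    (mg (fun x => (1+κ) * π x) (fun x y => π x * P x y)).map (sqm h) =
    ((mg (fun x => (1+κ) * π x) (fun x y => π x * P x y)).map (sqm 0)).conv
      (rhoM (nuM P π (fun x => (1+κ) * π x) m (1/(1+κ))) m) := by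
  have hm0 : 0 ≤ m := by nlinarith [mul_nonneg (sq_nonneg h) hκ.le]
  set q := 1/(1+κ) with hq
  have hq0 : 0 ≤ q := by positivity
  have hq1 : q < 1 := by rw [hq, div_lt_one (by linarith)]; linarith
  have hqk : q * (1+κ) = 1 := by rw [hq]; field_simp
  have hd : ∀ x, 0 < (1+κ) * π x := fun x => mul_pos (by linarith) (hπ x)
  have hfin : IsFiniteMeasure (mg (fun x => (1+κ) * π x) (fun x y => π x * P x y)) :=
    mg_finite (e := π) hr (fun x y => mul_nonneg (hπ x).le (hP x y))
      (fun x => by rw [← Finset.mul_sum, hP1, mul_one]) (fun x => by nlinarith [mul_pos hκ (hπ x)])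
  have hpr := (rho_exact (d := fun x => (1+κ) * π x) hP hP1 hπ hπ1 hm0 hq0 hq1 hd).1
  refine laplace_unique fun l hl => ?_
  have hdl : ∀ x, 0 < (1+κ) * π x + l x := fun x => add_pos_of_pos_of_nonneg (hd x) (hl x)
  set s : V → ℝ := fun x => (1+κ) * π x / ((1+κ) * π x + l x) with hsdef
  have hs : ∀ x, 0 ≤ s x := fun x => (div_pos (hd x) (hdl x)).le
  have hs1 : ∀ x, s x ≤ 1 := fun x => by rw [hsdef]; simp only; rw [div_le_one (hdl x)]; linarith [hl x]
  let z : ℕ → V → ℝ := fun j => Nat.rec (motive := fun _ => V → ℝ) s (fun _ u x => s x * ∑ y, P x y * u y) j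
  have hz0 : ∀ x, z 0 x = s x := fun x => rfl
  have hz : ∀ j x, z (j+1) x = s x * ∑ y, P x y * z j y := fun j x => rfl
  obtain ⟨f1, f2, f3⟩ := zz_facts (π := π) hP hP1 hs hs1 hq0 hq1 hz0 hz
  have hes := fun x => lint_eps_L hd hl x
  have hν := lint_nu (chiL_meas l) (chiL_add l) hP hs hπ hm0 hq0 hq1 hes hz0 hz f3
  have ht : 0 ≤ m * (1-q) * ∑' j, q^j * ∑ x, π x * z j x := by
    refine mul_nonneg (mul_nonneg hm0 (by linarith)) (tsum_nonneg fun j => mul_nonneg (pow_nonneg hq0 j) ?_)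
    exact Finset.sum_nonneg fun x _ => mul_nonneg (hπ x).le
      ((lint_NJ (chiL_meas l) (chiL_add l) hP hs hes hz0 hz j).1 x)
  have hρ := lint_rho (m := m) (chiL_meas l) (chiL_zero l) (chiL_add l) ht hν
  rw [lint_conv (chiL_meas l) (chiL_add l), hρ]
  rw [lap hP hP1 hπ hr hπ1 (h := 0) (v := 0) hκ hl (fun x => by simp [qm])]
  set Z : V → ℝ := fun x => ∑' j, q^j * z j x with hZ
  have hZe : ∀ x, ((1+κ) * π x + l x) * Z x = (1+κ) * π x + π x * ∑ y, P x y * Z y := by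
    intro x
    have h1 : Z x = s x + q * (s x * ∑ y, P x y * Z y) := f2 x
    have h2 : ((1+κ) * π x + l x) * s x = (1+κ) * π x := by
      simp only [hsdef]; field_simp [(hdl x).ne']
    calc ((1+κ) * π x + l x) * Z x = ((1+κ) * π x + l x) * s x + q * (((1+κ) * π x + l x) * s x) * ∑ y, P x y * Z y := by
          conv_lhs => rw [h1]
          ring
      _ = (1+κ) * π x + (q * (1+κ)) * (π x * ∑ y, P x y * Z y) := by rw [h2]; ring
      _ = _ := by rw [hqk]; ring
  rw [lap hP hP1 hπ hr hπ1 (h := h) (v := fun x => h * κ * q * Z x) hκ hl (fun x => by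
    have h1 := hZe x
    have h3 : ∑ y, π x * P x y * (h * κ * q * Z y) = h * κ * q * (π x * ∑ y, P x y * Z y) := by
      rw [Finset.mul_sum, Finset.mul_sum]; exact Finset.sum_congr rfl fun y _ => by ring
    simp only [qm]
    rw [h3]
    calc _ = h * κ * q * (((1+κ) * π x + l x) * Z x - π x * ∑ y, P x y * Z y) := by ring
      _ = h * κ * (q * (1+κ)) * π x := by rw [h1]; ring
      _ = _ := by rw [hqk]; ring)]
  have hI : 0 ≤ ∫ φ, gw (fun x => (1+κ) * π x + l x) (fun x y => π x * P x y) φ :=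
    integral_nonneg fun φ => (gw_pos _ _ φ).le
  rw [← ENNReal.ofReal_mul (mul_nonneg (Real.exp_pos _).le hI)]
  congr 1
  have e0 : (1/2 * ∑ x, 0 * κ * π x * (0 : V → ℝ) x - 0^2*κ/2 : ℝ) = 0 := by simp
  rw [e0, Real.exp_zero, one_mul, mul_comm]
  congr 2
  have e1 := tsum_pi_swap π f1
  have e2 : ∑ x, h * κ * π x * (h * κ * q * Z x) = h^2 * κ * (κ * q) * ∑ x, π x * Z x := by
    rw [Finset.mul_sum]; exact Finset.sum_congr rfl fun y _ => by ring
  have e3 : κ * q = 1 - q := by linarith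
  rw [e2, e3, hm, ← e1]
  ring

end PartA3


section PartD
open MeasureTheory ProbabilityTheory
open scoped ENNReal NNReal
variable {V : Type*} [Fintype V] [DecidableEq V]

lemma partA {P : V → V → ℝ} {π : V → ℝ} (hP : ∀ x y, 0 ≤ P x y) (hP1 : ∀ x, ∑ y, P x y = 1)
    (hπ : ∀ x, 0 < π x) (hr : ∀ x y, π x * P x y = π y * P y x) (hπ1 : ∑ x, π x = 1)
    {κ h m h0 : ℝ} (hκ : 0 < κ) (hm : h^2 * κ = 2 * m) (hh0 : 0 ≤ h0) (B : Finset V) {c : ℝ≥0∞}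
    (hc : ∀ x ∈ B, c ≤ mg (fun x => (1+κ) * π x) (fun x y => π x * P x y) {φ | |φ x| ≤ h0}) :
    ENNReal.ofReal (FF (GG P π m (1/(1+κ))) B) * c ≤
      mg (fun x => (1+κ) * π x) (fun x y => π x * P x y) {φ | ∃ x ∈ B, |φ x + h| ≤ h0} := by
  have hm0 : 0 ≤ m := by nlinarith [mul_nonneg (sq_nonneg h) hκ.le]
  have hdy := dynkin hP hP1 hπ hr hπ1 hκ hm
  set q := 1/(1+κ) with hq
  have hq0 : 0 ≤ q := by positivity
  have hq1 : q < 1 := by rw [hq, div_lt_one (by linarith)]; linarith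
  have hd : ∀ x, 0 < (1+κ) * π x := fun x => mul_pos (by linarith) (hπ x)
  have hfin : IsFiniteMeasure (mg (fun x => (1+κ) * π x) (fun x y => π x * P x y)) :=
    mg_finite (e := π) hr (fun x y => mul_nonneg (hπ x).le (hP x y))
      (fun x => by rw [← Finset.mul_sum, hP1, mul_one]) (fun x => by nlinarith [mul_pos hκ (hπ x)])
  obtain ⟨hpr, hex⟩ := rho_exact (d := fun x => (1+κ) * π x) hP hP1 hπ hπ1 hm0 hq0 hq1 hd
  set ρ := rhoM (nuM P π (fun x => (1+κ) * π x) m q) m with hρ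
  set μ := mg (fun x => (1+κ) * π x) (fun x y => π x * P x y) with hμ
  have hsq : ∀ (a : ℝ) (φ : V → ℝ) x, sqm a φ x ≤ (h0^2).toNNReal ↔ |φ x + a| ≤ h0 := by
    intro a φ x
    rw [sqm, Real.toNNReal_le_toNNReal_iff (sq_nonneg _), sq_le_sq, abs_of_nonneg hh0]
  set T : Set (V → ℝ≥0) := {y | ∃ x ∈ B, y x ≤ (h0^2).toNNReal} with hT
  have hTx : ∀ x : V, MeasurableSet {y : V → ℝ≥0 | y x ≤ (h0^2).toNNReal} := fun x =>
    measurableSet_le (measurable_pi_apply x) measurable_const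
  have hTm : MeasurableSet T := by
    have : T = ⋃ x ∈ B, {y : V → ℝ≥0 | y x ≤ (h0^2).toNNReal} := by ext y; simp [hT]
    rw [this]
    exact B.measurableSet_biUnion fun x _ => hTx x
  have e1 : μ {φ | ∃ x ∈ B, |φ x + h| ≤ h0} = (μ.map (sqm h)) T := by
    rw [Measure.map_apply (sqm_meas h) hTm]
    congr 1
    ext φ
    simp [hT, hsq]
  set N : Set (V → ℝ≥0) := {y | ∃ x ∈ B, y x = 0} with hN
  have hNu : N = ⋃ S ∈ Finset.univ.filter (fun S : Finset V => ¬ B ⊆ S), {y | ∀ x, y x ≠ 0 ↔ x ∈ S} := by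
    ext y
    simp only [hN, Set.mem_setOf_eq, Set.mem_iUnion, Finset.mem_filter, Finset.mem_univ, true_and, exists_prop]
    constructor
    · rintro ⟨x, hx, h⟩
      refine ⟨Finset.univ.filter fun x => y x ≠ 0, fun hs => ?_, fun x => by simp⟩
      exact (Finset.mem_filter.1 (hs hx)).2 h
    · rintro ⟨S, hS, h⟩
      obtain ⟨x, hx, hxS⟩ := Finset.not_subset.1 hS
      refine ⟨x, hx, ?_⟩
      by_contra hc
      exact hxS ((h x).1 hc)
  have hNm : MeasurableSet N := by
    have : N = ⋃ x ∈ B, {y : V → ℝ≥0 | y x = 0} := by ext y; simp [hN]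
    rw [this]
    exact B.measurableSet_biUnion fun x _ => measurableSet_eq_fun (measurable_pi_apply x) measurable_const
  have hNr : ρ.real N = FF (GG P π m q) B := by
    rw [hNu, measureReal_biUnion_finset]
    · simp only [hex]
      rw [FF, fl, Finset.sum_filter]
      refine Finset.sum_congr rfl fun S _ => ?_
      by_cases hS : B ⊆ S <;> simp [hS]
    · intro S _ T _ hST
      refine Set.disjoint_left.2 fun y hy hy' => hST ?_
      ext x
      rw [← hy x, ← hy' x]
    · intro S _
      simp only [Set.setOf_forall]
      refine MeasurableSet.iInter fun x => ?_
      by_cases hx : x ∈ S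
      · simp only [hx, iff_true]
        exact (measurableSet_eq_fun (measurable_pi_apply x) measurable_const).compl
      · simp only [hx, iff_false, not_not]
        exact measurableSet_eq_fun (measurable_pi_apply x) measurable_const
  rw [e1, hdy, Measure.conv_comm, ← hNr, ofReal_measureReal, ← lintegral_indicator_one hTm,
    Measure.lintegral_conv (measurable_one.indicator hTm), mul_comm, ← lintegral_indicator_const hNm]
  refine lintegral_mono fun y => ?_
  by_cases hy : y ∈ N
  · rw [Set.indicator_of_mem hy]
    obtain ⟨x, hx, hyx⟩ := hy
    refine (hc x hx).trans ?_
    have e2 : μ {φ | |φ x| ≤ h0} = (μ.map (sqm 0)) {y | y x ≤ (h0^2).toNNReal} := by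
      rw [Measure.map_apply (sqm_meas 0) (hTx x)]
      congr 1
      ext φ
      simp [hsq]
    rw [e2, ← lintegral_indicator_one (hTx x)]
    refine lintegral_mono fun w => ?_
    by_cases hw : w x ≤ (h0^2).toNNReal
    · have h1 : y + w ∈ T := ⟨x, hx, by simpa [hyx] using hw⟩
      rw [Set.indicator_of_mem h1, Set.indicator_of_mem (show w ∈ {y : V → ℝ≥0 | y x ≤ (h0^2).toNNReal} from hw)]
      exact le_rfl
    · rw [Set.indicator_of_notMem (show w ∉ {y : V → ℝ≥0 | y x ≤ (h0^2).toNNReal} from hw)]; exact zero_le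
  · rw [Set.indicator_of_notMem hy]; exact zero_le

lemma gw_negm (d : V → ℝ) (c : V → V → ℝ) (φ : V → ℝ) : gw d c (-φ) = gw d c φ := by
  rw [gw, qf_neg, gw]

lemma two_sided {P : V → V → ℝ} {π : V → ℝ} (hP : ∀ x y, 0 ≤ P x y) (hP1 : ∀ x, ∑ y, P x y = 1)
    (hπ : ∀ x, 0 < π x) (hr : ∀ x y, π x * P x y = π y * P y x) (hπ1 : ∑ x, π x = 1)
    {κ h m : ℝ} (hκ : 0 < κ) (hh : 0 ≤ h) (hm : h^2 * κ = 2 * m) (B : Finset V) :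
    (mg (fun x => (1+κ) * π x) (fun x y => π x * P x y)).real {φ | ∃ x ∈ B, h < |φ x|} ≤
      2 * FF (GG P π m (1/(1+κ))) B * (mg (fun x => (1+κ) * π x) (fun x y => π x * P x y)).real Set.univ := by
  have hB := partB hP hP1 hπ hπ1 hr hκ hh hm B
  set d : V → ℝ := fun x => (1+κ) * π x with hd
  set c : V → V → ℝ := fun x y => π x * P x y with hc
  have hcs : ∀ x y, c x y = c y x := hr
  have hc0 : ∀ x y, 0 ≤ c x y := fun x y => mul_nonneg (hπ x).le (hP x y)
  have he : ∀ x, ∑ y, c x y ≤ π x := fun x => by simp only [hc]; rw [← Finset.mul_sum, hP1, mul_one]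
  have hdl : ∀ x, π x < d x := fun x => by
    have := mul_pos hκ (hπ x); simp only [hd]; nlinarith
  have hfin : IsFiniteMeasure (mg d c) := mg_finite hcs hc0 he hdl
  have hm1 : MeasurableSet {φ : V → ℝ | ∀ x ∈ B, -h ≤ φ x} := by
    simp only [Set.setOf_forall]
    exact B.measurableSet_biInter fun x _ => measurableSet_le measurable_const (measurable_pi_apply x)
  have hm2 : MeasurableSet {φ : V → ℝ | ∀ x ∈ B, φ x ≤ h} := by
    simp only [Set.setOf_forall]
    exact B.measurableSet_biInter fun x _ => measurableSet_le (measurable_pi_apply x) measurable_const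
  have hZ : ∫ φ, gw d c φ = (mg d c).real Set.univ := by
    rw [← mg_real hcs hc0 he hdl MeasurableSet.univ]; simp
  have h1 : ∫ φ, {φ : V → ℝ | ∀ x ∈ B, -h ≤ φ x}.indicator (gw d c) φ = ∫ φ, {φ : V → ℝ | ∀ x ∈ B, φ x ≤ h}.indicator (gw d c) φ := by
    rw [← integral_neg_eq_self]
    refine integral_congr_ae (Filter.Eventually.of_forall fun φ => ?_)
    classical
    simp only [Set.indicator_apply, Set.mem_setOf_eq, Pi.neg_apply, neg_le_neg_iff, gw_negm]
  have h2 := hB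
  rw [h1, mg_real hcs hc0 he hdl hm2, hZ] at h2
  rw [mg_real hcs hc0 he hdl hm1, hZ] at hB
  have hsub : {φ : V → ℝ | ∃ x ∈ B, h < |φ x|} ⊆ {φ : V → ℝ | ∀ x ∈ B, -h ≤ φ x}ᶜ ∪ {φ : V → ℝ | ∀ x ∈ B, φ x ≤ h}ᶜ := by
    rintro φ ⟨x, hx, hφ⟩
    rcases lt_abs.1 hφ with h3 | h3
    · right; intro h4; linarith [h4 x hx]
    · left; intro h4; linarith [h4 x hx]
  have h3 := (measureReal_mono (μ := mg d c) hsub).trans (measureReal_union_le _ _)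
  rw [measureReal_compl hm1, measureReal_compl hm2] at h3
  linarith

lemma cmpP {P : V → V → ℝ} {π : V → ℝ} (hP : ∀ x y, 0 ≤ P x y) (hP1 : ∀ x, ∑ y, P x y = 1)
    (hπ : ∀ x, 0 < π x) (hr : ∀ x y, π x * P x y = π y * P y x) (hπ1 : ∑ x, π x = 1) : CmpP P π := by
  intro q1 q2 m hq2 hq21 hq1 hm B hf
  obtain rfl | hm := hm.eq_or_lt
  · have e : ∀ q, GG P π 0 q = 0 := by intro q; funext A; simp [GG]
    have e2 : (9 * 0 * ((1/q2-1)/(1/q1-1)) : ℝ) = 0 := by simp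
    rw [e2, e, e]
    have := FF_nonneg (0 : Finset V → ℝ) B
    linarith
  have hq10 : 0 < q1 := hq2.trans hq21
  obtain ⟨κ1, hκ1⟩ : ∃ κ, κ = 1/q1 - 1 := ⟨_, rfl⟩
  obtain ⟨κ2, hκ2⟩ : ∃ κ, κ = 1/q2 - 1 := ⟨_, rfl⟩
  have hk1 : 0 < κ1 := by rw [hκ1, sub_pos, lt_div_iff₀ hq10]; linarith
  have hk12 : κ1 < κ2 := by
    rw [hκ1, hκ2]
    have := one_div_lt_one_div_of_lt hq2 hq21
    linarith
  have hk2 := hk1.trans hk12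
  have eq1 : q1 = 1/(1+κ1) := by rw [hκ1]; simp
  have eq2 : q2 = 1/(1+κ2) := by rw [hκ2]; simp
  rw [← hκ1, ← hκ2]
  rw [eq1] at hf ⊢
  rw [eq2]
  set h := Real.sqrt (2*m/κ1) with hh
  have hh0 : 0 < h := Real.sqrt_pos.2 (by positivity)
  have hh2 : h^2 = 2*m/κ1 := Real.sq_sqrt (by positivity)
  have hm1 : h^2 * κ1 = 2*m := by rw [hh2]; field_simp
  have hm2 : (3*h)^2 * κ2 = 2*(9*m*(κ2/κ1)) := by rw [mul_pow, hh2]; ring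
  have hB := two_sided hP hP1 hπ hr hπ1 hk1 hh0.le hm1 B
  set f := FF (GG P π m (1/(1+κ1))) B with hfdef
  have hf0 : 0 ≤ f := FF_nonneg _ _
  set D : Set (V → ℝ) := {φ | ∃ x ∈ B, h < |φ x|} with hD
  have hDm : MeasurableSet D := by
    have : D = ⋃ x ∈ B, {φ : V → ℝ | h < |φ x|} := by ext φ; simp [hD]
    rw [this]
    exact B.measurableSet_biUnion fun x _ => measurableSet_lt measurable_const (by fun_prop)
  have hCs : ∀ x y, π x * P x y = π y * P y x := hr
  have hC0 : ∀ x y, 0 ≤ π x * P x y := fun x y => mul_nonneg (hπ x).le (hP x y)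
  have hCe : ∀ x, ∑ y, π x * P x y ≤ π x := fun x => by rw [← Finset.mul_sum, hP1, mul_one]
  have hd1 : ∀ x, π x < (1+κ1) * π x := fun x => by nlinarith [mul_pos hk1 (hπ x)]
  have hd2 : ∀ x, π x < (1+κ2) * π x := fun x => by nlinarith [mul_pos hk2 (hπ x)]
  have hCC := partC (d := fun x => (1+κ1) * π x) (δ := fun x => (κ2-κ1) * π x) (e := π)
    (c := fun x y => π x * P x y) hCs hC0 hCe hd1 (fun x => mul_pos (by linarith) (hπ x)) hDm (by
      rintro η ζ ⟨x, hx, hη⟩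
      by_cases h1 : h < |η x + ζ x|
      · exact Or.inl ⟨x, hx, h1⟩
      · right
        refine ⟨x, hx, ?_⟩
        simp only [Pi.sub_apply]
        rw [not_lt, abs_le] at h1
        rw [lt_abs] at hη ⊢
        rcases hη with h2 | h2
        · left; linarith [h1.2]
        · right; linarith [h1.1])
  have ed : (fun x => (1+κ1) * π x + (κ2-κ1) * π x) = fun x => (1+κ2) * π x := by funext x; ring
  rw [ed] at hCC
  have fin1 : IsFiniteMeasure (mg (fun x => (1+κ1) * π x) (fun x y => π x * P x y)) := mg_finite hCs hC0 hCe hd1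
  have fin2 : IsFiniteMeasure (mg (fun x => (1+κ2) * π x) (fun x y => π x * P x y)) := mg_finite hCs hC0 hCe hd2
  have nz1 := mg_ne_zero (fun x => (1+κ1) * π x) (fun x y => π x * P x y)
  have nz2 := mg_ne_zero (fun x => (1+κ2) * π x) (fun x y => π x * P x y)
  set μ1 := mg (fun x => (1+κ1) * π x) (fun x y => π x * P x y) with hμ1
  have hA := partA (h := 3*h) (h0 := h) (c := mg (fun x => (1+κ2) * π x) (fun x y => π x * P x y) Dᶜ)
    hP hP1 hπ hr hπ1 hk2 hm2 hh0.le B (by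
      intro x hx
      refine measure_mono fun φ hφ => ?_
      by_contra hc
      exact hφ ⟨x, hx, not_le.1 hc⟩)
  set μ2 := mg (fun x => (1+κ2) * π x) (fun x y => π x * P x y) with hμ2
  set F := FF (GG P π (9*m*(κ2/κ1)) (1/(1+κ2))) B with hF
  have hF0 : 0 ≤ F := FF_nonneg _ _
  have hA2 : ENNReal.ofReal F * μ2 Dᶜ ≤ μ2 D := by
    refine hA.trans (measure_mono ?_)
    rintro φ ⟨x, hx, h1⟩
    refine ⟨x, hx, ?_⟩
    rw [abs_le] at h1
    rw [lt_abs]; right; linarith [h1.2]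
  have hA3 : F * μ2.real Dᶜ ≤ μ2.real D := by
    have := ENNReal.toReal_mono (measure_ne_top μ2 D) hA2
    rwa [ENNReal.toReal_mul, ENNReal.toReal_ofReal hF0] at this
  have hC3 : μ2.real D * μ1.real Set.univ ≤ 2 * μ1.real D * μ2.real Set.univ := by
    have := ENNReal.toReal_mono (ENNReal.mul_ne_top (ENNReal.mul_ne_top (by simp) (measure_ne_top μ1 D)) (measure_ne_top μ2 _)) hCC
    simpa [ENNReal.toReal_mul, Measure.real] using this
  have z1 : 0 < μ1.real Set.univ := ENNReal.toReal_pos nz1 (measure_ne_top _ _)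
  have z2 : 0 < μ2.real Set.univ := ENNReal.toReal_pos nz2 (measure_ne_top _ _)
  rw [measureReal_compl hDm] at hA3
  have h4 : μ2.real D ≤ 4 * f * μ2.real Set.univ := by
    refine le_of_mul_le_mul_right ?_ z1
    calc _ ≤ _ := hC3
      _ ≤ 2 * (2 * f * μ1.real Set.univ) * μ2.real Set.univ := by gcongr
      _ = _ := by ring
  have h5 : μ2.real Set.univ / 2 ≤ μ2.real Set.univ - μ2.real D := by nlinarith
  have h6 : F * (μ2.real Set.univ / 2) ≤ 4 * f * μ2.real Set.univ :=
    (mul_le_mul_of_nonneg_left h5 hF0).trans (hA3.trans h4)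
  refine le_of_mul_le_mul_right ?_ z2
  linarith

end PartD


/-- There is a universal constant `C` such that for every finite
irreducible reversible chain and every `k`, for all starting states `x_1,…,x_k`,
`E_{x_1,…,x_k}[τ_cov(k)] ≤ C·(t_mix + t_cov/k)`. -/
theorem multi_cover_worst_start :
    ∃ C : ℝ, 0 < C ∧
      ∀ (V : Type) [Fintype V] [DecidableEq V] [Nonempty V]
        (P : V → V → ℝ) (π : V → ℝ),
        (∀ x y, 0 ≤ P x y) → (∀ x, ∑ y, P x y = 1) →
        (∀ x y, ∃ n : ℕ, 0 < (Matrix.of P ^ n) x y) →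
        (∀ x, 0 < π x) → (∑ x, π x = 1) →
        (∀ x y, π x * P x y = π y * P y x) →
        ∀ k : ℕ, 0 < k → ∀ x0 : Fin k → V,
          multiExpCov P k x0 ≤ C * ((tmix P π : ℝ) + tcov P / k) := by
  refine ⟨1000 * 2^14, by norm_num, ?_⟩
  intro V _ _ _ P π hP hP1 hirr hπ hπ1 hr k hk x0
  rcases subsingleton_or_nontrivial V with hV | hV
  · have h1 : multiExpCov P k x0 = 0 := by
      unfold multiExpCov pathSum
      have : ∀ (t : ℕ) (w : Fin (t+1) → Fin k → V), ∀ v : V, ∃ (i : Fin k) (t' : Fin (t+1)), w t' i = v :=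
        fun t w v => ⟨⟨0, hk⟩, 0, Subsingleton.elim _ _⟩
      simp [this]
    have h2 : 0 ≤ tcov P := by
      refine Real.iSup_nonneg fun x => ?_
      unfold expCov coverTail pathSum
      have : ∀ (t : ℕ) (w : Fin (t+1) → V), ∀ v : V, ∃ i : Fin (t+1), w i = v :=
        fun t w v => ⟨0, Subsingleton.elim _ _⟩
      simp [this]
    rw [h1]
    positivity
  · exact assemble hP hP1 hirr hπ hπ1 hr (cmpP hP hP1 hπ hr hπ1) k hk x0
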